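/- Let n ≥ 4 and let (W,S) be the affine Coxeter system of type D̃_n: S = {0,1,...,n} with m(0,2) = 3, m(1,2) = 3, m(i,i+1) = 3 for 2 ≤ i ≤ n−3, m(n−2,n−1) = 3, m(n−2,n) = 3, and all other pairs commuting (m = 2). Then for every k ≥ 0 and every d ≥ 2, the homology module H_k(C_*(W)) has no Φ_d²-torsion: every element x ∈ H_k(C_*(W)) with Φ_d² · x = 0 already satisfies Φ_d · x = 0. -/

import Mathlib

open Polynomial CoxeterSystem

set_option synthInstance.maxHeartbeats 1000000
set_option maxHeartbeats 1000000

noncomputable section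

/-- The ring `R = ℚ[q,q⁻¹]` of Laurent polynomials over `ℚ`. -/
abbrev R : Type := LaurentPolynomial ℚ

/-- The image of the `d`-th cyclotomic polynomial `Φ_d` in `R`. -/
def cyc (d : ℕ) : R := Polynomial.toLaurent (Polynomial.cyclotomic d ℚ)

/-- The `R`-module `R/(Φ_d)`. -/
abbrev CycQuot (d : ℕ) := R ⧸ Ideal.span {cyc d}

variable {B : Type*} [Fintype B] [LinearOrder B] {W : Type*} [Group W]
  {M : CoxeterMatrix B} (cs : CoxeterSystem M W)

/-- The standard parabolic subgroup `W_σ` generated by `σ ⊆ S`. -/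
def parabolic (σ : Finset B) : Subgroup W := Subgroup.closure (cs.simple '' σ)

/-- The Poincaré polynomial `W_σ(q) = Σ_{w ∈ W_σ} q^{ℓ(w)}` of the standard parabolic
subgroup `W_σ` (defined to be `0` if `W_σ` is infinite). -/
def poin (σ : Finset B) : ℚ[X] :=
  letI := Classical.dec ((parabolic cs σ : Set W).Finite)
  if h : (parabolic cs σ : Set W).Finite then ∑ w ∈ h.toFinset, X ^ cs.length w else 0

/-- The set of simplices `σ ∈ K_W` with `|σ| = k`, i.e. the subsets of `S` of
cardinality `k` generating a finite standard parabolic subgroup. -/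
abbrev KW (k : ℕ) := {σ : Finset B // σ.card = k ∧ (parabolic cs σ : Set W).Finite}

noncomputable instance (k : ℕ) : Fintype (KW cs k) := Fintype.ofFinite _

/-- The coefficient of `e_τ` in `∂ e_σ`: it is
`(−1)^{#{t ∈ σ : t < s}} · W_σ(q)/W_{σ∖{s}}(q)` if `τ = σ ∖ {s}` for some `s ∈ σ`,
and `0` otherwise. -/
def bcoeff (σ τ : Finset B) : R :=
  ∑ s ∈ σ, if τ = σ.erase s then
      (-1 : R) ^ (σ.filter (fun t => t < s)).card *
        Polynomial.toLaurent (poin cs σ / poin cs τ)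
    else 0

/-- The boundary map `∂ : C_{k+1} → C_k` of the weighted complex `C_*(W)`, where
`C_k = ⊕_{σ ∈ K_W, |σ| = k} R·e_σ`. -/
def bdry (k : ℕ) : (KW cs (k + 1) → R) →ₗ[R] (KW cs k → R) :=
  Matrix.mulVecLin (Matrix.of fun (τ : KW cs k) (σ : KW cs (k + 1)) => bcoeff cs σ.1 τ.1)

/-- The submodule of cycles in degree `k` of the weighted complex. -/
def cycles : (k : ℕ) → Submodule R (KW cs k → R)
  | 0 => ⊤
  | (k + 1) => LinearMap.ker (bdry cs k)

/-- The `k`-th homology `H_k(C_*(W))` of the weighted complex: cycles modulo boundaries. -/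
abbrev Hgy (k : ℕ) :=
  cycles cs k ⧸ Submodule.comap (cycles cs k).subtype (LinearMap.range (bdry cs k))

end

namespace CoxeterSystem

section Exchange

variable {G : Type*} [Group G]

open Classical in
/-- The involution `(t, ε) ↦ (a t a, ε + [t = a])` attached to an involution `a`. -/
noncomputable def signedConj (a : G) (ha : a * a = 1) : Equiv.Perm (G × ZMod 2) :=
  Function.Involutive.toPerm
    (fun x => (a * x.1 * a, x.2 + if x.1 = a then 1 else 0)) (by
      rintro ⟨t, ε⟩
      have h1 : a * (a * t * a) * a = t := by
        calc a * (a * t * a) * a = (a * a) * t * (a * a) := by group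
          _ = t := by simp [ha]
      have h2 : a * t * a = a ↔ t = a := by
        constructor
        · intro h
          rw [h, ha, one_mul] at h1
          exact h1.symm
        · rintro rfl; rw [ha, one_mul]
      simp only [h1, h2, Prod.mk.injEq, true_and]
      split_ifs
      · rw [add_assoc, CharTwo.add_self_eq_zero, add_zero]
      · simp)

open Classical in
theorem signedConj_apply (a : G) (ha : a * a = 1) (t : G) (ε : ZMod 2) :
    signedConj a ha (t, ε) = (a * t * a, ε + if t = a then 1 else 0) := rfl

open Classical in
theorem signedConj_mul_pow_apply {a b : G} (ha : a * a = 1) (hb : b * b = 1) (k : ℕ) (t : G)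
    (ε : ZMod 2) :
    ((signedConj a ha * signedConj b hb) ^ k) (t, ε) =
      ((a * b) ^ k * t * ((a * b) ^ k)⁻¹,
        ε + ∑ l ∈ Finset.range (2 * k), if t = b * (a * b) ^ l then 1 else 0) := by
  have hainv : a⁻¹ = a := inv_eq_of_mul_eq_one_left ha
  have hbinv : b⁻¹ = b := inv_eq_of_mul_eq_one_left hb
  have hconj : ∀ k : ℕ, b * (a * b) ^ k * b = ((a * b) ^ k)⁻¹ := by
    intro k
    have := (conj_pow (i := k) (a := b) (b := a * b)).symm
    rw [hbinv] at this
    rw [this, ← inv_pow]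
    congr 1
    rw [mul_inv_rev, hbinv, hainv, ← mul_assoc, mul_assoc (b * a), hb, mul_one]
  have hconj' : ∀ k : ℕ, b * (a * b) ^ k = ((a * b) ^ k)⁻¹ * b := by
    intro k
    rw [← hconj, mul_assoc (b * _), hb, mul_one]
  induction k with
  | zero => simp
  | succ k ih =>
    rw [pow_succ', Equiv.Perm.mul_apply, ih, Equiv.Perm.mul_apply, signedConj_apply,
      signedConj_apply]
    set u := a * b with hu
    have e1 : u ^ k * t * (u ^ k)⁻¹ = b ↔ t = b * u ^ (2 * k) := by
      rw [two_mul, pow_add, ← mul_assoc, hconj' k]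
      constructor
      · intro h; rw [← h]; group
      · intro h; rw [h]; group
    have e2 : b * (u ^ k * t * (u ^ k)⁻¹) * b = a ↔ t = b * u ^ (2 * k + 1) := by
      have : b * u ^ (2 * k + 1) = (u ^ k)⁻¹ * (b * a * b) * u ^ k := by
        rw [two_mul, add_assoc, pow_add, ← mul_assoc, hconj' k, pow_succ' u k, hu]
        simp only [mul_assoc]
      rw [this]
      constructor
      · intro h
        rw [← h]
        calc t = (u ^ k)⁻¹ * ((b * b) * (u ^ k * t * (u ^ k)⁻¹) * (b * b)) * u ^ k := by
              rw [hb]; group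
          _ = _ := by group
      · intro h
        rw [h]
        calc b * (u ^ k * ((u ^ k)⁻¹ * (b * a * b) * u ^ k) * (u ^ k)⁻¹) * b
            = (b * b) * a * (b * b) := by group
          _ = a := by rw [hb]; simp
    ext1
    · have : u⁻¹ = b * a := by rw [hu, mul_inv_rev, hainv, hbinv]
      rw [pow_succ' u k, mul_inv_rev, this]
      simp only [hu, mul_assoc]
    · simp only [e1, e2, mul_add, mul_one, Finset.sum_range_succ, add_assoc]

theorem signedConj_mul_pow_eq_one {a b : G} (ha : a * a = 1) (hb : b * b = 1) {m : ℕ}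
    (h : (a * b) ^ m = 1) : (signedConj a ha * signedConj b hb) ^ m = 1 := by
  classical
  ext1 ⟨t, ε⟩
  rw [signedConj_mul_pow_apply, h, two_mul, Finset.sum_range_add]
  simp only [pow_add, h, one_mul, CharTwo.add_self_eq_zero, add_zero]
  simp

variable {B : Type*} {W : Type*} [Group W] {M : CoxeterMatrix B} (cs : CoxeterSystem M W)

theorem isLiftable_signedConj : M.IsLiftable
    fun i => signedConj (cs.simple i) (cs.simple_mul_simple_self i) := fun i j =>
  signedConj_mul_pow_eq_one _ _ (cs.simple_mul_simple_pow i j)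

/-- The action of `W` on `W × ZMod 2` extending `signedConj` on the simple reflections. -/
noncomputable def signedAction : W →* Equiv.Perm (W × ZMod 2) :=
  cs.lift ⟨_, cs.isLiftable_signedConj⟩

open Classical in
theorem signedAction_wordProd (ω : List B) (t : W) (ε : ZMod 2) :
    cs.signedAction (cs.wordProd ω) (t, ε) =
      (cs.wordProd ω * t * (cs.wordProd ω)⁻¹, ε + ((cs.rightInvSeq ω).count t : ℕ)) := by
  induction ω with
  | nil => simp
  | cons i ω ih =>
    rw [wordProd_cons, map_mul, Equiv.Perm.mul_apply, ih, signedAction, lift_apply_simple,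
      signedConj_apply]
    have : cs.wordProd ω * t * (cs.wordProd ω)⁻¹ = cs.simple i ↔
        (cs.wordProd ω)⁻¹ * cs.simple i * cs.wordProd ω = t := by
      constructor
      · intro h; rw [← h]; group
      · intro h; rw [← h]; group
    ext1
    · simp [mul_assoc]
    · simp only [rightInvSeq, List.count_cons, this, beq_iff_eq]
      split_ifs <;> simp [add_assoc]

/-- The **exchange condition**: if `ℓ(ws) < ℓ(w)` then `ws` is obtained from any word for `w`
by erasing a letter. -/
theorem exchange (ω : List B) (i : B)
    (h : cs.length (cs.wordProd ω * cs.simple i) < cs.length (cs.wordProd ω)) :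
    ∃ j < ω.length, cs.wordProd ω * cs.simple i = cs.wordProd (ω.eraseIdx j) := by
  classical
  set w := cs.wordProd ω with hw
  obtain ⟨ω', hω', hw'⟩ := cs.exists_isReduced (w * cs.simple i)
  have hww : cs.wordProd (ω'.concat i) = w := by
    rw [wordProd_concat, ← hw', simple_mul_simple_cancel_right]
  have hred : cs.IsReduced (ω'.concat i) := by
    rw [IsReduced, hww, List.length_concat, ← hω'.eq, ← hw']
    have := cs.length_mul_simple w i
    omega
  have hmem : cs.simple i ∈ cs.rightInvSeq (ω'.concat i) := by
    rw [rightInvSeq_concat]; simp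
  have hc : (cs.rightInvSeq (ω'.concat i)).count (cs.simple i) = 1 :=
    List.count_eq_one_of_mem hred.nodup_rightInvSeq hmem
  have h1 := cs.signedAction_wordProd (ω'.concat i) (cs.simple i) 0
  have h2 := cs.signedAction_wordProd ω (cs.simple i) 0
  rw [hww, hc] at h1
  rw [← hw, h1] at h2
  have h3 : (cs.rightInvSeq ω).count (cs.simple i) ≠ 0 := by
    intro h0
    rw [h0] at h2
    simp at h2
  have h4 : cs.simple i ∈ cs.rightInvSeq ω := List.count_pos_iff.1 (Nat.pos_of_ne_zero h3)
  obtain ⟨j, hj, hji⟩ := List.mem_iff_getElem.1 h4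
  have hj' : j < ω.length := by simpa using hj
  refine ⟨j, hj', ?_⟩
  rw [← wordProd_mul_getD_rightInvSeq, List.getD_eq_getElem _ _ hj, hji]

end Exchange

end CoxeterSystem

namespace CoxeterSystem

section Parabolic

variable {B : Type*} {W : Type*} [Group W]
  {M : CoxeterMatrix B} (cs : CoxeterSystem M W)

theorem simple_mem_parabolic {σ : Finset B} {i : B} (hi : i ∈ σ) :
    cs.simple i ∈ parabolic cs σ :=
  Subgroup.subset_closure ⟨i, hi, rfl⟩

theorem parabolic_mono {σ τ : Finset B} (h : τ ⊆ σ) : parabolic cs τ ≤ parabolic cs σ :=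
  Subgroup.closure_mono (Set.image_mono (by exact_mod_cast h))

theorem wordProd_mem_parabolic {σ : Finset B} {ω : List B} (hω : ∀ i ∈ ω, i ∈ σ) :
    cs.wordProd ω ∈ parabolic cs σ := by
  induction ω with
  | nil => simp
  | cons i ω ih =>
    rw [wordProd_cons]
    exact mul_mem (cs.simple_mem_parabolic (hω i (by simp)))
      (ih fun j hj => hω j (by simp [hj]))

theorem exists_word_of_mem_parabolic {σ : Finset B} {w : W} (hw : w ∈ parabolic cs σ) :
    ∃ ω : List B, (∀ i ∈ ω, i ∈ σ) ∧ w = cs.wordProd ω := by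
  induction hw using Subgroup.closure_induction with
  | mem x hx =>
    obtain ⟨i, hi, rfl⟩ := hx
    exact ⟨[i], by simpa using hi, by simp⟩
  | one => exact ⟨[], by simp, by simp⟩
  | mul x y _ _ hx hy =>
    obtain ⟨ω, h1, rfl⟩ := hx
    obtain ⟨ω', h2, rfl⟩ := hy
    refine ⟨ω ++ ω', fun i hi => ?_, by rw [wordProd_append]⟩
    rcases List.mem_append.1 hi with h | h
    exacts [h1 i h, h2 i h]
  | inv x _ hx =>
    obtain ⟨ω, h1, rfl⟩ := hx
    exact ⟨ω.reverse, fun i hi => h1 i (by simpa using hi), by rw [wordProd_reverse]⟩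

/-- If `i` is a right descent of `w ∈ W_σ`, then `sᵢ ∈ W_σ`. -/
theorem simple_mem_parabolic_of_descent {σ : Finset B} {w : W} (hw : w ∈ parabolic cs σ) {i : B}
    (h : cs.length (w * cs.simple i) < cs.length w) : cs.simple i ∈ parabolic cs σ := by
  obtain ⟨ω, hω, rfl⟩ := cs.exists_word_of_mem_parabolic hw
  obtain ⟨j, -, hj⟩ := cs.exchange ω i h
  have h2 : cs.wordProd (ω.eraseIdx j) ∈ parabolic cs σ :=
    cs.wordProd_mem_parabolic fun i hi => hω i (List.mem_of_mem_eraseIdx hi)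
  rw [← hj] at h2
  exact (Subgroup.mul_mem_cancel_left _ hw).1 h2

theorem exists_isReduced_of_mem_parabolic {σ : Finset B} {w : W} (hw : w ∈ parabolic cs σ) :
    ∃ ω : List B, (∀ i ∈ ω, i ∈ σ) ∧ cs.IsReduced ω ∧ w = cs.wordProd ω := by
  obtain ⟨ω, hω, rfl⟩ := cs.exists_word_of_mem_parabolic hw
  clear hw
  induction ω using List.reverseRecOn with
  | nil => exact ⟨[], by simp, by simp [IsReduced], rfl⟩
  | append_singleton ω i ih =>
    obtain ⟨ω', h1, h2, h3⟩ := ih fun j hj => hω j (by simp [hj])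
    have hi : i ∈ σ := hω i (by simp)
    rw [wordProd_append, wordProd_singleton, h3]
    rcases cs.length_mul_simple (cs.wordProd ω') i with h | h
    · refine ⟨ω' ++ [i], ?_, ?_, by rw [wordProd_append, wordProd_singleton]⟩
      · intro j hj
        rcases List.mem_append.1 hj with hj | hj
        · exact h1 j hj
        · rw [List.mem_singleton.1 hj]; exact hi
      · rw [IsReduced, wordProd_append, wordProd_singleton, h, h2.eq]; simp
    · obtain ⟨j, hj, hj'⟩ := cs.exchange ω' i (by omega)
      refine ⟨ω'.eraseIdx j, fun i hi => h1 i (List.mem_of_mem_eraseIdx hi), ?_, hj'⟩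
      rw [IsReduced, ← hj']
      have := h2.eq
      have := List.length_eraseIdx_add_one hj
      omega

/-- `d` has minimal length in its coset `d W_τ`. -/
def IsMinimal (τ : Finset B) (d : W) : Prop :=
  ∀ u ∈ parabolic cs τ, cs.length d ≤ cs.length (d * u)

theorem IsMinimal.length_mul {cs : CoxeterSystem M W} {τ : Finset B} {d : W}
    (hd : cs.IsMinimal τ d) {u : W}
    (hu : u ∈ parabolic cs τ) : cs.length (d * u) = cs.length d + cs.length u := by
  obtain ⟨ω, hω, hr, rfl⟩ := cs.exists_isReduced_of_mem_parabolic hu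
  clear hu
  rw [hr.eq]
  induction ω using List.reverseRecOn with
  | nil => simp
  | append_singleton ω i ih =>
    have hω' : ∀ j ∈ ω, j ∈ τ := fun j hj => hω j (by simp [hj])
    have hr' : cs.IsReduced ω := by simpa using hr.take ω.length
    have ih' := ih hω' hr'
    have hi : i ∈ τ := hω i (by simp)
    have hlen := hr.eq
    rw [List.length_append, List.length_singleton, wordProd_append, wordProd_singleton] at *
    rcases cs.length_mul_simple (d * cs.wordProd ω) i with h | h
    · rw [← mul_assoc]; omega
    · exfalso
      obtain ⟨ωd, hd1, hd2⟩ := cs.exists_isReduced d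
      have hdl : cs.length d = ωd.length := by rw [hd2, hd1.eq]
      have key := cs.exchange (ωd ++ ω) i (by rw [wordProd_append, ← hd2]; omega)
      obtain ⟨j, hj, hj'⟩ := key
      rw [wordProd_append, ← hd2] at hj'
      rw [List.length_append] at hj
      by_cases hjd : j < ωd.length
      · rw [List.eraseIdx_append_of_lt_length hjd, wordProd_append] at hj'
        have h1 : cs.wordProd (ωd.eraseIdx j) =
            d * (cs.wordProd ω * cs.simple i * (cs.wordProd ω)⁻¹) := by
          rw [← mul_assoc, ← mul_assoc, hj', mul_inv_cancel_right]
        have h2 := hd (cs.wordProd ω * cs.simple i * (cs.wordProd ω)⁻¹)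
          (mul_mem (mul_mem (cs.wordProd_mem_parabolic hω') (cs.simple_mem_parabolic hi))
            (inv_mem (cs.wordProd_mem_parabolic hω')))
        rw [← h1] at h2
        have h3 := cs.length_wordProd_le (ωd.eraseIdx j)
        have := List.length_eraseIdx_add_one hjd
        omega
      · rw [List.eraseIdx_append_of_length_le (not_lt.1 hjd), wordProd_append, ← hd2,
          mul_assoc, mul_right_inj] at hj'
        have h3 := cs.length_wordProd_le (ω.eraseIdx (j - ωd.length))
        have := List.length_eraseIdx_add_one (l := ω) (i := j - ωd.length) (by omega)
        rw [← hj'] at h3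
        omega

theorem IsMinimal.eq_of_mul_eq {cs : CoxeterSystem M W} {τ : Finset B} {d d' : W}
    (hd : cs.IsMinimal τ d) (hd' : cs.IsMinimal τ d')
    {u : W} (hu : u ∈ parabolic cs τ) (h : d' = d * u) : d' = d := by
  have h1 := hd.length_mul hu
  have h2 := hd' _ (inv_mem hu)
  rw [h, mul_inv_cancel_right] at h2
  have : u = 1 := cs.length_eq_zero_iff.1 (by omega)
  rw [h, this, mul_one]

theorem isMinimal_of_forall_simple {τ : Finset B} {d : W}
    (h : ∀ i ∈ τ, cs.length d < cs.length (d * cs.simple i)) : cs.IsMinimal τ d := by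
  obtain ⟨u, hu, hmin⟩ : ∃ u ∈ parabolic cs τ, ∀ v ∈ parabolic cs τ,
      cs.length (d * u) ≤ cs.length (d * v) := by
    have hne : Set.Nonempty ((parabolic cs τ : Subgroup W) : Set W) := ⟨1, one_mem _⟩
    have hwf := (measure fun u : W => cs.length (d * u)).wf
    exact ⟨hwf.min _ hne, hwf.min_mem _ hne, fun v hv => not_lt.1 (hwf.not_lt_min _ hv)⟩
  have hm : cs.IsMinimal τ (d * u) := fun v hv => by
    rw [mul_assoc]; exact hmin _ (mul_mem hu hv)
  suffices u = 1 by rw [this, mul_one] at hm; exact hm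
  by_contra hne
  obtain ⟨ω, hω, hr, hv⟩ := cs.exists_isReduced_of_mem_parabolic (inv_mem hu)
  rcases List.eq_nil_or_concat ω with rfl | ⟨ω', i, rfl⟩
  · exact hne (by simpa using hv)
  have hi : i ∈ τ := hω i (by simp)
  have h1 := hm.length_mul (inv_mem hu)
  have h2 := hm.length_mul (mul_mem (inv_mem hu) (cs.simple_mem_parabolic hi))
  have h3 := h i hi
  rw [← mul_assoc, mul_inv_cancel_right] at h2
  rw [mul_inv_cancel_right] at h1
  have h4 : u⁻¹ * cs.simple i = cs.wordProd ω' := by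
    rw [hv, List.concat_eq_append, wordProd_append, wordProd_singleton,
      simple_mul_simple_cancel_right]
  have h5 := cs.length_wordProd_le ω'
  rw [← h4] at h5
  have h6 := hr.eq
  rw [← hv] at h6
  simp at h6
  rw [cs.length_inv] at h1
  omega

theorem exists_isMinimal (τ : Finset B) (w : W) :
    ∃ d, cs.IsMinimal τ d ∧ ∃ u ∈ parabolic cs τ, w = d * u := by
  have hne : Set.Nonempty ((parabolic cs τ : Subgroup W) : Set W) := ⟨1, one_mem _⟩
  have hwf := (measure fun u : W => cs.length (w * u)).wf
  have h1 := hwf.min_mem _ hne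
  refine ⟨w * hwf.min _ hne, fun v hv => ?_, _, inv_mem h1, by group⟩
  rw [mul_assoc]
  exact not_lt.1 (hwf.not_lt_min _ (mul_mem h1 hv))

theorem poin_eq_sum (σ : Finset B) [Fintype (parabolic cs σ)] :
    poin cs σ = ∑ w : parabolic cs σ, X ^ cs.length (w : W) := by
  have h : (parabolic cs σ : Set W).Finite := Set.toFinite _
  rw [poin, dif_pos h]
  refine Finset.sum_bij' (fun w hw => ⟨w, by simpa using hw⟩) (fun w _ => w.1) ?_ ?_ ?_ ?_ ?_ <;>
    simp

/-- Factorisation of the Poincaré polynomial along a system of minimal coset representatives. -/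
theorem finite_and_poin_eq_of_transversal {σ τ : Finset B}
    (hτ : (parabolic cs τ : Set W).Finite) (hτσ : τ ⊆ σ) {Y : Type*} [Fintype Y] (r : Y → W)
    (hr : Function.Injective r) (hmem : ∀ y, r y ∈ parabolic cs σ)
    (hmin : ∀ y, cs.IsMinimal τ (r y))
    (hsurj : ∀ w ∈ parabolic cs σ, ∃ y, ∃ u ∈ parabolic cs τ, w = r y * u) :
    (parabolic cs σ : Set W).Finite ∧
      poin cs σ = (∑ y, X ^ cs.length (r y)) * poin cs τ := by
  have : Finite (parabolic cs τ) := hτ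
  have := Fintype.ofFinite (parabolic cs τ)
  have hbij : Function.Bijective (fun p : Y × parabolic cs τ =>
      (⟨r p.1 * p.2, mul_mem (hmem _) (cs.parabolic_mono hτσ p.2.2)⟩ : parabolic cs σ)) := by
    constructor
    · rintro ⟨y, u, hu⟩ ⟨y', u', hu'⟩ h
      simp only [Subtype.mk.injEq] at h
      have h1 : r y' = r y * (u * u'⁻¹) := by rw [← mul_assoc, h, mul_inv_cancel_right]
      have h2 := hr ((hmin y).eq_of_mul_eq (hmin y') (mul_mem hu (inv_mem hu')) h1)
      subst h2
      simpa using h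
    · rintro ⟨w, hw⟩
      obtain ⟨y, u, hu, rfl⟩ := hsurj w hw
      exact ⟨(y, ⟨u, hu⟩), rfl⟩
  have hfin : Finite (parabolic cs σ) := Finite.of_surjective _ hbij.2
  refine ⟨hfin, ?_⟩
  have := Fintype.ofFinite (parabolic cs σ)
  rw [poin_eq_sum, poin_eq_sum, Finset.sum_mul_sum, ← Finset.sum_product',
    ← (Equiv.ofBijective _ hbij).sum_comp]
  refine Finset.sum_congr (by simp) fun p _ => ?_
  simp [← pow_add, (hmin p.1).length_mul p.2.2]

theorem poin_dvd_of_subset {σ τ : Finset B} (h : τ ⊆ σ) (hσ : (parabolic cs σ : Set W).Finite) :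
    poin cs τ ∣ poin cs σ := by
  have : Finite (parabolic cs σ) := hσ
  let Y := {w : parabolic cs σ // cs.IsMinimal τ w}
  have : Fintype Y := Fintype.ofFinite _
  refine ⟨_, ((cs.finite_and_poin_eq_of_transversal (hσ.subset (cs.parabolic_mono h)) h
    (fun y : Y => y.1.1) (fun y y' hy => Subtype.ext (Subtype.ext hy)) (fun y => y.1.2)
    (fun y => y.2) ?_).2).trans (mul_comm _ _)⟩
  intro w hw
  obtain ⟨d, hd, u, hu, hdu⟩ := cs.exists_isMinimal τ w
  have : d ∈ parabolic cs σ := by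
    rw [hdu] at hw
    exact (Subgroup.mul_mem_cancel_right _ (cs.parabolic_mono h hu)).1 hw
  exact ⟨⟨⟨d, this⟩, hd⟩, u, hu, hdu⟩

theorem poin_ne_zero {σ : Finset B} (hσ : (parabolic cs σ : Set W).Finite) :
    poin cs σ ≠ 0 := by
  have : Finite (parabolic cs σ) := hσ
  have := Fintype.ofFinite (parabolic cs σ)
  intro h
  have h1 := congrArg (Polynomial.eval 1) h
  rw [poin_eq_sum, Polynomial.eval_finsetSum] at h1
  simp at h1

theorem finite_parabolic_empty : (parabolic cs ∅ : Set W).Finite := by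
  simp [parabolic]

theorem poin_empty : poin cs ∅ = 1 := by
  have : parabolic cs ∅ = ⊥ := by simp [parabolic]
  rw [poin, dif_pos cs.finite_parabolic_empty]
  have h2 : cs.finite_parabolic_empty.toFinset = {1} := by
    ext x; simp [this]
  rw [h2]; simp

/-- Multiplicativity of Poincaré polynomials over commuting sets of generators. -/
theorem finite_and_poin_union [DecidableEq B] (hinj : Function.Injective cs.simple) {σ τ : Finset B}
    (hσ : (parabolic cs σ : Set W).Finite) (hτ : (parabolic cs τ : Set W).Finite)
    (hdisj : ∀ i ∈ σ, i ∉ τ) (hcomm : ∀ i ∈ σ, ∀ j ∈ τ, M i j = 2) :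
    (parabolic cs (σ ∪ τ) : Set W).Finite ∧ poin cs (σ ∪ τ) = poin cs σ * poin cs τ := by
  have : Finite (parabolic cs σ) := hσ
  have := Fintype.ofFinite (parabolic cs σ)
  rw [poin_eq_sum cs σ]
  refine cs.finite_and_poin_eq_of_transversal hτ Finset.subset_union_right
    (fun y : parabolic cs σ => (y : W)) Subtype.val_injective
    (fun y => cs.parabolic_mono Finset.subset_union_left y.2) ?_ ?_
  · rintro ⟨w, hw⟩
    refine cs.isMinimal_of_forall_simple fun i hi => ?_
    by_contra hlt
    have h0 := cs.length_mul_simple_ne w i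
    have h1 := cs.simple_mem_parabolic_of_descent hw (i := i)
      (lt_of_le_of_ne (not_lt.1 hlt) h0)
    obtain ⟨ω, hω, hr, h2⟩ := cs.exists_isReduced_of_mem_parabolic h1
    have h3 : ω.length = 1 := by rw [← hr.eq, ← h2, length_simple]
    obtain ⟨j, rfl⟩ := List.length_eq_one_iff.1 h3
    rw [wordProd_singleton] at h2
    exact hdisj i (hinj h2 ▸ hω j (by simp)) hi
  · intro w hw
    obtain ⟨ω, hω, rfl⟩ := cs.exists_word_of_mem_parabolic hw
    clear hw
    induction ω with
    | nil => exact ⟨1, 1, one_mem _, by simp⟩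
    | cons i ω ih =>
      obtain ⟨⟨y, hy⟩, u, hu, h⟩ := ih fun j hj => hω j (by simp [hj])
      rw [wordProd_cons, h]
      rcases Finset.mem_union.1 (hω i (by simp)) with hi | hi
      · exact ⟨⟨cs.simple i * y, mul_mem (cs.simple_mem_parabolic hi) hy⟩, u, hu,
          (mul_assoc _ _ _).symm⟩
      · refine ⟨⟨y, hy⟩, cs.simple i * u, mul_mem (cs.simple_mem_parabolic hi) hu, ?_⟩
        have hc : y ∈ Subgroup.centralizer {cs.simple i} := by
          refine (Subgroup.closure_le _).2 ?_ hy
          rintro _ ⟨j, hj, rfl⟩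
          rw [SetLike.mem_coe, Subgroup.mem_centralizer_singleton_iff]
          have h2 := cs.simple_mul_simple_pow j i
          rw [hcomm j hj i hi, pow_two] at h2
          have h3 := eq_inv_of_mul_eq_one_left h2
          rw [mul_inv_rev, inv_simple, inv_simple] at h3
          exact h3
        rw [Subgroup.mem_centralizer_singleton_iff] at hc
        change cs.simple i * (y * u) = y * (cs.simple i * u)
        rw [← mul_assoc, ← mul_assoc, hc]

/-- The automorphism of `W` induced by a permutation of the generators. -/
theorem exists_mulEquiv_of_symm (e : B ≃ B) (he : ∀ i j, M (e i) (e j) = M i j) :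
    ∃ φ : W ≃* W, (∀ i, φ (cs.simple i) = cs.simple (e i)) ∧
      ∀ w, cs.length (φ w) = cs.length w := by
  have h1 : M.IsLiftable fun i => cs.simple (e i) := fun i j => by
    rw [← he]; exact cs.simple_mul_simple_pow _ _
  have h2 : M.IsLiftable fun i => cs.simple (e.symm i) := fun i j => by
    rw [← e.apply_symm_apply i, ← e.apply_symm_apply j, he]
    simp
  have key : ∀ (f : B → B) (φ : W →* W) (_ : ∀ i, φ (cs.simple i) = cs.simple (f i)) (w : W),
      cs.length (φ w) ≤ cs.length w := by
    intro f φ hφ w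
    obtain ⟨ω, hω, rfl⟩ := cs.exists_isReduced w
    have : φ (cs.wordProd ω) = cs.wordProd (ω.map f) := by
      simp [wordProd, map_list_prod, hφ, Function.comp_def]
    rw [this, hω.eq]
    simpa using cs.length_wordProd_le (ω.map f)
  have a1 : ∀ i, cs.lift ⟨_, h1⟩ (cs.simple i) = cs.simple (e i) := fun i =>
    cs.lift_apply_simple h1 i
  have a2 : ∀ i, cs.lift ⟨_, h2⟩ (cs.simple i) = cs.simple (e.symm i) := fun i =>
    cs.lift_apply_simple h2 i
  have b1 : (cs.lift ⟨_, h2⟩).comp (cs.lift ⟨_, h1⟩) = MonoidHom.id W :=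
    cs.ext_simple fun i => by simp [a1, a2]
  have b2 : (cs.lift ⟨_, h1⟩).comp (cs.lift ⟨_, h2⟩) = MonoidHom.id W :=
    cs.ext_simple fun i => by simp [a1, a2]
  refine ⟨MonoidHom.toMulEquiv _ _ b1 b2, a1, fun w => le_antisymm (key _ _ a1 w) ?_⟩
  have := key _ _ a2 (cs.lift ⟨_, h1⟩ w)
  rwa [← MonoidHom.comp_apply, b1] at this

theorem finite_iff_and_poin_map_of_symm (e : B ≃ B) (he : ∀ i j, M (e i) (e j) = M i j)
    (σ : Finset B) :
    ((parabolic cs (σ.map e.toEmbedding) : Set W).Finite ↔ (parabolic cs σ : Set W).Finite) ∧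
      poin cs (σ.map e.toEmbedding) = poin cs σ := by
  obtain ⟨φ, hφ, hlen⟩ := cs.exists_mulEquiv_of_symm e he
  have hmap : parabolic cs (σ.map e.toEmbedding) = (parabolic cs σ).map φ.toMonoidHom := by
    rw [parabolic, parabolic, MonoidHom.map_closure]
    congr 1
    ext x
    simp only [Finset.coe_map, Set.mem_image, Finset.mem_coe, exists_exists_and_eq_and,
      Equiv.coe_toEmbedding, MulEquiv.toMonoidHom_eq_coe, MonoidHom.coe_coe, hφ]
  have hfin : (parabolic cs (σ.map e.toEmbedding) : Set W).Finite ↔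
      (parabolic cs σ : Set W).Finite := by
    rw [hmap, Subgroup.coe_map]
    exact Set.finite_image_iff φ.injective.injOn
  refine ⟨hfin, ?_⟩
  by_cases h : (parabolic cs σ : Set W).Finite
  · have : Finite (parabolic cs σ) := h
    have : Finite (parabolic cs (σ.map e.toEmbedding)) := hfin.2 h
    have := Fintype.ofFinite (parabolic cs σ)
    have := Fintype.ofFinite (parabolic cs (σ.map e.toEmbedding))
    rw [poin_eq_sum, poin_eq_sum]
    have hbij : Function.Bijective (fun w : parabolic cs σ =>
        (⟨φ w, by rw [hmap]; exact ⟨w, w.2, rfl⟩⟩ : parabolic cs (σ.map e.toEmbedding))) := by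
      constructor
      · intro x y h
        exact Subtype.ext (φ.injective (Subtype.ext_iff.1 h))
      · rintro ⟨x, hx⟩
        rw [hmap] at hx
        obtain ⟨y, hy, rfl⟩ := hx
        exact ⟨⟨y, hy⟩, rfl⟩
    rw [← (Equiv.ofBijective _ hbij).sum_comp]
    exact Finset.sum_congr rfl fun w _ => by simp [hlen]
  · rw [poin, poin, dif_neg h, dif_neg (mt hfin.1 h)]

end Parabolic

end CoxeterSystem

namespace CoxeterSystem

section NumbersGame

variable {B : Type*} [DecidableEq B] {W : Type*} [Group W] {M : CoxeterMatrix B}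

/-- The Cartan integers of a simply laced Coxeter matrix. -/
def cartan (M : CoxeterMatrix B) (i j : B) : ℤ :=
  if i = j then 2 else if M i j = 3 then -1 else 0

theorem cartan_self (i : B) : cartan M i i = 2 := if_pos rfl

/-- The move of the numbers game at the node `i`. -/
def move (M : CoxeterMatrix B) (i : B) : Module.End ℤ (B → ℤ) where
  toFun f j := f j - f i * cartan M i j
  map_add' f g := by ext j; simp; ring
  map_smul' c f := by ext j; simp; ring

theorem move_apply (i : B) (f : B → ℤ) (j : B) :
    move M i f j = f j - f i * cartan M i j := rfl

omit [DecidableEq B] in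
theorem isLiftable_of_simplyLaced [DecidableEq B] (hM : ∀ i j, i ≠ j → M i j = 2 ∨ M i j = 3) :
    M.IsLiftable (move M) := by
  intro i j
  have hii : ∀ i, cartan M i i = 2 := fun i => by simp [cartan]
  by_cases hij : i = j
  · subst hij
    rw [M.diagonal i, pow_one]
    refine LinearMap.ext fun f => funext fun k => ?_
    simp only [Module.End.mul_apply, move_apply, hii, Module.End.one_apply]
    ring
  · have hs : M j i = M i j := (M.symmetric i j).symm
    rcases hM i j hij with h | h
    · have h1 : cartan M i j = 0 := by simp [cartan, hij, h]
      have h2 : cartan M j i = 0 := by simp [cartan, Ne.symm hij, hs, h]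
      rw [h]
      refine LinearMap.ext fun f => funext fun k => ?_
      simp only [pow_two, Module.End.mul_apply, move_apply, hii, h1, h2, Module.End.one_apply]
      ring
    · have h1 : cartan M i j = -1 := by simp [cartan, hij, h]
      have h2 : cartan M j i = -1 := by simp [cartan, Ne.symm hij, hs, h]
      rw [h]
      refine LinearMap.ext fun f => funext fun k => ?_
      simp only [pow_succ, pow_zero, one_mul, Module.End.mul_apply, move_apply, hii, h1, h2,
        Module.End.one_apply]
      ring

variable (cs : CoxeterSystem M W) (hM : ∀ i j, i ≠ j → M i j = 2 ∨ M i j = 3)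

/-- The representation of `W` given by the numbers game. -/
noncomputable def numbersGame : W →* Module.End ℤ (B → ℤ) :=
  cs.lift ⟨_, isLiftable_of_simplyLaced hM⟩

theorem numbersGame_simple (i : B) : cs.numbersGame hM (cs.simple i) = move M i :=
  cs.lift_apply_simple _ i

include hM in
theorem simple_injective : Function.Injective cs.simple := by
  intro i j hij
  by_contra hne
  have h := congrArg (fun w => cs.numbersGame hM w (Pi.single i 1) i) hij
  simp [numbersGame_simple, move_apply, Pi.single_eq_of_ne (Ne.symm hne), cartan] at h

include cs hM in
theorem infinite_of_marks [Fintype B] [Nonempty B] (c : B → ℤ) (hpos : ∀ i, 0 < c i)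
    (hc : ∀ i, ∑ j, cartan M i j * c j = 0) : Infinite W := by
  by_contra hfin
  rw [not_infinite_iff_finite] at hfin
  have := Fintype.ofFinite W
  have hlevel : ∀ (w : W) (f : B → ℤ), ∑ j, c j * cs.numbersGame hM w f j = ∑ j, c j * f j := by
    intro w
    induction w using cs.simple_induction_left with
    | one => simp
    | mul_simple_left w i ih =>
      intro f
      rw [map_mul, numbersGame_simple, Module.End.mul_apply]
      simp only [move_apply, mul_sub, Finset.sum_sub_distrib, ih]
      have : ∑ j, c j * (cs.numbersGame hM w f i * cartan M i j) = 0 := by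
        rw [← mul_zero (cs.numbersGame hM w f i), ← hc i, Finset.mul_sum]
        exact Finset.sum_congr rfl fun j _ => by ring
      rw [this, sub_zero]
  set F : B → ℤ := ∑ w : W, cs.numbersGame hM w 1 with hF
  have hinv : ∀ i, move M i F = F := by
    intro i
    rw [hF, map_sum, ← cs.numbersGame_simple hM i]
    simp only [← Module.End.mul_apply, ← map_mul]
    exact Equiv.sum_comp (Equiv.mulLeft (cs.simple i)) fun w => cs.numbersGame hM w 1
  have hzero : ∀ i, F i = 0 := by
    intro i
    have h := congrFun (hinv i) i
    rw [move_apply] at h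
    simp [cartan] at h
    exact h
  have h1 : ∑ j, c j * F j = Fintype.card W * ∑ j, c j := by
    calc ∑ j, c j * F j = ∑ j, ∑ w : W, c j * cs.numbersGame hM w 1 j := by
          refine Finset.sum_congr rfl fun j _ => ?_
          rw [hF, Finset.sum_apply, Finset.mul_sum]
      _ = ∑ w : W, ∑ j, c j * cs.numbersGame hM w 1 j := Finset.sum_comm
      _ = _ := by simp [hlevel]
  have h2 : 0 < ∑ j, c j := Finset.sum_pos (fun i _ => hpos i) Finset.univ_nonempty
  have h3 : (0 : ℤ) < Fintype.card W := by exact_mod_cast Fintype.card_pos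
  have h4 := mul_pos h3 h2
  rw [← h1] at h4
  simp [hzero] at h4

/-- A finite combinatorial model of the `W_σ`-orbit of the fundamental weight at `s` which is
minuscule for `W_σ`: `val y` records the numbers on the nodes of `σ`, `act t` is the move at `t`
and `ht` the number of moves needed to reach a state from the initial one. -/
structure MinusculeOrbit (M : CoxeterMatrix B) (σ : Finset B) (s : B) (Y : Type*) where
  val : Y → B → ℤ
  act : B → Y → Y
  ht : Y → ℕ
  init : Y
  mem : s ∈ σ
  val_act : ∀ t ∈ σ, ∀ y, ∀ u ∈ σ, val (act t y) u = val y u - val y t * cartan M t u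
  val_cases : ∀ t ∈ σ, ∀ y, val y t = -1 ∨ val y t = 0 ∨ val y t = 1
  val_injective : ∀ y y', (∀ t ∈ σ, val y t = val y' t) → y = y'
  ht_act : ∀ t ∈ σ, ∀ y, val y t = 1 → ht (act t y) = ht y + 1
  val_init : ∀ t ∈ σ, val init t = if t = s then 1 else 0
  ht_init : ht init = 0
  exists_down : ∀ y, y ≠ init → ∃ t ∈ σ, val y t = -1

namespace MinusculeOrbit

variable {σ : Finset B} {s : B} {Y : Type*} (O : MinusculeOrbit M σ s Y)

include O in
theorem act_of_val_eq_zero {t : B} (ht : t ∈ σ) {y : Y} (h : O.val y t = 0) : O.act t y = y :=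
  O.val_injective _ _ fun u hu => by rw [O.val_act t ht y u hu, h]; ring

theorem act_act {t : B} (ht : t ∈ σ) (y : Y) : O.act t (O.act t y) = y :=
  O.val_injective _ _ fun u hu => by
    rw [O.val_act t ht _ u hu, O.val_act t ht y u hu, O.val_act t ht y t ht,
      cartan_self]
    ring

theorem val_act_self {t : B} (ht : t ∈ σ) (y : Y) : O.val (O.act t y) t = - O.val y t := by
  rw [O.val_act t ht y t ht, cartan_self]; ring

theorem ht_act_of_neg {t : B} (ht : t ∈ σ) {y : Y} (h : O.val y t = -1) :
    O.ht y = O.ht (O.act t y) + 1 := by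
  have := O.ht_act t ht (O.act t y) (by rw [O.val_act_self ht, h, neg_neg])
  rwa [O.act_act ht] at this

theorem ht_act_le {t : B} (ht : t ∈ σ) (y : Y) : O.ht (O.act t y) ≤ O.ht y + 1 := by
  rcases O.val_cases t ht y with h | h | h
  · have := O.ht_act_of_neg ht h; omega
  · rw [O.act_of_val_eq_zero ht h]; omega
  · rw [O.ht_act t ht y h]

theorem cartan_symm (i j : B) : cartan M i j = cartan M j i := by
  have : M j i = M i j := (M.symmetric i j).symm
  simp [cartan, eq_comm, this]

include hM in
theorem cartan_eq {i j : B} (h : i ≠ j) : (cartan M i j = 0 ∧ M i j = 2) ∨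
    (cartan M i j = -1 ∧ M i j = 3) := by
  rcases hM i j h with h1 | h1 <;> simp [cartan, h, h1]

include hM in
/-- Two distinct downward moves commute. -/
theorem commute_of_downs {t c : B} (ht : t ∈ σ) (hc : c ∈ σ) (hne : t ≠ c) {y : Y}
    (h1 : O.val y t = -1) (h2 : O.val y c = -1) : cartan M t c = 0 ∧ M t c = 2 := by
  rcases cartan_eq hM hne with h | h
  · exact h
  · exfalso
    have := O.val_act t ht y c hc
    rcases O.val_cases c hc (O.act t y) with h3 | h3 | h3 <;> rw [this, h1, h2, h.1] at h3 <;>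
      omega

theorem act_comm {t c : B} (ht : t ∈ σ) (hc : c ∈ σ) (h : cartan M t c = 0) (y : Y) :
    O.act t (O.act c y) = O.act c (O.act t y) := by
  refine O.val_injective _ _ fun u hu => ?_
  have h' : cartan M c t = 0 := by rw [cartan_symm, h]
  rw [O.val_act t ht _ u hu, O.val_act c hc _ u hu, O.val_act c hc _ u hu, O.val_act t ht _ u hu,
    O.val_act c hc _ t ht, O.val_act t ht _ c hc, h, h']
  ring

open Classical in
/-- A chosen downward move out of a non-initial state. -/
noncomputable def down (y : Y) : B := if h : y ≠ O.init then (O.exists_down y h).choose else s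

theorem down_mem {y : Y} (h : y ≠ O.init) : O.down y ∈ σ := by
  rw [down, dif_pos h]; exact (O.exists_down y h).choose_spec.1

theorem val_down {y : Y} (h : y ≠ O.init) : O.val y (O.down y) = -1 := by
  rw [down, dif_pos h]; exact (O.exists_down y h).choose_spec.2

theorem ht_act_down {y : Y} (h : y ≠ O.init) : O.ht y = O.ht (O.act (O.down y) y) + 1 :=
  O.ht_act_of_neg (O.down_mem h) (O.val_down h)

theorem eq_init_of_ht_eq_zero {y : Y} (h : O.ht y = 0) : y = O.init := by
  by_contra hne
  have := O.ht_act_down hne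
  omega

open Classical in
/-- The element of `W_σ` leading from the initial state to `y` along chosen moves. -/
noncomputable def rep (y : Y) : W :=
  if _h : y ≠ O.init then cs.simple (O.down y) * rep (O.act (O.down y) y) else 1
termination_by O.ht y
decreasing_by have := O.ht_act_down _h; omega

theorem rep_init : O.rep cs O.init = 1 := by rw [rep]; simp

theorem rep_of_ne {y : Y} (h : y ≠ O.init) :
    O.rep cs y = cs.simple (O.down y) * O.rep cs (O.act (O.down y) y) := by
  rw [rep, dif_pos h]

theorem rep_mem (y : Y) : O.rep cs y ∈ parabolic cs σ := by
  induction hn : O.ht y generalizing y with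
  | zero => rw [O.eq_init_of_ht_eq_zero hn, rep_init]; exact one_mem _
  | succ n ih =>
    have hy : y ≠ O.init := by rintro rfl; rw [O.ht_init] at hn; omega
    rw [O.rep_of_ne cs hy]
    exact mul_mem (cs.simple_mem_parabolic (O.down_mem hy))
      (ih _ (by have := O.ht_act_down hy; omega))

theorem length_rep_le (y : Y) : cs.length (O.rep cs y) ≤ O.ht y := by
  induction hn : O.ht y generalizing y with
  | zero => rw [O.eq_init_of_ht_eq_zero hn, rep_init, length_one]
  | succ n ih =>
    have hy : y ≠ O.init := by rintro rfl; rw [O.ht_init] at hn; omega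
    rw [O.rep_of_ne cs hy]
    have h1 := ih (O.act (O.down y) y) (by have := O.ht_act_down hy; omega)
    have h2 := cs.length_mul_le (cs.simple (O.down y)) (O.rep cs (O.act (O.down y) y))
    rw [length_simple] at h2
    omega

/-- Equality of left cosets of `W_{σ∖{s}}`. -/
def SameCoset (σ : Finset B) (s : B) (x y : W) : Prop := x⁻¹ * y ∈ parabolic cs (σ.erase s)

variable {cs} in
theorem SameCoset.symm {x y : W} (h : SameCoset cs σ s x y) : SameCoset cs σ s y x := by
  have := inv_mem h
  rwa [mul_inv_rev, inv_inv] at this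

variable {cs} in
theorem SameCoset.trans {x y z : W} (h : SameCoset cs σ s x y) (h' : SameCoset cs σ s y z) :
    SameCoset cs σ s x z := by
  have := mul_mem h h'
  rwa [mul_assoc, mul_inv_cancel_left] at this

variable {cs} in
theorem SameCoset.mul_left {x y : W} (h : SameCoset cs σ s x y) (g : W) :
    SameCoset cs σ s (g * x) (g * y) := by
  rw [SameCoset, mul_inv_rev, mul_assoc, inv_mul_cancel_left]; exact h

theorem SameCoset.rfl {x : W} : SameCoset cs σ s x x := by
  rw [SameCoset, inv_mul_cancel]; exact one_mem _

omit [DecidableEq B] in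
theorem _root_.CoxeterSystem.simple_mul_comm {i j : B} (h : M i j = 2) :
    cs.simple i * cs.simple j = cs.simple j * cs.simple i := by
  have h2 := cs.simple_mul_simple_pow i j
  rw [h, pow_two] at h2
  have h3 := eq_inv_of_mul_eq_one_left h2
  rwa [mul_inv_rev, inv_simple, inv_simple] at h3

omit [DecidableEq B] in
theorem _root_.CoxeterSystem.simple_braid {i j : B} (h : M i j = 3) :
    cs.simple i * cs.simple j * cs.simple i = cs.simple j * cs.simple i * cs.simple j := by
  have h2 := cs.simple_mul_simple_pow i j
  rw [h, pow_succ, pow_two] at h2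
  have h3 : (cs.simple i * cs.simple j * cs.simple i) *
      (cs.simple j * cs.simple i * cs.simple j) = 1 := by
    rw [← h2]; simp only [mul_assoc]
  have h4 := eq_inv_of_mul_eq_one_left h3
  simpa [mul_assoc] using h4

include hM in
/-- The Schreier graph of `W_σ / W_{σ∖{s}}` is the graph of states. -/
theorem simple_mul_rep (y : Y) : ∀ t ∈ σ,
    SameCoset cs σ s (cs.simple t * O.rep cs y) (O.rep cs (O.act t y)) := by
  induction hn : O.ht y using Nat.strong_induction_on generalizing y with
  | _ n IH =>
  have ih : ∀ y', O.ht y' < O.ht y → ∀ t ∈ σ,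
      SameCoset cs σ s (cs.simple t * O.rep cs y') (O.rep cs (O.act t y')) :=
    fun y' h t ht => IH _ (hn ▸ h) y' rfl t ht
  clear IH
  have hcancel : ∀ t (x : W), cs.simple t * (cs.simple t * x) = x := fun t x => by
    rw [← mul_assoc, simple_mul_simple_self, one_mul]
  have hneg : ∀ t ∈ σ, O.val y t = -1 →
      SameCoset cs σ s (cs.simple t * O.rep cs y) (O.rep cs (O.act t y)) := by
    intro t ht hv
    have hy : y ≠ O.init := by
      rintro rfl
      rw [O.val_init t ht] at hv
      split_ifs at hv
    rw [O.rep_of_ne cs hy]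
    have hc := O.down_mem hy
    have hvc := O.val_down hy
    have hlt := O.ht_act_down hy
    generalize O.down y = c at *
    by_cases htc : t = c
    · subst htc
      rw [hcancel]
      exact SameCoset.rfl cs
    · obtain ⟨h0, h2⟩ := O.commute_of_downs hM ht hc htc hv hvc
      have h3 := ih (O.act c y) (by omega) t ht
      have h4 := ih (O.act t y) (by have := O.ht_act_of_neg ht hv; omega) c hc
      rw [O.act_comm ht hc h0] at h3
      rw [← mul_assoc, cs.simple_mul_comm h2, mul_assoc]
      refine (h3.mul_left _).trans ?_
      have h5 := (h4.mul_left (cs.simple c)).symm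
      rwa [hcancel] at h5
  intro t ht
  rcases O.val_cases t ht y with hv | hv | hv
  · exact hneg t ht hv
  · rw [O.act_of_val_eq_zero ht hv]
    by_cases hy : y = O.init
    · subst hy
      rw [rep_init, SameCoset, mul_one, mul_one, inv_simple]
      refine cs.simple_mem_parabolic (Finset.mem_erase.2 ⟨?_, ht⟩)
      rintro rfl
      rw [O.val_init t ht, if_pos rfl] at hv
      omega
    · rw [O.rep_of_ne cs hy]
      have hc := O.down_mem hy
      have hvc := O.val_down hy
      have hlt := O.ht_act_down hy
      generalize O.down y = c at *
      have hne : t ≠ c := by rintro rfl; omega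
      rcases cartan_eq hM hne with ⟨h0, h2⟩ | ⟨h0, h2⟩
      · have hv' : O.val (O.act c y) t = 0 := by
          rw [O.val_act c hc y t ht, cartan_symm, h0, hv]; ring
        have h3 := ih (O.act c y) (by omega) t ht
        rw [O.act_of_val_eq_zero ht hv'] at h3
        rw [← mul_assoc, cs.simple_mul_comm h2, mul_assoc]
        exact h3.mul_left _
      · have hv' : O.val (O.act c y) t = -1 := by
          rw [O.val_act c hc y t ht, cartan_symm, h0, hv, hvc]; ring
        have hvc' : O.val (O.act c y) c = 1 := by rw [O.val_act_self hc, hvc, neg_neg]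
        have hv'' : O.val (O.act t (O.act c y)) c = 0 := by
          rw [O.val_act t ht _ c hc, h0, hv', hvc']; ring
        have hlt' := O.ht_act_of_neg ht hv'
        have h3 := ih (O.act c y) (by omega) t ht
        have h4 := ih (O.act t (O.act c y)) (by omega) c hc
        rw [O.act_of_val_eq_zero hc hv''] at h4
        have h5 := h3.mul_left (cs.simple t)
        rw [hcancel] at h5
        have h6 := h5.mul_left (cs.simple t * cs.simple c)
        rw [← mul_assoc (cs.simple t * cs.simple c), cs.simple_braid h2, mul_assoc, mul_assoc,
          mul_assoc] at h6
        refine h6.trans ((SameCoset.trans ?_ h5.symm).mul_left _)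
        exact h4.mul_left _
  · have hz := O.ht_act t ht y hv
    have hzt : O.val (O.act t y) t = -1 := by rw [O.val_act_self ht, hv]
    have hz0 : O.act t y ≠ O.init := by
      intro h; rw [h, O.ht_init] at hz; omega
    rw [O.rep_of_ne cs hz0]
    have hc := O.down_mem hz0
    have hvc := O.val_down hz0
    generalize O.down (O.act t y) = c at *
    by_cases htc : t = c
    · subst htc
      rw [O.act_act ht]
      exact SameCoset.rfl cs
    · obtain ⟨h0, h2⟩ := O.commute_of_downs hM ht hc htc hzt hvc
      have hyc : O.val y c = -1 := by
        rw [O.val_act t ht y c hc, h0] at hvc; omega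
      have hlt := O.ht_act_of_neg hc hyc
      rw [← O.act_comm ht hc h0]
      have h3 := (hneg c hc hyc).mul_left (cs.simple c)
      rw [hcancel] at h3
      have h4 := h3.mul_left (cs.simple t)
      rw [← mul_assoc (cs.simple t) (cs.simple c), cs.simple_mul_comm h2, mul_assoc] at h4
      exact h4.trans ((ih _ (by omega) t ht).mul_left _)

/-- The state reached from the initial one by a word. -/
def run (ω : List B) : Y := ω.foldr O.act O.init

include hM in
theorem wordProd_sameCoset {ω : List B} (hω : ∀ i ∈ ω, i ∈ σ) :
    SameCoset cs σ s (cs.wordProd ω) (O.rep cs (O.run ω)) ∧ O.ht (O.run ω) ≤ ω.length := by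
  induction ω with
  | nil => simp [run, rep_init, O.ht_init, SameCoset.rfl]
  | cons i ω ih =>
    obtain ⟨h1, h2⟩ := ih fun j hj => hω j (by simp [hj])
    have hi := hω i (by simp)
    rw [wordProd_cons]
    refine ⟨(h1.mul_left _).trans (O.simple_mul_rep cs hM _ i hi), ?_⟩
    have := O.ht_act_le hi (O.run ω)
    simp only [run, List.foldr_cons, List.length_cons] at *
    omega

theorem numbersGame_of_mem {u : W} (hu : u ∈ parabolic cs (σ.erase s)) :
    cs.numbersGame hM u (Pi.single s 1) = Pi.single s 1 := by
  obtain ⟨ω, hω, rfl⟩ := cs.exists_word_of_mem_parabolic hu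
  clear hu
  induction ω with
  | nil => simp
  | cons i ω ih =>
    rw [wordProd_cons, map_mul, Module.End.mul_apply, ih fun j hj => hω j (by simp [hj]),
      numbersGame_simple]
    have hi : i ≠ s := (Finset.mem_erase.1 (hω i (by simp))).1
    ext j
    rw [move_apply, Pi.single_eq_of_ne hi]
    ring

theorem numbersGame_rep (y : Y) : ∀ t ∈ σ,
    cs.numbersGame hM (O.rep cs y) (Pi.single s 1) t = O.val y t := by
  induction hn : O.ht y generalizing y with
  | zero =>
    intro t ht
    rw [O.eq_init_of_ht_eq_zero hn, rep_init, O.val_init t ht]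
    simp [Pi.single_apply]
  | succ n ih =>
    intro t ht
    have hy : y ≠ O.init := by rintro rfl; rw [O.ht_init] at hn; omega
    have h1 := ih (O.act (O.down y) y) (by have := O.ht_act_down hy; omega)
    rw [O.rep_of_ne cs hy, map_mul, Module.End.mul_apply, numbersGame_simple, move_apply,
      h1 t ht, h1 _ (O.down_mem hy), ← O.val_act _ (O.down_mem hy) _ t ht,
      O.act_act (O.down_mem hy)]

include hM in
theorem eq_of_sameCoset {y y' : Y} (h : SameCoset cs σ s (O.rep cs y) (O.rep cs y')) : y = y' := by
  refine O.val_injective _ _ fun t ht => ?_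
  rw [← O.numbersGame_rep cs hM y t ht, ← O.numbersGame_rep cs hM y' t ht]
  have : O.rep cs y' = O.rep cs y * ((O.rep cs y)⁻¹ * O.rep cs y') := by group
  rw [this, map_mul, Module.End.mul_apply, numbersGame_of_mem cs hM h]

include hM in
theorem ht_le_length {w : W} (hw : w ∈ parabolic cs σ) {y : Y}
    (h : SameCoset cs σ s w (O.rep cs y)) : O.ht y ≤ cs.length w := by
  obtain ⟨ω, hω, hr, rfl⟩ := cs.exists_isReduced_of_mem_parabolic hw
  obtain ⟨h1, h2⟩ := O.wordProd_sameCoset cs hM hω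
  rw [O.eq_of_sameCoset cs hM (h.symm.trans h1), hr.eq]
  exact h2

include hM O in
theorem finite_and_poin_eq [Fintype Y] (hτ : (parabolic cs (σ.erase s) : Set W).Finite) :
    (parabolic cs σ : Set W).Finite ∧
      poin cs σ = (∑ y, X ^ O.ht y) * poin cs (σ.erase s) := by
  have hlen : ∀ y, cs.length (O.rep cs y) = O.ht y := fun y =>
    le_antisymm (O.length_rep_le cs y)
      (O.ht_le_length cs hM (O.rep_mem cs y) (SameCoset.rfl cs))
  have := cs.finite_and_poin_eq_of_transversal hτ (Finset.erase_subset s σ) (O.rep cs)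
    (fun y y' h => O.eq_of_sameCoset cs hM (by rw [h]; exact SameCoset.rfl cs))
    (O.rep_mem cs) (fun y u hu => ?_) (fun w hw => ?_)
  · simpa only [hlen] using this
  · rw [hlen]
    refine O.ht_le_length cs hM (mul_mem (O.rep_mem cs y)
      (cs.parabolic_mono (Finset.erase_subset s σ) hu)) ?_
    rw [SameCoset, mul_inv_rev, mul_assoc, inv_mul_cancel, mul_one]
    exact inv_mem hu
  · obtain ⟨ω, hω, rfl⟩ := cs.exists_word_of_mem_parabolic hw
    exact ⟨O.run ω, _, (O.wordProd_sameCoset cs hM hω).1.symm, (mul_inv_cancel_left _ _).symm⟩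

end MinusculeOrbit

end NumbersGame

end CoxeterSystem

namespace AffineD

/-- Adjacency in the Dynkin diagram of type `D̃ₙ`. -/
def Adj (n a b : ℕ) : Prop :=
  ((a = 0 ∧ b = 2) ∨ (a = 1 ∧ b = 2) ∨ (2 ≤ a ∧ a ≤ n - 2 ∧ b = a + 1) ∨ (a = n - 2 ∧ b = n)) ∨
  ((b = 0 ∧ a = 2) ∨ (b = 1 ∧ a = 2) ∨ (2 ≤ b ∧ b ≤ n - 2 ∧ a = b + 1) ∨ (b = n - 2 ∧ a = n))

instance (n a b : ℕ) : Decidable (Adj n a b) := by unfold Adj; infer_instance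

/-- The Cartan integers of type `D̃ₙ`. -/
def cartanInt (n a b : ℕ) : ℤ := if a = b then 2 else if Adj n a b then -1 else 0

/-- The Coxeter matrix of type `D̃ₙ`. -/
def IsAffineD (n : ℕ) (M : CoxeterMatrix (Fin (n + 1))) : Prop :=
  ∀ i j : Fin (n + 1), i.val < j.val →
    M.M i j =
      (if (i.val = 0 ∧ j.val = 2) ∨ (i.val = 1 ∧ j.val = 2) ∨
          (2 ≤ i.val ∧ i.val ≤ n - 2 ∧ j.val = i.val + 1) ∨
          (i.val = n - 2 ∧ j.val = n) then 3
       else 2)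

section

variable {n : ℕ} (hn : 4 ≤ n) {M : CoxeterMatrix (Fin (n + 1))} (hM : IsAffineD n M)

include hn hM

theorem matrix_apply (i j : Fin (n + 1)) (h : i ≠ j) : M i j = if Adj n i j then 3 else 2 := by
  have h' : i.val ≠ j.val := fun h' => h (Fin.ext h')
  rcases lt_or_gt_of_ne h' with h1 | h1
  · change M.M i j = _
    rw [hM i j h1]
    refine if_congr ?_ rfl rfl
    unfold Adj
    omega
  · change M.M i j = _
    rw [M.symmetric, hM j i h1]
    refine if_congr ?_ rfl rfl
    unfold Adj
    omega

theorem simplyLaced (i j : Fin (n + 1)) (h : i ≠ j) : M i j = 2 ∨ M i j = 3 := by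
  rw [matrix_apply hn hM i j h]; split_ifs <;> simp

theorem cartan_apply (i j : Fin (n + 1)) : cartan M i j = cartanInt n i j := by
  unfold cartan cartanInt
  by_cases h : i = j
  · simp [h]
  · have h' : i.val ≠ j.val := fun h' => h (Fin.ext h')
    rw [if_neg h, if_neg h', matrix_apply hn hM i j h]
    by_cases h2 : Adj n i j <;> simp [h2]

end

/-- The generators with labels in `s`. -/
def nodes (n : ℕ) (s : Finset ℕ) : Finset (Fin (n + 1)) := Finset.univ.filter fun i => i.val ∈ s

theorem mem_nodes {n : ℕ} {s : Finset ℕ} {i : Fin (n + 1)} : i ∈ nodes n s ↔ i.val ∈ s := by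
  simp [nodes]

/-- The numbers at the states of the type `A` chain `i, …, j`. -/
def chainVal (j k t : ℕ) : ℤ := if t + k = j then 1 else if t + k = j + 1 then -1 else 0

/-- The moves between the states of the type `A` chain. -/
def chainAct (j k t : ℕ) : ℕ := if t + k = j then k + 1 else if t + k = j + 1 then k - 1 else k

/-- The numbers at the states of the vector representation of type `D`. -/
def forkVal (j k t : ℕ) : ℤ :=
  if t = 0 then (if k + 1 = j ∨ k = j then 1 else if k = j + 1 ∨ k = j + 2 then -1 else 0)
  else (if t + k = j ∨ k = j + t then 1 else if t + k = j + 1 ∨ k = j + t + 1 then -1 else 0)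

/-- The moves between the states of the vector representation of type `D`. -/
def forkAct (j k t : ℕ) : ℕ :=
  if t = 0 then
    (if k + 1 = j ∨ k = j then k + 2 else if k = j + 1 ∨ k = j + 2 then k - 2 else k)
  else (if t + k = j ∨ k = j + t then k + 1
    else if t + k = j + 1 ∨ k = j + t + 1 then k - 1 else k)

theorem chainVal_act {n i j k t u : ℕ} (hi : 1 ≤ i) (hjn : j + 1 ≤ n)
    (ht : i ≤ t ∧ t ≤ j) (hu : i ≤ u ∧ u ≤ j) :
    chainVal j (chainAct j k t) u = chainVal j k u - chainVal j k t * cartanInt n t u := by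
  have hc : cartanInt n t u = if t = u then 2 else if t = u + 1 ∨ u = t + 1 then -1 else 0 := by
    unfold cartanInt
    split_ifs <;> first | rfl | (exfalso; unfold Adj at *; omega)
  rw [hc]
  unfold chainVal chainAct
  split_ifs <;> omega

theorem forkVal_act {n j k t u : ℕ} (hj : 2 ≤ j) (hjn : j + 1 ≤ n)
    (ht : t ≤ j) (hu : u ≤ j) :
    forkVal j (forkAct j k t) u = forkVal j k u - forkVal j k t * cartanInt n t u := by
  have hc : cartanInt n t u = if t = u then 2 else
      if t = 0 then (if u = 2 then -1 else 0) else if u = 0 then (if t = 2 then -1 else 0) else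
      if t = u + 1 ∨ u = t + 1 then -1 else 0 := by
    unfold cartanInt
    split_ifs <;> first | rfl | (exfalso; unfold Adj at *; omega)
  rw [hc]
  unfold forkVal forkAct
  rcases Nat.eq_zero_or_pos t with rfl | h1 <;> rcases Nat.eq_zero_or_pos u with rfl | h2
  · simp only [if_true]
    split_ifs <;> omega
  · simp only [if_true, h2.ne', if_false]
    split_ifs <;> omega
  · simp only [if_true, h1.ne', if_false]
    split_ifs <;> omega
  · simp only [h1.ne', h2.ne', if_false]
    split_ifs <;> omega

theorem forkVal_injective {j k k' : ℕ} (hj : 2 ≤ j) (hk : k < 2 * j + 2) (hk' : k' < 2 * j + 2)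
    (h' : ∀ t, t ≤ j → forkVal j k t = forkVal j k' t) : k = k' := by
  have h0 : ∀ t, 1 ≤ t → t ≤ j →
      (((t + k = j ∨ k = j + t) ↔ (t + k' = j ∨ k' = j + t)) ∧
      ((t + k = j + 1 ∨ k = j + t + 1) ↔ (t + k' = j + 1 ∨ k' = j + t + 1))) := by
    intro t h1 h2
    have := h' t h2
    have ht : t ≠ 0 := by omega
    simp only [forkVal, ht, if_false] at this
    clear h'
    grind
  have b0 := h' 0 (by omega)
  have b1 : (((k + 1 = j ∨ k = j) ↔ (k' + 1 = j ∨ k' = j)) ∧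
      ((k = j + 1 ∨ k = j + 2) ↔ (k' = j + 1 ∨ k' = j + 2))) := by
    simp only [forkVal, if_true] at b0
    clear h'
    grind
  have a0 := h0 j (by omega) le_rfl
  have a1 := h0 1 le_rfl (by omega)
  have a2 := h0 (j - 1) (by omega) (by omega)
  clear h' b0
  by_cases c1 : k < j
  · have a3 := h0 (j - k) (by omega) (by omega)
    by_cases c2 : k = 0
    · omega
    · have a4 := h0 (j + 1 - k) (by omega) (by omega)
      omega
  · by_cases c2 : k ≤ j + 1
    · omega
    · have a4 := h0 (k - 1 - j) (by omega) (by omega)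
      by_cases c3 : k = 2 * j + 1
      · omega
      · have a3 := h0 (k - j) (by omega) (by omega)
        omega


theorem forkAct_le {j k t : ℕ} (hj : 2 ≤ j) (hk : k < 2 * j + 2) (ht : t ≤ j) :
    forkAct j k t ≤ 2 * j + 1 := by
  unfold forkAct; split_ifs <;> omega

theorem ht_forkAct {j k t : ℕ} (hj : 2 ≤ j)
    (h : forkVal j k t = 1) :
    (if forkAct j k t ≤ j then forkAct j k t else forkAct j k t - 1) =
      (if k ≤ j then k else k - 1) + 1 := by
  have : if t = 0 then k + 1 = j ∨ k = j else t + k = j ∨ k = j + t := by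
    unfold forkVal at h
    grind
  unfold forkAct
  clear h
  split_ifs at * <;> omega

theorem forkVal_zero {j t : ℕ} (hj : 2 ≤ j) (ht : t ≤ j) :
    forkVal j 0 t = if t = j then 1 else 0 := by
  unfold forkVal
  grind

section

variable {n : ℕ} (hn : 4 ≤ n) {M : CoxeterMatrix (Fin (n + 1))} (hM : IsAffineD n M)

/-- The minuscule orbit of an end node of a type `A` chain. -/
def chainOrbit {i j : ℕ} (hi : 1 ≤ i) (hij : i ≤ j) (hjn : j + 1 ≤ n) :
    MinusculeOrbit M (nodes n (Finset.Ico i (j + 1))) ⟨j, by omega⟩ (Fin (j + 2 - i)) where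
  val k t := chainVal j k t
  act t k := ⟨min (chainAct j k t) (j + 1 - i), by omega⟩
  ht k := k
  init := ⟨0, by omega⟩
  mem := by rw [mem_nodes, Finset.mem_Ico]; simp; omega
  val_act t ht k u hu := by
    rw [mem_nodes, Finset.mem_Ico] at ht hu
    rw [cartan_apply hn hM, ← chainVal_act hi hjn (by omega) (by omega)]
    congr 1
    have := k.2
    simp only [chainAct]
    split_ifs <;> omega
  val_cases t ht k := by unfold chainVal; split_ifs <;> simp
  val_injective k k' h := by
    have h' : ∀ t, i ≤ t → t ≤ j → chainVal j k t = chainVal j k' t := fun t h1 h2 =>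
      h ⟨t, by omega⟩ (by rw [mem_nodes, Finset.mem_Ico]; exact ⟨h1, by simp; omega⟩)
    obtain ⟨k, hk⟩ := k
    obtain ⟨k', hk'⟩ := k'
    simp only at h'
    rw [Fin.mk.injEq]
    by_cases h0 : k = 0
    · have := h' j hij le_rfl
      unfold chainVal at this
      split_ifs at this <;> omega
    · have := h' (j + 1 - k) (by omega) (by omega)
      unfold chainVal at this
      split_ifs at this <;> omega
  ht_act t ht k h := by
    rw [mem_nodes, Finset.mem_Ico] at ht
    have := k.2
    simp only [chainVal, chainAct] at *
    split_ifs at * <;> omega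
  val_init t ht := by
    rw [mem_nodes, Finset.mem_Ico] at ht
    simp only [chainVal, Fin.ext_iff]
    split_ifs <;> omega
  ht_init := rfl
  exists_down k hk := by
    have hk0 : k.val ≠ 0 := fun h => hk (Fin.ext h)
    have := k.2
    refine ⟨⟨j + 1 - k, by omega⟩, ?_, ?_⟩
    · rw [mem_nodes, Finset.mem_Ico]; simp only; omega
    · simp only [chainVal]; split_ifs <;> omega

/-- The vector representation of type `D`, as the minuscule orbit of the end node. -/
def forkOrbit {j : ℕ} (hj : 2 ≤ j) (hjn : j + 1 ≤ n) :
    MinusculeOrbit M (nodes n (Finset.Ico 0 (j + 1))) ⟨j, by omega⟩ (Fin (2 * j + 2)) where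
  val k t := forkVal j k t
  act t k := ⟨min (forkAct j k t) (2 * j + 1), by omega⟩
  ht k := if k.val ≤ j then k else k - 1
  init := ⟨0, by omega⟩
  mem := by rw [mem_nodes, Finset.mem_Ico]; simp
  val_act t ht k u hu := by
    rw [mem_nodes, Finset.mem_Ico] at ht hu
    rw [cartan_apply hn hM, ← forkVal_act hj hjn (by omega) (by omega)]
    congr 1
    exact min_eq_left (forkAct_le hj k.2 (by omega))
  val_cases t ht k := by unfold forkVal; split_ifs <;> simp
  val_injective k k' h := by
    exact Fin.ext (forkVal_injective hj k.2 k'.2 fun t ht =>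
      h ⟨t, by omega⟩ (by rw [mem_nodes, Finset.mem_Ico]; exact ⟨by simp, by simp; omega⟩))
  ht_act t ht k h := by
    rw [mem_nodes, Finset.mem_Ico] at ht
    have hm : min (forkAct j k t) (2 * j + 1) = forkAct j k t :=
      min_eq_left (forkAct_le hj k.2 (by omega))
    simp only [hm]
    exact ht_forkAct hj h
  val_init t ht := by
    rw [mem_nodes, Finset.mem_Ico] at ht
    simp only [Fin.ext_iff]
    exact forkVal_zero hj (by omega)
  ht_init := by simp
  exists_down k hk := by
    have hk0 : k.val ≠ 0 := fun h => hk (Fin.ext h)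
    have := k.2
    by_cases h1 : k.val ≤ j
    · refine ⟨⟨j + 1 - k, by omega⟩, ?_, ?_⟩
      · rw [mem_nodes, Finset.mem_Ico]; simp only; omega
      · simp only [forkVal]; split_ifs <;> omega
    · refine ⟨⟨k - 1 - j, by omega⟩, ?_, ?_⟩
      · rw [mem_nodes, Finset.mem_Ico]; simp only; omega
      · simp only [forkVal]; split_ifs <;> omega

end

end AffineD

namespace AffineD

/-- The interchange of the labels `0` and `1`. -/
def swapLeft (a : ℕ) : ℕ := if a = 0 then 1 else if a = 1 then 0 else a

theorem adj_symm {n a b : ℕ} (h : Adj n a b) : Adj n b a := Or.symm h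

theorem adj_swapLeft {n a b : ℕ} (hn : 4 ≤ n) (h : Adj n a b) : Adj n (swapLeft a) (swapLeft b) := by
  have key : ∀ a b, ((a = 0 ∧ b = 2) ∨ (a = 1 ∧ b = 2) ∨ (2 ≤ a ∧ a ≤ n - 2 ∧ b = a + 1) ∨
      (a = n - 2 ∧ b = n)) → Adj n (swapLeft a) (swapLeft b) := by
    intro a b h
    left
    unfold swapLeft
    rcases h with h | h | h | h
    · simp [h.1, h.2]
    · simp [h.1, h.2]
    all_goals
      rw [if_neg (by omega), if_neg (by omega), if_neg (by omega), if_neg (by omega)]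
      omega
  rcases h with h | h
  · exact key a b h
  · exact adj_symm (key b a h)

theorem adj_flip {n a b : ℕ} (hn : 4 ≤ n) (h : Adj n a b) : Adj n (n - a) (n - b) := by
  have key : ∀ a b, ((a = 0 ∧ b = 2) ∨ (a = 1 ∧ b = 2) ∨ (2 ≤ a ∧ a ≤ n - 2 ∧ b = a + 1) ∨
      (a = n - 2 ∧ b = n)) → Adj n (n - a) (n - b) := by
    intro a b h
    right
    omega
  rcases h with h | h
  · exact key a b h
  · exact adj_symm (key b a h)
variable {n : ℕ} (hn : 4 ≤ n) {M : CoxeterMatrix (Fin (n + 1))} (hM : IsAffineD n M)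
  {W : Type*} [Group W] (cs : CoxeterSystem M W)

theorem nodes_congr {s t : Finset ℕ} (h : ∀ i, i ≤ n → (i ∈ s ↔ i ∈ t)) : nodes n s = nodes n t := by
  ext i
  rw [mem_nodes, mem_nodes]
  exact h i (by omega)

include hn hM

theorem chain_step {i j : ℕ} (hi : 1 ≤ i) (hij : i ≤ j) (hjn : j + 1 ≤ n)
    (hf : (parabolic cs (nodes n (Finset.Ico i j)) : Set W).Finite) :
    (parabolic cs (nodes n (Finset.Ico i (j + 1))) : Set W).Finite ∧
      poin cs (nodes n (Finset.Ico i (j + 1))) =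
        (∑ k ∈ Finset.range (j + 2 - i), X ^ k) * poin cs (nodes n (Finset.Ico i j)) := by
  have he : (nodes n (Finset.Ico i (j + 1))).erase ⟨j, by omega⟩ = nodes n (Finset.Ico i j) := by
    ext x
    simp only [Finset.mem_erase, mem_nodes, Finset.mem_Ico, ne_eq, Fin.ext_iff]
    omega
  have := (chainOrbit hn hM hi hij hjn).finite_and_poin_eq cs (simplyLaced hn hM) (he ▸ hf)
  rw [he] at this
  refine ⟨this.1, this.2.trans ?_⟩
  congr 1
  exact Fin.sum_univ_eq_sum_range (fun k => (X : ℚ[X]) ^ k) _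

theorem fork_step {j : ℕ} (hj : 2 ≤ j) (hjn : j + 1 ≤ n)
    (hf : (parabolic cs (nodes n (Finset.Ico 0 j)) : Set W).Finite) :
    (parabolic cs (nodes n (Finset.Ico 0 (j + 1))) : Set W).Finite ∧
      poin cs (nodes n (Finset.Ico 0 (j + 1))) =
        (1 + X ^ j) * (∑ k ∈ Finset.range (j + 1), X ^ k) * poin cs (nodes n (Finset.Ico 0 j)) := by
  have he : (nodes n (Finset.Ico 0 (j + 1))).erase ⟨j, by omega⟩ = nodes n (Finset.Ico 0 j) := by
    ext x
    simp only [Finset.mem_erase, mem_nodes, Finset.mem_Ico, ne_eq, Fin.ext_iff]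
    omega
  have := (forkOrbit hn hM hj hjn).finite_and_poin_eq cs (simplyLaced hn hM) (he ▸ hf)
  rw [he] at this
  refine ⟨this.1, this.2.trans ?_⟩
  congr 1
  refine (Fin.sum_univ_eq_sum_range
    (fun k => (X : ℚ[X]) ^ (if k ≤ j then k else k - 1)) (2 * j + 2)).trans ?_
  rw [show 2 * j + 2 = (j + 1) + (j + 1) by ring, Finset.sum_range_add, add_mul, one_mul,
    Finset.mul_sum]
  congr 1
  · exact Finset.sum_congr rfl fun k hk => by
      rw [if_pos (by rw [Finset.mem_range] at hk; omega)]
  · exact Finset.sum_congr rfl fun k hk => by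
      rw [if_neg (by omega), ← pow_add]
      congr 1
      omega

theorem matrix_symm (e : Fin (n + 1) ≃ Fin (n + 1))
    (he : ∀ i j, Adj n (e i) (e j) ↔ Adj n i j) (i j : Fin (n + 1)) : M (e i) (e j) = M i j := by
  by_cases h : i = j
  · subst h
    simp
  · rw [matrix_apply hn hM i j h, matrix_apply hn hM _ _ (e.injective.ne h)]
    exact if_congr (he i j) rfl rfl

theorem symm_apply (e : Fin (n + 1) ≃ Fin (n + 1)) {f : ℕ → ℕ} (hf : ∀ i, (e i).val = f i)
    (hff : ∀ i, i ≤ n → f (f i) = i) (he : ∀ a b, Adj n a b → Adj n (f a) (f b)) {s t : Finset ℕ}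
    (hst : ∀ i, i ≤ n → (i ∈ s ↔ f i ∈ t)) :
    ((parabolic cs (nodes n t) : Set W).Finite ↔ (parabolic cs (nodes n s) : Set W).Finite) ∧
      poin cs (nodes n t) = poin cs (nodes n s) := by
  have hmap : (nodes n s).map e.toEmbedding = nodes n t := by
    ext i
    rw [Finset.mem_map_equiv, mem_nodes, mem_nodes, hst _ (by omega), ← hf, Equiv.apply_symm_apply]
  rw [← hmap]
  refine finite_iff_and_poin_map_of_symm cs e (matrix_symm hn hM e fun i j => ?_) _
  rw [hf, hf]
  refine ⟨fun h => ?_, he _ _⟩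
  have := he _ _ h
  rwa [hff _ (by omega), hff _ (by omega)] at this

theorem swap_left {s t : Finset ℕ} (h0 : 0 ∈ s ↔ 1 ∈ t) (h1 : 1 ∈ s ↔ 0 ∈ t)
    (h : ∀ i, 2 ≤ i → i ≤ n → (i ∈ s ↔ i ∈ t)) :
    ((parabolic cs (nodes n t) : Set W).Finite ↔ (parabolic cs (nodes n s) : Set W).Finite) ∧
      poin cs (nodes n t) = poin cs (nodes n s) := by
  refine symm_apply hn hM cs (f := swapLeft) (Equiv.swap ⟨0, by omega⟩ ⟨1, by omega⟩)
    (fun i => ?_) (fun i _ => ?_) (fun a b => adj_swapLeft hn) fun i hi => ?_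
  · rw [Equiv.swap_apply_def]
    simp only [Fin.ext_iff, swapLeft]
    split_ifs <;> rfl
  · unfold swapLeft
    grind
  · unfold swapLeft
    split_ifs with c c
    · rw [c]; exact h0
    · rw [c]; exact h1
    · exact h _ (by omega) hi

theorem flip {s t : Finset ℕ} (h : ∀ i, i ≤ n → (i ∈ s ↔ n - i ∈ t)) :
    ((parabolic cs (nodes n t) : Set W).Finite ↔ (parabolic cs (nodes n s) : Set W).Finite) ∧
      poin cs (nodes n t) = poin cs (nodes n s) :=
  symm_apply hn hM cs (f := fun i => n - i) Fin.revPerm (fun i => by simp [Fin.val_rev])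
    (fun i hi => by omega) (fun a b => adj_flip hn) h

theorem union_of_not_adj {s t u : Finset ℕ} (hu : ∀ i, i ≤ n → (i ∈ u ↔ i ∈ s ∨ i ∈ t))
    (hst : ∀ i ∈ s, ∀ j ∈ t, i ≠ j ∧ ¬ Adj n i j)
    (hs : (parabolic cs (nodes n s) : Set W).Finite)
    (ht : (parabolic cs (nodes n t) : Set W).Finite) :
    (parabolic cs (nodes n u) : Set W).Finite ∧
      poin cs (nodes n u) = poin cs (nodes n s) * poin cs (nodes n t) := by
  have hmap : nodes n u = nodes n s ∪ nodes n t := by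
    ext i
    rw [Finset.mem_union, mem_nodes, mem_nodes, mem_nodes, hu _ (by omega)]
  rw [hmap]
  refine cs.finite_and_poin_union (simple_injective cs (simplyLaced hn hM)) hs ht
    (fun i hi hj => ?_) fun i hi j hj => ?_
  · rw [mem_nodes] at hi hj
    exact (hst _ hi _ hj).1 rfl
  · rw [mem_nodes] at hi hj
    have := hst _ hi _ hj
    rw [matrix_apply hn hM i j fun h => this.1 (congrArg _ h), if_neg this.2]

theorem finite_chain {i j : ℕ} (hi : 1 ≤ i) (hij : i ≤ j) (hjn : j ≤ n) :
    (parabolic cs (nodes n (Finset.Ico i j)) : Set W).Finite := by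
  induction j, hij using Nat.le_induction with
  | base =>
    have : nodes n (Finset.Ico i i) = ∅ := by ext; simp [mem_nodes]
    rw [this]
    exact finite_parabolic_empty cs
  | succ j hij ih => exact (chain_step hn hM cs hi hij hjn (ih (by omega))).1

theorem finite_and_poin_ends :
    (parabolic cs (nodes n (Finset.Ico 0 2)) : Set W).Finite ∧
      poin cs (nodes n (Finset.Ico 0 2)) = (∑ k ∈ Finset.range 2, X ^ k) ^ 2 := by
  have h1 := chain_step hn hM cs le_rfl le_rfl (by omega)
    (finite_chain hn hM cs le_rfl le_rfl (by omega))
  have hempty : nodes n (Finset.Ico 1 1) = ∅ := by ext; simp [mem_nodes]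
  rw [hempty, poin_empty, mul_one] at h1
  have h0 := swap_left hn hM cs (s := Finset.Ico 1 2) (t := {0}) (by simp) (by simp) fun i hi _ => by
    simp; omega
  have hunion := union_of_not_adj hn hM cs (s := {0}) (t := Finset.Ico 1 2) (u := Finset.Ico 0 2)
    (fun i _ => by simp; omega) (fun i hi j hj => by
      simp at hi hj
      unfold Adj
      omega) (h0.1.2 h1.1) h1.1
  refine ⟨hunion.1, ?_⟩
  rw [hunion.2, h0.2, h1.2, sq]

theorem finite_fork {j : ℕ} (hj : 2 ≤ j) (hjn : j ≤ n) :
    (parabolic cs (nodes n (Finset.Ico 0 j)) : Set W).Finite := by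
  induction j, hj using Nat.le_induction with
  | base => exact (finite_and_poin_ends hn hM cs).1
  | succ j hj ih => exact (fork_step hn hM cs hj hjn (ih (by omega))).1

omit hn hM in
theorem finite_of_subset {s t : Finset ℕ} (h : ∀ i, i ≤ n → i ∈ s → i ∈ t)
    (ht : (parabolic cs (nodes n t) : Set W).Finite) :
    (parabolic cs (nodes n s) : Set W).Finite :=
  ht.subset (parabolic_mono cs fun i hi => mem_nodes.2 (h _ (by omega) (mem_nodes.1 hi)))

theorem finite_of_not_mem {s : Finset ℕ} {x : ℕ} (hx : x ≤ n) (hxs : x ∉ s) :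
    (parabolic cs (nodes n s) : Set W).Finite := by
  have hlast : ∀ s : Finset ℕ, n ∉ s → (parabolic cs (nodes n s) : Set W).Finite := fun s hs =>
    finite_of_subset cs (t := Finset.Ico 0 n) (fun i hi his => by
      have : i ≠ n := fun h => hs (h ▸ his)
      simp; omega) (finite_fork hn hM cs (by omega) le_rfl)
  have hzero : ∀ s : Finset ℕ, 0 ∉ s → (parabolic cs (nodes n s) : Set W).Finite := fun s hs => by
    refine (flip hn hM cs (s := (Finset.range (n + 1)).filter fun i => n - i ∈ s) fun i hi => ?_).1.2
      (hlast _ ?_)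
    · simp; omega
    · simpa using hs
  have hone : ∀ s : Finset ℕ, 1 ∉ s → (parabolic cs (nodes n s) : Set W).Finite := fun s hs => by
    refine (swap_left hn hM cs (s := (Finset.range (n + 1)).filter fun i => swapLeft i ∈ s)
      ?_ ?_ fun i hi h2 => ?_).1.2 (hzero _ ?_)
    · rw [Finset.mem_filter, Finset.mem_range]
      exact ⟨fun h => h.2, fun h => ⟨by omega, h⟩⟩
    · rw [Finset.mem_filter, Finset.mem_range]
      exact ⟨fun h => h.2, fun h => ⟨by omega, h⟩⟩
    · rw [Finset.mem_filter, Finset.mem_range, swapLeft, if_neg (by omega), if_neg (by omega)]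
      exact ⟨fun h => h.2, fun h => ⟨by omega, h⟩⟩
    · rw [Finset.mem_filter]
      exact fun h => hs h.2
  by_cases h0 : x = 0
  · exact hzero s (h0 ▸ hxs)
  by_cases h1 : x = 1
  · exact hone s (h1 ▸ hxs)
  by_cases h2 : x = n
  · exact hlast s (h2 ▸ hxs)
  by_cases h3 : x = n - 1
  · refine (flip hn hM cs (s := (Finset.range (n + 1)).filter fun i => n - i ∈ s) fun i hi => ?_).1.2
      (hone _ ?_)
    · simp; omega
    · subst h3
      simpa using fun _ => hxs
  · have hr := flip hn hM cs (s := Finset.Ico 0 (n - x)) (t := Finset.Ico (x + 1) (n + 1))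
      fun i hi => by simp; omega
    refine (union_of_not_adj hn hM cs (s := (Finset.Ico 0 x).filter fun i => i ∈ s)
      (t := (Finset.Ico (x + 1) (n + 1)).filter fun i => i ∈ s) (fun i hi => ?_)
      (fun i hi j hj => ?_)
      (finite_of_subset cs (fun i _ hi => (Finset.mem_filter.1 hi).1)
        (finite_fork hn hM cs (by omega) (by omega)))
      (finite_of_subset cs (fun i _ hi => (Finset.mem_filter.1 hi).1)
        (hr.1.2 (finite_fork hn hM cs (by omega) (by omega))))).1
    · simp only [Finset.mem_filter, Finset.mem_Ico]
      refine ⟨fun his => ?_, by tauto⟩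
      have : i ≠ x := fun h => hxs (h ▸ his)
      rcases lt_or_gt_of_ne this with h | h
      · exact Or.inl ⟨by omega, his⟩
      · exact Or.inr ⟨by omega, his⟩
    · simp only [Finset.mem_filter, Finset.mem_Ico] at hi hj
      unfold Adj
      omega

end AffineD

namespace AffineD

/-- The multiplicity of the `d`-th cyclotomic polynomial. -/
noncomputable def ord (d : ℕ) (p : ℚ[X]) : ℕ := multiplicity (cyclotomic d ℚ) p

theorem prime_cyclotomic {d : ℕ} (hd : 0 < d) : Prime (cyclotomic d ℚ) :=
  (cyclotomic.irreducible_rat hd).prime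

theorem finiteMultiplicity_cyclotomic {d : ℕ} (hd : 0 < d) {p : ℚ[X]} (hp : p ≠ 0) :
    FiniteMultiplicity (cyclotomic d ℚ) p :=
  FiniteMultiplicity.of_not_isUnit (prime_cyclotomic hd).not_isUnit hp

theorem ord_mul {d : ℕ} (hd : 0 < d) {p q : ℚ[X]} (hp : p ≠ 0) (hq : q ≠ 0) :
    ord d (p * q) = ord d p + ord d q :=
  multiplicity_mul (prime_cyclotomic hd) (finiteMultiplicity_cyclotomic hd (mul_ne_zero hp hq))

theorem ord_one {d : ℕ} (hd : 0 < d) : ord d 1 = 0 :=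
  multiplicity_eq_zero.2 fun h => (prime_cyclotomic hd).not_isUnit (isUnit_of_dvd_one h)

theorem ord_le_of_dvd {d : ℕ} (hd : 0 < d) {p q : ℚ[X]} (h : p ∣ q) (hq : q ≠ 0) :
    ord d p ≤ ord d q := by
  obtain ⟨r, rfl⟩ := h
  rw [ord_mul hd (left_ne_zero_of_mul hq) (right_ne_zero_of_mul hq)]
  exact Nat.le_add_right _ _

theorem cyclotomic_dvd_X_pow_sub_one_iff {d m : ℕ} (hd : 0 < d) (hm : 0 < m) :
    cyclotomic d ℚ ∣ X ^ m - 1 ↔ d ∣ m := by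
  rw [← prod_cyclotomic_eq_X_pow_sub_one hm]
  refine ⟨fun h => ?_, fun h => Finset.dvd_prod_of_mem _ (Nat.mem_divisors.2 ⟨h, hm.ne'⟩)⟩
  obtain ⟨i, hi, h⟩ := (prime_cyclotomic hd).dvd_finsetProd_iff _ |>.1 h
  by_cases hdi : d = i
  · exact hdi ▸ Nat.dvd_of_mem_divisors hi
  · exact absurd ((cyclotomic.isCoprime_rat hdi).isUnit_of_dvd' dvd_rfl h)
      (prime_cyclotomic hd).not_isUnit

theorem X_pow_sub_one_ne_zero {m : ℕ} (hm : 0 < m) : (X ^ m - 1 : ℚ[X]) ≠ 0 :=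
  (monic_X_pow_sub_C (1 : ℚ) hm.ne').ne_zero

theorem ord_X_pow_sub_one {d m : ℕ} (hd : 0 < d) (hm : 0 < m) :
    ord d (X ^ m - 1) = if d ∣ m then 1 else 0 := by
  split_ifs with h
  · have hsq : Squarefree (X ^ m - 1 : ℚ[X]) :=
      (X_pow_sub_one_separable_iff.2 (by exact_mod_cast hm.ne')).squarefree
    refine le_antisymm ?_ ?_
    · by_contra! hlt
      have h2 := pow_dvd_of_le_multiplicity (show 2 ≤ multiplicity _ _ from hlt)
      rw [sq] at h2
      exact (prime_cyclotomic hd).not_isUnit (hsq _ h2)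
    · exact Nat.one_le_iff_ne_zero.2 (multiplicity_ne_zero.2
        ((cyclotomic_dvd_X_pow_sub_one_iff hd hm).2 h))
  · exact multiplicity_eq_zero.2 fun h2 => h ((cyclotomic_dvd_X_pow_sub_one_iff hd hm).1 h2)

theorem geom_sum_ne_zero' {m : ℕ} (hm : 0 < m) : (∑ k ∈ Finset.range m, X ^ k : ℚ[X]) ≠ 0 := fun h =>
  X_pow_sub_one_ne_zero hm (by rw [← geom_sum_mul, h, zero_mul])

theorem ord_geom_sum {d m : ℕ} (hd : 2 ≤ d) (hm : 0 < m) :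
    ord d (∑ k ∈ Finset.range m, X ^ k) = if d ∣ m then 1 else 0 := by
  have h := ord_X_pow_sub_one (d := d) (by omega) hm
  have h1 := ord_X_pow_sub_one (d := d) (by omega) one_pos
  rw [if_neg (fun h => by have := Nat.le_of_dvd one_pos h; omega), pow_one] at h1
  rwa [← geom_sum_mul, ord_mul (by omega) (geom_sum_ne_zero' hm)
    (by simpa using X_pow_sub_one_ne_zero one_pos), h1, add_zero] at h

theorem one_add_X_pow_ne_zero (j : ℕ) : (1 + X ^ j : ℚ[X]) ≠ 0 := fun h => by
  have := congrArg (eval 1) h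
  norm_num at this

theorem ord_one_add_X_pow {d j : ℕ} (hd : 2 ≤ d) (hj : 0 < j) :
    ord d (1 + X ^ j) + (if d ∣ j then 1 else 0) = if d ∣ 2 * j then 1 else 0 := by
  rw [← ord_X_pow_sub_one (by omega) hj, ← ord_X_pow_sub_one (by omega) (by omega : 0 < 2 * j),
    ← ord_mul (by omega) (one_add_X_pow_ne_zero j) (X_pow_sub_one_ne_zero hj)]
  congr 1
  ring

/-- The multiplicity of the `d`-th cyclotomic polynomial in the Poincaré polynomial of
type `Dₚ`. -/
def forkOrd (d p : ℕ) : ℕ := if d % 2 = 1 then p / d else p / d + (p + d / 2 - 1) / d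

theorem forkOrd_two {d : ℕ} (hd : 2 ≤ d) : forkOrd d 2 = 2 * if d ∣ 2 then 1 else 0 := by
  unfold forkOrd
  rcases Nat.eq_or_lt_of_le hd with rfl | h
  · norm_num
  · rw [if_neg (c := d ∣ 2) (fun h => by have := Nat.le_of_dvd two_pos h; omega),
      Nat.div_eq_of_lt h, Nat.div_eq_of_lt (by omega)]
    simp

theorem forkOrd_succ {d j : ℕ} (hd : 2 ≤ d) (hj : 0 < j) :
    forkOrd d (j + 1) =
      ord d (1 + X ^ j) + (if d ∣ j + 1 then 1 else 0) + forkOrd d j := by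
  have h := ord_one_add_X_pow hd hj
  unfold forkOrd
  by_cases h2 : d % 2 = 1
  · rw [if_pos h2, if_pos h2, Nat.succ_div]
    have : d ∣ 2 * j ↔ d ∣ j := by
      exact (Nat.coprime_two_right.2 (Nat.odd_iff.2 h2)).dvd_mul_left
    simp only [this] at h
    omega
  · rw [if_neg h2, if_neg h2, Nat.succ_div, show j + 1 + d / 2 - 1 = (j + d / 2 - 1) + 1 by omega,
      Nat.succ_div, show j + d / 2 - 1 + 1 = j + d / 2 by omega]
    have h3 : (d ∣ 2 * j) ↔ d ∣ j ∨ d ∣ j + d / 2 := by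
      obtain ⟨e, rfl⟩ : ∃ e, d = 2 * e := ⟨d / 2, by omega⟩
      rw [Nat.mul_dvd_mul_iff_left two_pos, Nat.mul_div_cancel_left e two_pos]
      constructor
      · rintro ⟨c, rfl⟩
        rcases Nat.even_or_odd' c with ⟨b, rfl | rfl⟩
        · exact Or.inl ⟨b, by ring⟩
        · exact Or.inr ⟨b + 1, by ring⟩
      · rintro (h | h)
        · exact dvd_trans ⟨2, by ring⟩ h
        · exact (Nat.dvd_add_left dvd_rfl).1 (dvd_trans ⟨2, by ring⟩ h)
    have h4 : d ∣ j → ¬ d ∣ j + d / 2 := fun h5 h6 => by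
      have := Nat.le_of_dvd (by omega) ((Nat.dvd_add_right h5).1 h6)
      omega
    by_cases h5 : d ∣ j <;> by_cases h6 : d ∣ j + d / 2 <;> simp [h3, h5, h6] at h h4 ⊢ <;> omega

/-- The combinatorial properties of the multiplicities of the `d`-th cyclotomic polynomial in the
Poincaré polynomials of the finite standard parabolic subgroups of type `D̃ₙ`. -/
structure IsWeight (n d : ℕ) (V : Finset ℕ → ℕ) : Prop where
  congr : ∀ s t, (∀ i, i ≤ n → (i ∈ s ↔ i ∈ t)) → V s = V t
  cut : ∀ s a, 2 ≤ a → a + 2 ≤ n → a ∉ s →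
    V s = V (s.filter (· < a)) + V (s.filter (a < ·))
  mono : ∀ s t, (∀ i, i ≤ n → i ∈ s → i ∈ t) → (∃ x, x ≤ n ∧ x ∉ t) → V s ≤ V t
  chain : ∀ i j, 1 ≤ i → i ≤ j → j ≤ n → V (Finset.Ico i j) = (j - i + 1) / d
  fork : ∀ j, 2 ≤ j → j ≤ n → V (Finset.Ico 0 j) = forkOrd d j
  swap : ∀ s t, (0 ∈ s ↔ 1 ∈ t) → (1 ∈ s ↔ 0 ∈ t) →
    (∀ i, 2 ≤ i → i ≤ n → (i ∈ s ↔ i ∈ t)) → V s = V t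
  flip : ∀ s t, (∀ i, i ≤ n → (i ∈ s ↔ n - i ∈ t)) → V s = V t

section

variable {n : ℕ} (hn : 4 ≤ n) {M : CoxeterMatrix (Fin (n + 1))} (hM : IsAffineD n M)
  {W : Type*} [Group W] (cs : CoxeterSystem M W)

include hn hM in
theorem isWeight_ord_poin {d : ℕ} (hd : 2 ≤ d) :
    IsWeight n d fun s => ord d (poin cs (nodes n s)) where
  congr s t h := by simp only [nodes_congr h]
  cut s a ha han has := by
    have hf : ∀ t : Finset ℕ, a ∉ t → (parabolic cs (nodes n t) : Set W).Finite :=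
      fun t => finite_of_not_mem hn hM cs (x := a) (by omega)
    have h1 := hf (s.filter (· < a)) (by simp)
    have h2 := hf (s.filter (a < ·)) (by simp)
    have := union_of_not_adj hn hM cs (u := s) (s := s.filter (· < a)) (t := s.filter (a < ·))
      (fun i _ => by
        simp only [Finset.mem_filter]
        refine ⟨fun h => ?_, by tauto⟩
        have : i ≠ a := fun h' => has (h' ▸ h)
        rcases lt_or_gt_of_ne this with h3 | h3
        · exact Or.inl ⟨h, h3⟩
        · exact Or.inr ⟨h, h3⟩)
      (fun i hi j hj => by
        simp only [Finset.mem_filter] at hi hj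
        unfold Adj
        omega) h1 h2
    rw [this.2, ord_mul (by omega) (poin_ne_zero cs h1) (poin_ne_zero cs h2)]
  mono s t h hx := by
    obtain ⟨x, hx, hxt⟩ := hx
    have ht := finite_of_not_mem hn hM cs hx hxt
    exact ord_le_of_dvd (by omega) (poin_dvd_of_subset cs
      (fun i hi => mem_nodes.2 (h _ (by omega) (mem_nodes.1 hi))) ht) (poin_ne_zero cs ht)
  chain i j hi hij hjn := by
    induction j, hij using Nat.le_induction with
    | base =>
      have hempty : nodes n (Finset.Ico i i) = ∅ := by ext; simp [mem_nodes]
      rw [hempty, poin_empty, ord_one (by omega), Nat.div_eq_of_lt (by omega)]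
    | succ j hij ih =>
      have hf := finite_chain hn hM cs hi hij (by omega)
      rw [(chain_step hn hM cs hi hij hjn hf).2, ord_mul (by omega) (geom_sum_ne_zero' (by omega))
        (poin_ne_zero cs hf), ih (by omega), ord_geom_sum hd (by omega), add_comm,
        show j + 2 - i = j - i + 1 + 1 by omega, show j + 1 - i + 1 = j - i + 1 + 1 by omega]
      exact Nat.succ_div.symm
  fork j hj hjn := by
    induction j, hj using Nat.le_induction with
    | base =>
      rw [(finite_and_poin_ends hn hM cs).2, sq, ord_mul (by omega) (geom_sum_ne_zero' (by omega))
        (geom_sum_ne_zero' (by omega)), ord_geom_sum hd (by omega), forkOrd_two hd, two_mul]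
    | succ j hj ih =>
      have hf := finite_fork hn hM cs hj (by omega)
      rw [(fork_step hn hM cs hj hjn hf).2, ord_mul (by omega)
        (mul_ne_zero (one_add_X_pow_ne_zero j) (geom_sum_ne_zero' (by omega)))
        (poin_ne_zero cs hf), ord_mul (by omega) (one_add_X_pow_ne_zero j)
        (geom_sum_ne_zero' (by omega)), ih (by omega), ord_geom_sum hd (by omega),
        forkOrd_succ hd (by omega)]
  swap s t h0 h1 h := by simp only [(swap_left hn hM cs h0 h1 h).2]
  flip s t h := by simp only [(flip hn hM cs h).2]

end

section

variable {n : ℕ} (hn : 4 ≤ n) {M : CoxeterMatrix (Fin (n + 1))} (hM : IsAffineD n M)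
  {W : Type*} [Group W] (cs : CoxeterSystem M W)

include hn in
theorem sum_cartanInt_mul_marks (i : ℕ) (hi : i ≤ n) :
    ∑ j ∈ Finset.range (n + 1), cartanInt n i j * (if j ≤ 1 ∨ n - 1 ≤ j then 1 else 2) = 0 := by
  let I : ℕ → ℕ → ℤ := fun a j => if a = j then 1 else 0
  have hI : ∀ a, a ≤ n → ∑ j ∈ Finset.range (n + 1), I a j = 1 := fun a ha => by
    simp only [I]
    rw [Finset.sum_ite_eq, if_pos (by rw [Finset.mem_range]; omega)]
  have hend : ∀ b, b ≤ n → (∀ j, j ≤ n → cartanInt n i j * (if j ≤ 1 ∨ n - 1 ≤ j then 1 else 2) =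
      2 * I i j - 2 * I b j) →
      ∑ j ∈ Finset.range (n + 1), cartanInt n i j * (if j ≤ 1 ∨ n - 1 ≤ j then 1 else 2) = 0 := by
    intro b hb h
    rw [Finset.sum_congr rfl fun j hj => h j (by rw [Finset.mem_range] at hj; omega),
      Finset.sum_sub_distrib, ← Finset.mul_sum, ← Finset.mul_sum, hI _ hi, hI _ hb, sub_self]
  have hmid : ∀ a b : ℤ, (∀ j, j ≤ n → cartanInt n i j * (if j ≤ 1 ∨ n - 1 ≤ j then 1 else 2) =
      4 * I i j - 2 * I (i - 1) j - 2 * I (i + 1) j + a * (I 1 j - I 0 j) +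
        b * (I (n - 1) j - I n j)) → i < n →
      ∑ j ∈ Finset.range (n + 1), cartanInt n i j * (if j ≤ 1 ∨ n - 1 ≤ j then 1 else 2) = 0 := by
    intro a b h hin
    rw [Finset.sum_congr rfl fun j hj => h j (by rw [Finset.mem_range] at hj; omega)]
    simp only [Finset.sum_sub_distrib, Finset.sum_add_distrib, ← Finset.mul_sum]
    rw [hI _ hi, hI _ (by omega), hI _ (by omega), hI _ (by omega), hI _ (by omega),
      hI _ (by omega), hI _ le_rfl]
    ring
  have hc : ∀ j, cartanInt n i j * (if j ≤ 1 ∨ n - 1 ≤ j then 1 else 2) =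
      if i = j then (if j ≤ 1 ∨ n - 1 ≤ j then 2 else 4) else if Adj n i j then
        (if j ≤ 1 ∨ n - 1 ≤ j then -1 else -2) else 0 := fun j => by
    unfold cartanInt
    split_ifs <;> rfl
  rcases (by omega : i ≤ 1 ∨ n - 1 ≤ i ∨ (2 ≤ i ∧ i + 2 ≤ n)) with h | h | h
  · refine hend 2 (by omega) fun j hj => ?_
    have hA : Adj n i j ↔ 2 = j := by
      unfold Adj
      constructor <;> intro <;> omega
    rw [hc]
    simp only [I, hA]
    split_ifs <;> omega
  · refine hend (n - 2) (by omega) fun j hj => ?_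
    have hA : Adj n i j ↔ n - 2 = j := by
      unfold Adj
      constructor <;> intro <;> omega
    rw [hc]
    simp only [I, hA]
    split_ifs <;> omega
  · refine hmid (if i = 2 then 1 else 0) (if i = n - 2 then 1 else 0) (fun j hj => ?_) (by omega)
    have hA : Adj n i j ↔ (i = 2 ∧ j ≤ 1) ∨ j = i + 1 ∨ (3 ≤ i ∧ j + 1 = i) ∨
        (i = n - 2 ∧ j = n) := by
      unfold Adj
      constructor <;> intro <;> omega
    rw [hc]
    simp only [I, hA]
    clear hend hmid hI hc hA
    rcases (by omega : j = 0 ∨ j = 1 ∨ j = n ∨ j = n - 1 ∨ (2 ≤ j ∧ j + 2 ≤ n)) with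
      h' | h' | h' | h' | h'
    · rw [if_neg (by omega), if_neg (c := i = j) (by omega), if_neg (c := i - 1 = j) (by omega),
        if_neg (c := i + 1 = j) (by omega), if_neg (c := 1 = j) (by omega),
        if_neg (c := n - 1 = j) (by omega), if_neg (c := n = j) (by omega), if_pos (c := 0 = j) h'.symm]
      split_ifs <;> omega
    · rw [if_neg (c := i = j) (by omega),
        if_neg (c := i + 1 = j) (by omega), if_pos (c := 1 = j) h'.symm,
        if_neg (c := n - 1 = j) (by omega), if_neg (c := n = j) (by omega),
        if_neg (c := 0 = j) (by omega)]
      split_ifs <;> omega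
    · rw [if_neg (c := i = j) (by omega), if_neg (c := i - 1 = j) (by omega),
        if_neg (c := i + 1 = j) (by omega), if_neg (c := 1 = j) (by omega),
        if_neg (c := n - 1 = j) (by omega), if_pos (c := n = j) h'.symm,
        if_neg (c := 0 = j) (by omega)]
      split_ifs <;> omega
    · rw [if_neg (c := i = j) (by omega), if_neg (c := i - 1 = j) (by omega),
        if_neg (c := 1 = j) (by omega),
        if_pos (c := n - 1 = j) h'.symm, if_neg (c := n = j) (by omega),
        if_neg (c := 0 = j) (by omega)]
      split_ifs <;> omega
    · rw [if_neg (c := 1 = j) (by omega), if_neg (c := n - 1 = j) (by omega),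
        if_neg (c := n = j) (by omega), if_neg (c := 0 = j) (by omega)]
      split_ifs <;> omega

include hn hM cs in
theorem infinite : Infinite W := by
  refine infinite_of_marks cs (simplyLaced hn hM) (fun i => if i.val ≤ 1 ∨ n - 1 ≤ i.val then 1 else 2)
    (fun i => by split_ifs <;> norm_num) fun i => ?_
  rw [← sum_cartanInt_mul_marks hn i (by omega), Finset.sum_range]
  exact Finset.sum_congr rfl fun j _ => by rw [cartan_apply hn hM]

include hn hM in
theorem finite_iff {σ : Finset (Fin (n + 1))} :
    (parabolic cs σ : Set W).Finite ↔ σ ≠ Finset.univ := by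
  constructor
  · rintro h rfl
    have htop : parabolic cs Finset.univ = ⊤ := by
      rw [parabolic, Finset.coe_univ, Set.image_univ, cs.subgroup_closure_range_simple]
    rw [htop, Subgroup.coe_top] at h
    have := infinite hn hM cs
    exact Set.infinite_univ h
  · intro h
    obtain ⟨x, hx⟩ : ∃ x, x ∉ σ := by
      by_contra! hall
      exact h (Finset.eq_univ_iff_forall.2 hall)
    have hσ : σ = nodes n (σ.map Fin.valEmbedding) := by
      ext i
      rw [mem_nodes, ← Fin.valEmbedding_apply, Finset.mem_map' Fin.valEmbedding]
    rw [hσ]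
    refine finite_of_not_mem hn hM cs (x := x) (by omega) ?_
    rwa [← Fin.valEmbedding_apply, Finset.mem_map' Fin.valEmbedding]

end

end AffineD

namespace AffineD

theorem add_div_le (d a b : ℕ) : (a + b) / d ≤ a / d + b / d + 1 := by
  rcases Nat.eq_zero_or_pos d with rfl | hd
  · simp
  · rw [Nat.add_div hd]
    split_ifs <;> omega

theorem forkOrd_odd {d : ℕ} (hd : d % 2 = 1) (p : ℕ) : forkOrd d p = p / d := if_pos hd

theorem forkOrd_even {d h : ℕ} (hd : d = 2 * h) (p : ℕ) :
    forkOrd d p = p / d + (p + h - 1) / d := by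
  subst hd
  rw [forkOrd, if_neg (by omega), Nat.mul_div_cancel_left h two_pos]

theorem forkOrd_mono {d : ℕ} {p q : ℕ} (h : p ≤ q) : forkOrd d p ≤ forkOrd d q := by
  unfold forkOrd
  have h1 := Nat.div_le_div_right (c := d) h
  have h2 := Nat.div_le_div_right (c := d) (by omega : p + d / 2 - 1 ≤ q + d / 2 - 1)
  split_ifs <;> omega

theorem forkOrd_zero {d : ℕ} (hd : 2 ≤ d) : forkOrd d 0 = 0 := by
  unfold forkOrd
  rw [Nat.zero_div, Nat.div_eq_of_lt (by omega : 0 + d / 2 - 1 < d)]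
  simp

section

variable {d h : ℕ} (hd : d = 2 * h) (hh : 1 ≤ h)

include hd hh

theorem forkOrd_add_self (p : ℕ) : forkOrd d (p + d) = forkOrd d p + 2 := by
  rw [forkOrd_even hd, forkOrd_even hd, Nat.add_div_right p (by omega),
    show p + d + h - 1 = p + h - 1 + d by omega, Nat.add_div_right _ (by omega)]
  omega

theorem forkOrd_eq_zero {p : ℕ} (hp : p ≤ h) : forkOrd d p = 0 := by
  rw [forkOrd_even hd, Nat.div_eq_of_lt (by omega), Nat.div_eq_of_lt (by omega)]

theorem forkOrd_pos {p : ℕ} (hp : h + 1 ≤ p) : 1 ≤ forkOrd d p := by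
  rw [forkOrd_even hd]
  have := Nat.div_le_div_right (c := d) (by omega : d ≤ p + h - 1)
  rw [Nat.div_self (by omega)] at this
  exact le_add_left this

theorem div_lt_forkOrd {p : ℕ} (hp : h + 1 ≤ p) : p / d + 1 ≤ forkOrd d p := by
  rw [forkOrd_even hd]
  have := Nat.div_le_div_right (c := d) (by omega : d ≤ p + h - 1)
  rw [Nat.div_self (by omega)] at this
  omega

theorem forkOrd_add_le {p q : ℕ} (hq : q + 1 ≤ h) : forkOrd d (p + q) ≤ forkOrd d p + 1 := by
  rw [forkOrd_even hd, forkOrd_even hd]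
  have h1 := Nat.div_add_mod p d
  have h2 : p % d < d := Nat.mod_lt _ (by omega)
  by_cases c : p % d < h + 1
  · have e1 : (p + q) / d ≤ p / d := by
      refine Nat.le_of_lt_succ ((Nat.div_lt_iff_lt_mul (by omega)).2 ?_)
      have : (p / d).succ * d = d * (p / d) + d := by rw [Nat.succ_mul, mul_comm]
      omega
    have e2 := Nat.div_le_div_right (c := d) (by omega : p + q + h - 1 ≤ p + h - 1 + d)
    rw [Nat.add_div_right _ (by omega)] at e2
    omega
  · have e1 := Nat.div_le_div_right (c := d) (by omega : p + q ≤ p + d)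
    rw [Nat.add_div_right _ (by omega)] at e1
    have e2 : (p + q + h - 1) / d ≤ p / d + 1 := by
      refine Nat.le_of_lt_succ ((Nat.div_lt_iff_lt_mul (by omega)).2 ?_)
      have : (p / d + 1).succ * d = d * (p / d) + 2 * d := by
        rw [Nat.succ_mul, add_mul, mul_comm d]; omega
      omega
    have e3 : p / d + 1 ≤ (p + h - 1) / d := by
      rw [Nat.le_div_iff_mul_le (by omega), add_mul, mul_comm]
      omega
    omega

theorem lt_forkOrd_add (p : ℕ) : forkOrd d p + 1 ≤ forkOrd d (p + h + 1) := by
  rw [forkOrd_even hd, forkOrd_even hd]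
  have e1 := Nat.div_le_div_right (c := d) (by omega : p + h - 1 ≤ p + h + 1)
  have e2 := Nat.div_le_div_right (c := d) (by omega : p + d ≤ p + h + 1 + h - 1)
  rw [Nat.add_div_right _ (by omega)] at e2
  omega

theorem add_div_lt_forkOrd {p q : ℕ} (hpq : forkOrd d p < forkOrd d (p + q)) :
    forkOrd d p + q / d + 1 ≤ forkOrd d (p + q) := by
  rw [forkOrd_even hd, forkOrd_even hd] at *
  have e1 : p / d + q / d ≤ (p + q) / d := Nat.div_add_div_le_add_div
  by_cases c : (p + h - 1) / d < (p + q + h - 1) / d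
  · omega
  · have e2 : (p + h - 1) / d + q / d ≤ (p + h - 1 + q) / d := Nat.div_add_div_le_add_div
    have e3 := Nat.div_le_div_right (c := d) (by omega : p + h - 1 + q ≤ p + q + h - 1)
    omega

theorem forkOrd_add_le_of_dvd {k q : ℕ} (hk : d ∣ k) (hq : q ≤ d + h) :
    forkOrd d (k + q) ≤ forkOrd d k + q / d + 1 := by
  obtain ⟨c, rfl⟩ := hk
  rw [forkOrd_even hd, forkOrd_even hd, show d * c + q + h - 1 = q + h - 1 + d * c by omega,
    show d * c + h - 1 = h - 1 + d * c by omega, add_comm (d * c) q,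
    Nat.add_mul_div_left _ _ (by omega), Nat.add_mul_div_left _ _ (by omega),
    Nat.add_mul_div_left _ _ (by omega), Nat.mul_div_cancel_left _ (by omega)]
  have : (q + h - 1) / d ≤ 1 := by
    refine Nat.le_of_lt_succ ((Nat.div_lt_iff_lt_mul (by omega)).2 ?_)
    omega
  have := Nat.zero_le ((h - 1) / d)
  omega

end

theorem forkOrd_succ_le {d p : ℕ} (hd : 2 ≤ d) (h2 : ¬(d = 2 ∧ p % 2 = 1)) :
    forkOrd d (p + 1) ≤ forkOrd d p + 1 := by
  by_cases c : d % 2 = 1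
  · rw [forkOrd_odd c, forkOrd_odd c, Nat.succ_div]
    split_ifs <;> omega
  · obtain ⟨h, hh⟩ : ∃ h, d = 2 * h := ⟨d / 2, by omega⟩
    by_cases c2 : h = 1
    · have hd2 : d = 2 := by omega
      subst hd2
      rw [forkOrd_even hh, forkOrd_even hh, c2]
      omega
    · exact forkOrd_add_le hh (by omega) (by omega)

end AffineD

namespace AffineD

namespace IsWeight

variable {n d : ℕ} {V : Finset ℕ → ℕ} (w : IsWeight n d V) (hn : 4 ≤ n) (hd : 2 ≤ d)

include w hn hd

theorem eq_zero {s : Finset ℕ} (h : ∀ i, i ≤ n → i ∉ s) : V s = 0 := by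
  have := w.chain 1 1 le_rfl le_rfl (by omega)
  rw [Nat.div_eq_of_lt (by omega)] at this
  rw [← this]
  refine w.congr _ _ fun i hi => ?_
  simp [h i hi]

theorem cut' {s : Finset ℕ} {a : ℕ} (ha : a ≤ n) (ha1 : a ≠ 1) (han : a + 1 ≠ n) (has : a ∉ s) :
    V s = V (s.filter (· < a)) + V (s.filter (a < ·)) := by
  by_cases h0 : a = 0
  · rw [w.eq_zero hn hd (s := s.filter (· < a)) (by simp [h0]), zero_add]
    refine w.congr _ _ fun i hi => ?_
    grind
  by_cases h1 : a = n
  · rw [w.eq_zero hn hd (s := s.filter (a < ·)) (by grind), add_zero]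
    refine w.congr _ _ fun i hi => ?_
    grind
  exact w.cut s a (by omega) (by omega) has

omit hn hd in
theorem segment {s : Finset ℕ} {a b : ℕ} (hab : a < b) (hb : b ≤ n)
    (h : ∀ i, i ≤ n → (i ∈ s ↔ a < i ∧ i < b)) : V s = (b - a) / d := by
  rw [w.congr s (Finset.Ico (a + 1) b) (fun i hi => by rw [h i hi, Finset.mem_Ico]; omega),
    w.chain _ _ (by omega) (by omega) hb]
  congr 1
  omega

theorem left_segment {s : Finset ℕ} {b : ℕ} (hb : b ≤ n) (hb1 : b ≠ 1)
    (h : ∀ i, i ≤ n → (i ∈ s ↔ i < b)) : V s = forkOrd d b := by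
  by_cases h0 : b = 0
  · rw [h0, forkOrd_zero hd]
    exact w.eq_zero hn hd fun i hi => by rw [h i hi]; omega
  · rw [w.congr s (Finset.Ico 0 b) (fun i hi => by rw [h i hi, Finset.mem_Ico]; omega),
      w.fork _ (by omega) hb]

/-- The effect of filling the gap `j` between the consecutive gaps `a` and `b`. -/
theorem join {s t : Finset ℕ} {a j b : ℕ} (haj : a < j) (hjb : j < b) (hbn : b ≤ n)
    (ha : a ≠ 1) (hj : j ≠ 1) (hb : b ≠ 1) (han : a + 1 ≠ n) (hjn : j + 1 ≠ n) (hbn' : b + 1 ≠ n)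
    (has : a ∉ s) (hjs : j ∉ s) (hbs : b ∉ s) (hs : ∀ i, a < i → i < b → i ≠ j → i ∈ s)
    (ht : ∀ i, i ≤ n → (i ∈ t ↔ i ∈ s ∨ i = j)) :
    V t + (j - a) / d + (b - j) / d = V s + (b - a) / d := by
  have hat : a ∉ t := by grind
  have hbt : b ∉ t := by grind
  rw [w.cut' hn hd (by omega) ha han has, w.cut' hn hd (by omega) ha han hat,
    w.cut' hn hd (s := s.filter (a < ·)) hbn hb hbn' (by grind),
    w.cut' hn hd (s := t.filter (a < ·)) hbn hb hbn' (by grind),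
    w.cut' hn hd (s := (s.filter (a < ·)).filter (· < b)) (a := j) (by omega) hj hjn (by grind),
    w.congr (t.filter (· < a)) (s.filter (· < a)) (by grind),
    w.congr ((t.filter (a < ·)).filter (b < ·)) ((s.filter (a < ·)).filter (b < ·)) (by grind),
    w.segment (a := a) (b := b) (s := (t.filter (a < ·)).filter (· < b)) (by omega) hbn
      (by grind),
    w.segment (a := a) (b := j) (s := ((s.filter (a < ·)).filter (· < b)).filter (· < j))
      (by omega) (by omega) (by grind),
    w.segment (a := j) (b := b) (s := ((s.filter (a < ·)).filter (· < b)).filter (j < ·))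
      (by omega) (by omega) (by grind)]
  omega

/-- The effect of filling the first gap `j`, where `b` is the second gap. -/
theorem join_left {s t : Finset ℕ} {j b : ℕ} (hjb : j < b) (hbn : b ≤ n)
    (hj : j ≠ 1) (hb : b ≠ 1) (hjn : j + 1 ≠ n) (hbn' : b + 1 ≠ n)
    (hjs : j ∉ s) (hbs : b ∉ s) (hs : ∀ i, i < b → i ≠ j → i ∈ s)
    (ht : ∀ i, i ≤ n → (i ∈ t ↔ i ∈ s ∨ i = j)) :
    V t + forkOrd d j + (b - j) / d = V s + forkOrd d b := by
  have hbt : b ∉ t := by grind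
  rw [w.cut' hn hd hbn hb hbn' hbs, w.cut' hn hd hbn hb hbn' hbt,
    w.cut' hn hd (s := s.filter (· < b)) (a := j) (by omega) hj hjn (by grind),
    w.congr (t.filter (b < ·)) (s.filter (b < ·)) (by grind),
    w.left_segment hn hd (b := b) (s := t.filter (· < b)) hbn hb (by grind),
    w.left_segment hn hd (b := j) (s := (s.filter (· < b)).filter (· < j)) (by omega) hj (by grind),
    w.segment (a := j) (b := b) (s := (s.filter (· < b)).filter (j < ·)) hjb hbn (by grind)]
  omega

/-- The labels reflected along the diagram. -/
def _root_.AffineD.reflect (n : ℕ) (s : Finset ℕ) : Finset ℕ :=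
  (Finset.range (n + 1)).filter fun i => n - i ∈ s

omit w hn hd in
theorem _root_.AffineD.mem_reflect {s : Finset ℕ} {i : ℕ} :
    i ∈ reflect n s ↔ i ≤ n ∧ n - i ∈ s := by
  rw [reflect, Finset.mem_filter, Finset.mem_range, Nat.lt_succ_iff]

omit hn hd in
theorem reflect_eq (s : Finset ℕ) : V (reflect n s) = V s :=
  w.flip _ _ fun i hi => by simp [mem_reflect, hi]

/-- The effect of filling the last gap `j`, where `a` is the second to last gap. -/
theorem join_right {s t : Finset ℕ} {a j : ℕ} (haj : a < j) (hjn' : j ≤ n)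
    (ha : a ≠ 1) (hj : j ≠ 1) (han : a + 1 ≠ n) (hjn : j + 1 ≠ n)
    (has : a ∉ s) (hjs : j ∉ s) (hs : ∀ i, a < i → i ≤ n → i ≠ j → i ∈ s)
    (ht : ∀ i, i ≤ n → (i ∈ t ↔ i ∈ s ∨ i = j)) :
    V t + forkOrd d (n - j) + (j - a) / d = V s + forkOrd d (n - a) := by
  have := w.join_left hn hd (s := reflect n s) (t := reflect n t) (j := n - j) (b := n - a)
    (by omega) (by omega) (by omega) (by omega) (by omega) (by omega)
    (by rw [mem_reflect, Nat.sub_sub_self hjn']; tauto)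
    (by rw [mem_reflect, Nat.sub_sub_self (by omega)]; tauto)
    (fun i hi hij => mem_reflect.2 ⟨by omega, hs _ (by omega) (by omega) (by omega)⟩)
    (fun i hi => by
      rw [mem_reflect, mem_reflect, ht _ (by omega)]
      have : n - i = j ↔ i = n - j := by omega
      tauto)
  rwa [w.reflect_eq, w.reflect_eq, show n - a - (n - j) = j - a by omega] at this

end IsWeight

end AffineD

namespace AffineD

/-- The first gap `m ≥ 2`, or `n` if there is none. -/
noncomputable def firstGap (n : ℕ) (s : Finset ℕ) : ℕ := sInf {m | 2 ≤ m ∧ (m ∉ s ∨ m = n)}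

/-- The last gap `m` with `2 ≤ m ≤ n - 2`, or `0` if there is none. -/
def lastGap (n : ℕ) (s : Finset ℕ) : ℕ :=
  ((Finset.range (n - 1)).filter fun m => 2 ≤ m ∧ m ∉ s).sup id

/-- The number of layers used by the matching for `D̃ₙ`. -/
def depth (n d : ℕ) : ℕ := max 1 (forkOrd d (n - d))

/-- The matching for `D̃ₙ` is ordered by this level. -/
noncomputable def level (n d : ℕ) (s : Finset ℕ) : ℕ :=
  if 1 ∉ s then 0 else if n - 1 ∉ s then 1
  else if d % 2 = 1 ∨ firstGap n s ≤ d / 2 then 2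
  else if n ≤ d + 1 ∨ 0 ∉ s then 3
  else if forkOrd d (firstGap n s) < depth n d then 4 + forkOrd d (firstGap n s)
  else if n - lastGap n s ≤ d / 2 then 4 + depth n d
  else 5 + depth n d

/-- The node toggled by the matching for `D̃ₙ` at a given level. -/
noncomputable def pivot (n d k : ℕ) : ℕ :=
  if k = 0 then (if d = 2 ∧ n % 2 = 0 then 2 else 0)
  else if k = 1 then (if d = 2 ∧ n % 2 = 0 then n - 2 else n)
  else if k = 2 then 0
  else if k = 3 then (if n ≤ d + 1 then n else d)
  else if k < 4 + depth n d then sInf {j | j ≤ n ∧ k - 4 < forkOrd d j ∧ d ∣ n - j}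
  else if k = 4 + depth n d then n
  else sInf {p | depth n d ≤ forkOrd d p}

theorem firstGap_spec {n : ℕ} (hn : 4 ≤ n) (s : Finset ℕ) :
    2 ≤ firstGap n s ∧ firstGap n s ≤ n ∧ (firstGap n s ∉ s ∨ firstGap n s = n) ∧
      ∀ m, 2 ≤ m → m < firstGap n s → m ∈ s := by
  have hmem : n ∈ {m | 2 ≤ m ∧ (m ∉ s ∨ m = n)} := ⟨by omega, Or.inr rfl⟩
  have h := Nat.sInf_mem ⟨n, hmem⟩
  refine ⟨h.1, Nat.sInf_le hmem, h.2, fun m hm hlt => ?_⟩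
  by_contra hms
  exact Nat.notMem_of_lt_sInf hlt ⟨hm, Or.inl hms⟩

theorem lastGap_spec {n : ℕ} (hn : 4 ≤ n) (s : Finset ℕ) :
    lastGap n s + 2 ≤ n ∧ (lastGap n s = 0 ∨ 2 ≤ lastGap n s ∧ lastGap n s ∉ s) ∧
      ∀ m, 2 ≤ m → lastGap n s < m → m + 2 ≤ n → m ∈ s := by
  set F := (Finset.range (n - 1)).filter fun m => 2 ≤ m ∧ m ∉ s with hF
  have key : ∀ m, m ∈ F ↔ m < n - 1 ∧ 2 ≤ m ∧ m ∉ s := fun m => by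
    rw [hF, Finset.mem_filter, Finset.mem_range]
  have hle : ∀ m, m ∈ F → m ≤ lastGap n s := fun m hm => Finset.le_sup (f := id) hm
  have h2 : lastGap n s = 0 ∨ lastGap n s ∈ F := by
    rcases F.eq_empty_or_nonempty with h | h
    · left
      rw [lastGap, ← hF, h, Finset.sup_empty]
      rfl
    · right
      obtain ⟨x, hx, hxe⟩ := Finset.exists_mem_eq_sup F h id
      rw [lastGap, ← hF, hxe]
      exact hx
  refine ⟨?_, ?_, fun m hm hlt hmn => ?_⟩
  · rcases h2 with h | h
    · omega
    · have := ((key _).1 h).1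
      omega
  · exact h2.imp_right fun h => ((key _).1 h).2
  · by_contra hms
    have := hle m ((key m).2 ⟨by omega, hm, hms⟩)
    omega

section

variable {n : ℕ} (hn : 4 ≤ n) {s t : Finset ℕ}

include hn

theorem firstGap_mono (h : ∀ i, i ≤ n → i ∈ s → i ∈ t) : firstGap n s ≤ firstGap n t := by
  obtain ⟨_, _, _, h4⟩ := firstGap_spec hn s
  obtain ⟨_, _, h3', _⟩ := firstGap_spec hn t
  by_contra hc
  have := h4 (firstGap n t) (by omega) (by omega)
  rcases h3' with h5 | h5
  · exact h5 (h _ (by omega) this)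
  · omega

theorem lastGap_anti (h : ∀ i, i ≤ n → i ∈ s → i ∈ t) : lastGap n t ≤ lastGap n s := by
  obtain ⟨_, _, h3⟩ := lastGap_spec hn s
  obtain ⟨_, h2', _⟩ := lastGap_spec hn t
  by_contra hc
  rcases h2' with h5 | h5
  · omega
  · exact h5.2 (h _ (by omega) (h3 _ h5.1 (by omega) (by omega)))

variable {y : ℕ} (ht : ∀ i, i ≤ n → (i ∈ t ↔ i ∈ s ∨ i = y))

include ht

theorem firstGap_fill : firstGap n s = firstGap n t ∨ firstGap n s = y := by
  by_contra! hc
  obtain ⟨h1, h2, h3, _⟩ := firstGap_spec hn s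
  obtain ⟨_, h2', _, h4'⟩ := firstGap_spec hn t
  have h5 := firstGap_mono hn fun i hi his => (ht i hi).2 (Or.inl his)
  have h6 := h4' (firstGap n s) h1 (by omega)
  rw [ht _ h2] at h6
  rcases h3 with h3 | h3
  · tauto
  · omega

theorem lastGap_fill : lastGap n s = lastGap n t ∨ lastGap n s = y := by
  by_contra! hc
  obtain ⟨h1, h2, _⟩ := lastGap_spec hn s
  obtain ⟨_, _, h3'⟩ := lastGap_spec hn t
  have h5 := lastGap_anti hn fun i hi his => (ht i hi).2 (Or.inl his)
  rcases h2 with h2 | h2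
  · omega
  · have h6 := h3' (lastGap n s) h2.1 (by omega) h1
    rw [ht _ (by omega)] at h6
    tauto

end

theorem one_le_depth (n d : ℕ) : 1 ≤ depth n d := le_max_left _ _

section

variable {n d h : ℕ} (hd : d = 2 * h) (hh : 1 ≤ h) (hnd : d + 2 ≤ n)

include hd hh hnd

theorem pivot_layer {c : ℕ} (hc : 1 ≤ c) (hcG : c < depth n d) :
    c < forkOrd d (pivot n d (4 + c)) ∧ d ∣ n - pivot n d (4 + c) ∧ pivot n d (4 + c) + d ≤ n ∧
      (d ≤ pivot n d (4 + c) → forkOrd d (pivot n d (4 + c) - d) ≤ c) ∧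
      h < pivot n d (4 + c) := by
  have e : pivot n d (4 + c) = sInf {j | j ≤ n ∧ c < forkOrd d j ∧ d ∣ n - j} := by
    unfold pivot
    simp only [show 4 + c ≠ 0 by omega, show 4 + c ≠ 1 by omega, show 4 + c ≠ 2 by omega,
      show 4 + c ≠ 3 by omega, show 4 + c < 4 + depth n d by omega, if_false, if_true,
      Nat.add_sub_cancel_left]
  set P := {j | j ≤ n ∧ c < forkOrd d j ∧ d ∣ n - j} with hP
  have hmem : n - d ∈ P :=
    ⟨by omega, by unfold depth at hcG; omega, by rw [Nat.sub_sub_self (by omega)]⟩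
  have h1 := Nat.sInf_mem ⟨_, hmem⟩
  have h2 := Nat.sInf_le hmem
  rw [e]
  refine ⟨h1.2.1, h1.2.2, by omega, fun hle => ?_, ?_⟩
  · by_contra! hlt
    refine Nat.notMem_of_lt_sInf (m := sInf P - d) (s := P) (by omega) ⟨by omega, hlt, ?_⟩
    rw [show n - (sInf P - d) = n - sInf P + d by have := h1.1; omega]
    exact dvd_add h1.2.2 dvd_rfl
  · by_contra! hle
    have := h1.2.1
    rw [forkOrd_eq_zero hd hh hle] at this
    omega

theorem pivot_last :
    depth n d ≤ forkOrd d (pivot n d (5 + depth n d)) ∧ h < pivot n d (5 + depth n d) ∧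
      pivot n d (5 + depth n d) + h + 1 ≤ n ∧
      (pivot n d (5 + depth n d) + d ≤ n ∨ depth n d = 1) ∧
      ∀ p, depth n d ≤ forkOrd d p → pivot n d (5 + depth n d) ≤ p := by
  have hG := one_le_depth n d
  have e : pivot n d (5 + depth n d) = sInf {p | depth n d ≤ forkOrd d p} := by
    unfold pivot
    simp only [show 5 + depth n d ≠ 0 by omega, show 5 + depth n d ≠ 1 by omega,
      show 5 + depth n d ≠ 2 by omega, show 5 + depth n d ≠ 3 by omega,
      show ¬ 5 + depth n d < 4 + depth n d by omega, show 5 + depth n d ≠ 4 + depth n d by omega,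
      if_false]
  set P := {p | depth n d ≤ forkOrd d p} with hP
  have hle : ∀ p, depth n d ≤ forkOrd d p → sInf P ≤ p := fun p hp => Nat.sInf_le hp
  have hmem : depth n d ≤ forkOrd d (n - h - 1) := by
    unfold depth
    exact max_le (forkOrd_pos hd hh (by omega)) (forkOrd_mono (by omega))
  have h1 : depth n d ≤ forkOrd d (sInf P) := Nat.sInf_mem (s := P) ⟨_, hmem⟩
  have h2 := hle _ hmem
  rw [e]
  refine ⟨h1, ?_, by omega, ?_, hle⟩
  · by_contra! hc
    rw [forkOrd_eq_zero hd hh hc] at h1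
    omega
  · by_cases c : depth n d ≤ forkOrd d (n - d)
    · have := hle _ c
      omega
    · unfold depth at c ⊢
      omega

omit hnd hd hh in
theorem pivot_top : pivot n d (4 + depth n d) = n := by
  have hG := one_le_depth n d
  unfold pivot
  simp only [show 4 + depth n d ≠ 0 by omega, show 4 + depth n d ≠ 1 by omega,
    show 4 + depth n d ≠ 2 by omega, show 4 + depth n d ≠ 3 by omega,
    lt_irrefl, if_false, if_true]

end

theorem level_mono {n d : ℕ} (hn : 4 ≤ n) {s t : Finset ℕ} (h : ∀ i, i ≤ n → i ∈ s → i ∈ t) :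
    level n d s ≤ level n d t := by
  have h0 := h 0 (by omega)
  have h1 := h 1 (by omega)
  have h2 := h (n - 1) (by omega)
  have h3 := firstGap_mono hn h
  have h4 := lastGap_anti hn h
  have h5 := forkOrd_mono (d := d) h3
  have h6 := one_le_depth n d
  unfold level
  grind (splits := 20)

end AffineD

namespace AffineD

theorem level_cases (n : ℕ) {d : ℕ} (hd : 2 ≤ d) (s : Finset ℕ) :
    (1 ∉ s ∧ level n d s = 0) ∨ (1 ∈ s ∧ n - 1 ∉ s ∧ level n d s = 1) ∨
    (1 ∈ s ∧ n - 1 ∈ s ∧ ((d % 2 = 1 ∨ firstGap n s ≤ d / 2) ∧ level n d s = 2 ∨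
    ∃ h, d = 2 * h ∧ 1 ≤ h ∧ h < firstGap n s ∧
      (n ≤ d + 1 ∧ level n d s = 3 ∨ d + 2 ≤ n ∧ (0 ∉ s ∧ level n d s = 3 ∨
      0 ∈ s ∧ (forkOrd d (firstGap n s) < depth n d ∧
          level n d s = 4 + forkOrd d (firstGap n s) ∨
        depth n d ≤ forkOrd d (firstGap n s) ∧
          (n ≤ lastGap n s + h ∧ level n d s = 4 + depth n d ∨
          lastGap n s + h < n ∧ level n d s = 5 + depth n d)))))) := by
  unfold level
  by_cases c1 : 1 ∈ s
  swap
  · simp [c1]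
  by_cases c2 : n - 1 ∈ s
  swap
  · simp [c1, c2]
  simp only [c1, c2, not_true, false_and, true_and, false_or, if_false]
  by_cases c3 : d % 2 = 1 ∨ firstGap n s ≤ d / 2
  · simp [c3]
  right
  rw [if_neg c3]
  refine ⟨d / 2, by omega, by omega, by omega, ?_⟩
  by_cases c4 : n ≤ d + 1
  · simp [c4]
  right
  refine ⟨by omega, ?_⟩
  by_cases c5 : 0 ∈ s
  swap
  · simp [c5]
  right
  refine ⟨c5, ?_⟩
  rw [if_neg (by tauto)]
  by_cases c6 : forkOrd d (firstGap n s) < depth n d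
  · simp [c6]
  right
  refine ⟨by omega, ?_⟩
  rw [if_neg c6]
  split_ifs
  · omega
  · omega

section

variable {n d : ℕ} (hn : 4 ≤ n) (hd : 2 ≤ d)

theorem pivot_zero : pivot n d 0 = if d = 2 ∧ n % 2 = 0 then 2 else 0 := rfl

theorem pivot_one : pivot n d 1 = if d = 2 ∧ n % 2 = 0 then n - 2 else n := rfl

theorem pivot_two : pivot n d 2 = 0 := rfl

theorem pivot_three : pivot n d 3 = if n ≤ d + 1 then n else d := rfl

include hn hd

theorem pivot_level_le (s : Finset ℕ) : pivot n d (level n d s) ≤ n := by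
  rcases level_cases n hd s with ⟨_, e⟩ | ⟨_, _, e⟩ | ⟨_, _, ⟨_, e⟩ | ⟨h, h1, h2, h3, H⟩⟩
  · rw [e, pivot_zero]
    split_ifs <;> omega
  · rw [e, pivot_one]
    split_ifs <;> omega
  · rw [e, pivot_two]
    omega
  · rcases H with ⟨_, e⟩ | ⟨h4, ⟨_, e⟩ | ⟨_, ⟨h5, e⟩ | ⟨_, ⟨_, e⟩ | ⟨_, e⟩⟩⟩⟩
    · rw [e, pivot_three, if_pos (by omega)]
    · rw [e, pivot_three]
      split_ifs <;> omega
    · rw [e]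
      have := pivot_layer h1 h2 h4 (forkOrd_pos h1 h2 (by omega)) h5
      omega
    · rw [e, pivot_top]
    · rw [e]
      have := pivot_last h1 h2 h4
      omega

variable {s t : Finset ℕ} {y : ℕ} (ht : ∀ i, i ≤ n → (i ∈ t ↔ i ∈ s ∨ i = y))

include ht

theorem level_le_of_eq_pivot_left (hy : y = pivot n d (level n d s)) :
    level n d t ≤ level n d s := by
  have t0 := ht 0 (by omega)
  have t1 := ht 1 (by omega)
  have t2 := ht (n - 1) (by omega)
  have p1 := firstGap_mono hn fun i hi his => (ht i hi).2 (Or.inl his)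
  have p2 := firstGap_fill hn ht
  have p3 := firstGap_spec hn s
  have p4 := firstGap_spec hn t
  have e1 := lastGap_anti hn fun i hi his => (ht i hi).2 (Or.inl his)
  have e2 := lastGap_fill hn ht
  have e3 := lastGap_spec hn s
  have pg := forkOrd_mono (d := d) p1
  rcases level_cases n hd s with ⟨_, e⟩ | ⟨_, _, e⟩ | ⟨_, _, ⟨_, e⟩ | ⟨h, h1, h2, h3, H⟩⟩
  · rw [e, pivot_zero] at hy
    rcases level_cases n hd t with ⟨_, e'⟩ | ⟨_, _, e'⟩ | ⟨_, _, _⟩ <;> grind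
  · rw [e, pivot_one] at hy
    rcases level_cases n hd t with ⟨_, e'⟩ | ⟨_, _, e'⟩ | ⟨_, _, _⟩ <;> grind
  · rw [e, pivot_two] at hy
    rcases level_cases n hd t with ⟨_, e'⟩ | ⟨_, _, e'⟩ | ⟨_, _, ⟨_, e'⟩ | ⟨h, h1, h2, h3, H⟩⟩ <;>
      omega
  · have lt4 : n ≤ d + 1 ∨ 0 ∉ t → level n d t ≤ 3 := by
      intro hc
      unfold level
      split_ifs <;> omega
    have lt5 : forkOrd d (firstGap n t) < depth n d →
        level n d t ≤ 4 + forkOrd d (firstGap n t) := by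
      intro hc
      unfold level
      split_ifs <;> omega
    have lt6 : n ≤ lastGap n t + h → level n d t ≤ 4 + depth n d := by
      intro hc
      unfold level
      split_ifs <;> omega
    have lt7 : level n d t ≤ 5 + depth n d := by
      unfold level
      split_ifs <;> omega
    rcases H with ⟨_, e⟩ | ⟨h4, ⟨_, e⟩ | ⟨_, ⟨h5, e⟩ | ⟨_, ⟨_, e⟩ | ⟨_, e⟩⟩⟩⟩
    · rw [e]
      exact lt4 (Or.inl ‹_›)
    · rw [e, pivot_three, if_neg (by omega)] at hy
      rw [e]
      refine lt4 (Or.inr fun hc => ?_)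
      have := (t0.1 hc).resolve_left ‹_›
      omega
    · rw [e] at hy
      obtain ⟨q1, -, q2, q3, q4⟩ := pivot_layer h1 h2 h4 (forkOrd_pos h1 h2 (by omega)) h5
      rw [← hy] at q1
      have : firstGap n s = firstGap n t := p2.resolve_right fun hc => by
        rw [hc] at q1
        exact lt_irrefl _ q1
      rw [e, this]
      exact lt5 (this ▸ h5)
    · rw [e, pivot_top] at hy
      rw [e]
      apply lt6
      omega
    · rw [e]
      exact lt7

theorem level_le_of_eq_pivot_right (hy : y = pivot n d (level n d t)) :
    level n d t ≤ level n d s := by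
  have t0 := ht 0 (by omega)
  have t1 := ht 1 (by omega)
  have t2 := ht (n - 1) (by omega)
  have p1 := firstGap_mono hn fun i hi his => (ht i hi).2 (Or.inl his)
  have p2 := firstGap_fill hn ht
  have p3 := firstGap_spec hn s
  have p4 := firstGap_spec hn t
  have e1 := lastGap_anti hn fun i hi his => (ht i hi).2 (Or.inl his)
  have e2 := lastGap_fill hn ht
  have e3 := lastGap_spec hn s
  have pg := forkOrd_mono (d := d) p1
  have hs1 : 1 ∈ t → y ≠ 1 → 1 ∈ s := fun a b => (t1.1 a).resolve_right b.symm
  have hs2 : n - 1 ∈ t → y + 1 ≠ n → n - 1 ∈ s := by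
    intro hc hc'
    exact (t2.1 hc).resolve_right (by omega)
  rcases level_cases n hd t with ⟨_, e⟩ | ⟨i1, _, e⟩ | ⟨i1, i2, ⟨_, e⟩ | ⟨h, h1, h2, h3, H⟩⟩
  · omega
  · rw [e, pivot_one] at hy
    have := hs1 i1 (by split_ifs at hy <;> omega)
    rw [e]
    unfold level
    simp only [this, not_true, if_false]
    split_ifs <;> omega
  · rw [e, pivot_two] at hy
    have := hs1 i1 (by omega)
    have := hs2 i2 (by omega)
    rw [e]
    unfold level
    simp only [*, not_true, if_false]
    split_ifs <;> omega
  · replace hs1 := hs1 i1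
    replace hs2 := hs2 i2
    have lt3 : 1 ∈ s → n - 1 ∈ s → h < firstGap n s → 3 ≤ level n d s := by
      intro i1 i2 hc
      unfold level
      simp only [i1, i2, not_true, if_false]
      split_ifs <;> omega
    have lt4 : 1 ∈ s → n - 1 ∈ s → h < firstGap n s → 0 ∈ s → d + 2 ≤ n →
        forkOrd d (firstGap n s) < depth n d →
        4 + forkOrd d (firstGap n s) ≤ level n d s := by
      intro i1 i2 hc i0 hnd
      unfold level
      simp only [i1, i2, i0, not_true, if_false, or_false]
      split_ifs <;> omega
    have lt5 : 1 ∈ s → n - 1 ∈ s → h < firstGap n s → 0 ∈ s → d + 2 ≤ n →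
        depth n d ≤ forkOrd d (firstGap n s) → 
        4 + depth n d ≤ level n d s := by
      intro i1 i2 hc i0 hnd
      unfold level
      simp only [i1, i2, i0, not_true, if_false, or_false]
      split_ifs <;> omega
    have lt6 : 1 ∈ s → n - 1 ∈ s → h < firstGap n s → 0 ∈ s → d + 2 ≤ n →
        depth n d ≤ forkOrd d (firstGap n s) → lastGap n s + h < n →
        5 + depth n d ≤ level n d s := by
      intro i1 i2 hc i0 hnd
      unfold level
      simp only [i1, i2, i0, not_true, if_false, or_false]
      split_ifs <;> omega
    rcases H with ⟨_, e⟩ | ⟨h4, ⟨_, e⟩ | ⟨i0, ⟨h5, e⟩ | ⟨_, ⟨_, e⟩ | ⟨_, e⟩⟩⟩⟩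
    · rw [e, pivot_three, if_pos (by omega)] at hy
      rw [e]
      exact lt3 (hs1 (by omega)) (hs2 (by omega)) (by omega)
    · rw [e, pivot_three, if_neg (by omega)] at hy
      rw [e]
      exact lt3 (hs1 (by omega)) (hs2 (by omega)) (by omega)
    · have hs0 : y ≠ 0 → 0 ∈ s := fun b => (t0.1 i0).resolve_right b.symm
      rw [e] at hy ⊢
      obtain ⟨q1, -, q2, q3, q4⟩ := pivot_layer h1 h2 h4 (forkOrd_pos h1 h2 (by omega)) h5
      rw [← hy] at q1 q2 q3 q4
      have : firstGap n s = firstGap n t := by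
        by_contra hc
        have h6 := p2.resolve_left hc
        have := forkOrd_mono (d := d) p1
        rw [h6] at this
        omega
      rw [← this] at h5 ⊢
      refine lt4 (hs1 (by omega)) (hs2 (by omega)) (by omega) (hs0 (by omega)) h4 h5
    · have hs0 : y ≠ 0 → 0 ∈ s := fun b => (t0.1 i0).resolve_right b.symm
      rw [e, pivot_top] at hy
      rw [e]
      have : firstGap n s = firstGap n t := by omega
      refine lt5 (hs1 (by omega)) (hs2 (by omega)) (by omega) (hs0 (by omega)) h4 (by rwa [this])
    · have hs0 : y ≠ 0 → 0 ∈ s := fun b => (t0.1 i0).resolve_right b.symm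
      rw [e] at hy ⊢
      obtain ⟨q1, q2, q3, q4, q5⟩ := pivot_last h1 h2 h4
      rw [← hy] at q1 q2 q3 q4
      refine lt6 (hs1 (by omega)) (hs2 (by omega)) (by omega) (hs0 (by omega)) h4 ?_ (by omega)
      rcases p2 with h6 | h6
      · rwa [h6]
      · rwa [h6]

end

end AffineD

namespace AffineD

theorem exists_prev_gap (s : Finset ℕ) (j : ℕ) :
    (∀ i, i < j → i ∈ s) ∨ ∃ a, a < j ∧ a ∉ s ∧ ∀ i, a < i → i < j → i ∈ s := by
  induction j with
  | zero => exact Or.inl fun i hi => absurd hi (Nat.not_lt_zero i)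
  | succ j ih =>
    by_cases hj : j ∈ s
    · rcases ih with h | ⟨a, h1, h2, h3⟩
      · exact Or.inl (by grind)
      · exact Or.inr ⟨a, by grind⟩
    · exact Or.inr ⟨j, by grind⟩

theorem exists_next_gap (s : Finset ℕ) {j n : ℕ} (hj : j ≤ n) :
    (∀ i, j < i → i ≤ n → i ∈ s) ∨
      ∃ b, j < b ∧ b ≤ n ∧ b ∉ s ∧ ∀ i, j < i → i < b → i ∈ s := by
  induction n, hj using Nat.le_induction with
  | base => exact Or.inl (by grind)
  | succ n _ ih =>
    rcases ih with h | ⟨b, h⟩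
    · by_cases hn : n + 1 ∈ s
      · exact Or.inl (by grind)
      · exact Or.inr ⟨n + 1, by grind⟩
    · exact Or.inr ⟨b, by grind⟩

namespace IsWeight

variable {n d : ℕ} {V : Finset ℕ → ℕ} (w : IsWeight n d V) (hn : 4 ≤ n) (hd : 2 ≤ d)

include w hn hd

theorem fill_cases {s t : Finset ℕ} (h1 : 1 ∈ s) (h2 : n - 1 ∈ s) {j : ℕ} (hj : j ≤ n)
    (hjs : j ∉ s) (ht : ∀ i, i ≤ n → (i ∈ t ↔ i ∈ s ∨ i = j)) (hx : ∃ x, x ≤ n ∧ x ∉ t) :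
    (∃ a b, a < j ∧ j < b ∧ b ≤ n ∧ a ∉ s ∧ b ∉ s ∧
      V t + (j - a) / d + (b - j) / d = V s + (b - a) / d) ∨
    (∃ b, j < b ∧ b ≤ n ∧ b ∉ s ∧ (∀ i, i < b → i ≠ j → i ∈ s) ∧
      V t + forkOrd d j + (b - j) / d = V s + forkOrd d b) ∨
    (∃ a, a < j ∧ a ∉ s ∧ (∀ i, a < i → i ≤ n → i ≠ j → i ∈ s) ∧
      V t + forkOrd d (n - j) + (j - a) / d = V s + forkOrd d (n - a)) := by
  have k1 : ∀ a, a ∉ s → a ≠ 1 := fun a ha h => ha (h ▸ h1)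
  have k2 : ∀ a, a ∉ s → a + 1 ≠ n := fun a ha h => ha (by
    rwa [show a = n - 1 by omega])
  rcases exists_prev_gap s j with hp | ⟨a, ha, has, hp⟩ <;>
    rcases exists_next_gap s hj with hq | ⟨b, hb, hbn, hbs, hq⟩
  · obtain ⟨x, hx, hxt⟩ := hx
    rw [ht x hx] at hxt
    grind
  · exact Or.inr (Or.inl ⟨b, hb, hbn, hbs, by grind, w.join_left hn hd hb hbn (k1 _ hjs) (k1 _ hbs)
      (k2 _ hjs) (k2 _ hbs) hjs hbs (by grind) ht⟩)
  · exact Or.inr (Or.inr ⟨a, ha, has, by grind, w.join_right hn hd ha hj (k1 _ has) (k1 _ hjs)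
      (k2 _ has) (k2 _ hjs) has hjs (by grind) ht⟩)
  · exact Or.inl ⟨a, b, ha, hb, hbn, has, hbs, w.join hn hd ha hb hbn (k1 _ has) (k1 _ hjs)
      (k1 _ hbs) (k2 _ has) (k2 _ hjs) (k2 _ hbs) has hjs hbs (by grind) ht⟩

omit hd in
theorem swap_right {s t : Finset ℕ} (h1 : n ∈ s ↔ n - 1 ∈ t) (h2 : n - 1 ∈ s ↔ n ∈ t)
    (h : ∀ i, i + 2 ≤ n → (i ∈ s ↔ i ∈ t)) : V s = V t := by
  rw [← w.reflect_eq, ← w.reflect_eq t]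
  refine w.swap _ _ ?_ ?_ fun i hi hin => ?_
  · rw [mem_reflect, mem_reflect, Nat.sub_zero]
    simpa [show 1 ≤ n by omega] using h1
  · rw [mem_reflect, mem_reflect, Nat.sub_zero]
    simpa [show 1 ≤ n by omega] using h2
  · rw [mem_reflect, mem_reflect, h _ (by omega)]

/-- The dependence of the weight on the beginning of the first run, if `0` is missing. -/
theorem tail (s : Finset ℕ) {c : ℕ} (hc : 2 ≤ c) (hcn : c + 1 ≤ n) :
    (∃ b K, c ≤ b ∧ ∀ a u, 1 ≤ a → a ≤ c →
      (∀ i, i ≤ n → (i ∈ u ↔ a ≤ i ∧ (i < c ∨ i ∈ s))) → V u = (b - a + 1) / d + K) ∨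
    ∀ a u, 1 ≤ a → a ≤ c →
      (∀ i, i ≤ n → (i ∈ u ↔ a ≤ i ∧ (i < c ∨ i ∈ s))) → V u = forkOrd d (n + 1 - a) := by
  have key : ∀ b, c ≤ b → b ≤ n → b + 1 ≠ n → b ∉ s → (∀ i, c ≤ i → i < b → i ∈ s) →
      ∃ b K, c ≤ b ∧ ∀ a u, 1 ≤ a → a ≤ c →
        (∀ i, i ≤ n → (i ∈ u ↔ a ≤ i ∧ (i < c ∨ i ∈ s))) → V u = (b - a + 1) / d + K := by
    intro b hcb hbn hbn' hbs hb
    refine ⟨b, V (s.filter (b < ·)), hcb, fun a u ha hac hu => ?_⟩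
    rw [w.cut' hn hd hbn (by omega) hbn' (by grind : b ∉ u),
      w.congr (u.filter (b < ·)) (s.filter (b < ·)) (by grind),
      w.congr (u.filter (· < b)) (Finset.Ico a b) (fun i hi => by
        rw [Finset.mem_filter, Finset.mem_Ico, hu i hi]
        grind), w.chain a b ha (by omega) hbn]
  rcases exists_next_gap s (j := c - 1) (n := n) (by omega) with h | ⟨b, hcb, hbn, hbs, hb⟩
  · refine Or.inr fun a u ha hac hu => ?_
    rw [w.flip u (Finset.Ico 0 (n + 1 - a)) (fun i hi => by
      rw [Finset.mem_Ico, hu i hi]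
      grind), w.fork _ (by omega) (by omega)]
  · left
    by_cases hb' : b + 1 = n
    · by_cases hns : n ∈ s
      · refine ⟨n, 0, by omega, fun a u ha hac hu => ?_⟩
        rw [w.swap_right hn (s := u) (t := Finset.Ico a n) ?_ ?_ ?_,
          w.chain a n ha (by omega) le_rfl, add_zero]
        · rw [hu _ le_rfl, Finset.mem_Ico]
          grind
        · rw [hu _ (by omega), Finset.mem_Ico]
          grind
        · intro i hi
          rw [hu _ (by omega), Finset.mem_Ico]
          grind
      · refine ⟨b, 0, by omega, fun a u ha hac hu => ?_⟩
        rw [w.congr u (Finset.Ico a b) (fun i hi => by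
          rw [hu i hi, Finset.mem_Ico]
          refine and_congr_right fun _ => ⟨fun h => ?_, fun h => ?_⟩
          · by_contra hc'
            have h1 : i = b ∨ i = n := by omega
            have h2 := h.resolve_left (by omega)
            rcases h1 with rfl | rfl
            · exact hbs h2
            · exact hns h2
          · by_cases h1 : i < c
            · exact Or.inl h1
            · exact Or.inr (hb i (by omega) h)), w.chain a b ha (by omega) hbn, add_zero]
    · exact key b (by omega) hbn hb' hbs (by grind)

variable {s t u : Finset ℕ}

/-- Filling the pivot of level `0`. -/
theorem fill_zero (h1 : 1 ∉ s) (hp : pivot n d 0 ∉ s)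
    (ht : ∀ i, i ≤ n → (i ∈ t ↔ i ∈ s ∨ i = pivot n d 0)) : V t ≤ V s + 1 := by
  rw [pivot_zero] at hp ht
  by_cases c : d = 2 ∧ n % 2 = 0
  · simp only [if_pos c] at hp ht
    obtain ⟨s', hs'⟩ : ∃ s' : Finset ℕ, ∀ i, i ∈ s' ↔ (i = 1 ∧ 0 ∈ s ∨ 2 ≤ i ∧ i ∈ s) :=
      ⟨(if 0 ∈ s then {1} else ∅) ∪ s.filter (2 ≤ ·), fun i => by split_ifs <;> grind⟩
    obtain ⟨t', ht'⟩ : ∃ t' : Finset ℕ, ∀ i, i ∈ t' ↔ i ∈ s' ∨ i = 2 :=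
      ⟨insert 2 s', fun i => by grind⟩
    rw [w.swap s s' (by grind) (by grind) (by grind), w.swap t t' (by grind) (by grind) (by grind),
      w.cut s' 2 le_rfl (by omega) (by grind)]
    have e1 : V (s'.filter (· < 2)) = if 0 ∈ s then 1 else 0 := by
      split_ifs with h0
      · rw [w.congr _ (Finset.Ico 1 2) (by grind), w.chain 1 2 le_rfl (by omega) (by omega), c.1]
      · exact w.eq_zero hn hd (by grind)
    rw [e1]
    rcases w.tail hn hd s (c := 3) (by omega) (by omega) with ⟨b, K, hb, H⟩ | H
    · rw [H 3 (s'.filter (2 < ·)) (by omega) le_rfl (by grind)]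
      split_ifs with h0
      · rw [H 1 t' (by omega) (by omega) (by grind)]
        rw [c.1]
        omega
      · rw [H 2 t' (by omega) (by omega) (by grind)]
        rw [c.1]
        omega
    · rw [H 3 (s'.filter (2 < ·)) (by omega) le_rfl (by grind)]
      have hd2 : d = 2 * 1 := by omega
      split_ifs with h0
      · rw [H 1 t' (by omega) (by omega) (by grind)]
        have := forkOrd_add_self hd2 le_rfl (n - 2)
        rw [c.1, show n - 2 + 2 = n by omega] at this
        rw [c.1, show n + 1 - 1 = n by omega, show n + 1 - 3 = n - 2 by omega]
        omega
      · rw [H 2 t' (by omega) (by omega) (by grind)]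
        rw [forkOrd_even hd2, forkOrd_even hd2, c.1]
        omega
  · simp only [if_neg c] at hp ht
    obtain ⟨t', ht'⟩ : ∃ t' : Finset ℕ, ∀ i, i ∈ t' ↔ i ∈ s ∨ i = 1 :=
      ⟨insert 1 s, fun i => by grind⟩
    rw [w.swap t t' (by grind) (by grind) (by grind)]
    rcases w.tail hn hd s (c := 2) (by omega) (by omega) with ⟨b, K, hb, H⟩ | H
    · rw [H 2 s (by omega) le_rfl (by grind), H 1 t' (by omega) (by omega) (by grind)]
      have := add_div_le d (b - 2 + 1) 1
      rw [Nat.div_eq_of_lt (by omega : 1 < d), show b - 2 + 1 + 1 = b - 1 + 1 by omega] at this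
      omega
    · rw [H 2 s (by omega) le_rfl (by grind), H 1 t' (by omega) (by omega) (by grind)]
      rw [show n + 1 - 1 = n + 1 - 2 + 1 by omega]
      exact forkOrd_succ_le hd (by omega)

theorem fill_zero_le (h1 : 1 ∉ s) (hp : pivot n d 0 ∉ s)
    (ht : ∀ i, i ≤ n → (i ∈ t ↔ i ∈ s ∨ i = pivot n d 0))
    (hu : ∀ i, i ≤ n → (i ∈ u ↔ i ∈ s ∨ i = 1)) : V t ≤ V u := by
  have hf := w.fill_zero hn hd h1 hp ht
  rw [pivot_zero] at hp ht
  by_cases c : d = 2 ∧ n % 2 = 0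
  · simp only [if_pos c] at hp ht
    refine hf.trans (le_of_eq ?_)
    rw [w.cut s 2 le_rfl (by omega) hp, w.cut u 2 le_rfl (by omega) (by grind),
      w.congr (u.filter (2 < ·)) (s.filter (2 < ·)) (by grind), add_right_comm]
    congr 1
    have e : V (Finset.Ico 1 2) = 1 := by
      rw [w.chain 1 2 le_rfl (by omega) (by omega), c.1]
    by_cases h0 : 0 ∈ s
    · rw [w.swap _ (Finset.Ico 1 2) (by grind) (by grind) (by grind), e,
        w.congr (u.filter (· < 2)) (Finset.Ico 0 2) (by grind), w.fork 2 le_rfl (by omega),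
        forkOrd_even (h := 1) (by omega), c.1]
    · rw [w.eq_zero hn hd (s := s.filter (· < 2)) (by grind),
        w.congr (u.filter (· < 2)) (Finset.Ico 1 2) (by grind), e]
  · simp only [if_neg c] at hp ht
    exact (w.swap _ _ (by grind) (by grind) (by grind)).le

omit w hn hd V in
theorem _root_.AffineD.pivot_one_eq : pivot n d 1 = n - pivot n d 0 := by
  rw [pivot_zero, pivot_one]
  split_ifs <;> rfl

/-- Filling the pivot of level `1`. -/
theorem fill_one (h1 : n - 1 ∉ s) (hp : pivot n d 1 ∉ s)
    (ht : ∀ i, i ≤ n → (i ∈ t ↔ i ∈ s ∨ i = pivot n d 1)) : V t ≤ V s + 1 := by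
  rw [pivot_one_eq] at hp ht
  have h0 : pivot n d 0 ≤ n := by
    rw [pivot_zero]
    split_ifs <;> omega
  rw [← w.reflect_eq, ← w.reflect_eq s]
  refine w.fill_zero hn hd (by rw [mem_reflect]; tauto) (by rw [mem_reflect]; tauto) fun i hi => ?_
  rw [mem_reflect, mem_reflect, ht _ (by omega)]
  have : n - i = n - pivot n d 0 ↔ i = pivot n d 0 := by omega
  tauto

theorem fill_one_le (h1 : n - 1 ∉ s) (hp : pivot n d 1 ∉ s)
    (ht : ∀ i, i ≤ n → (i ∈ t ↔ i ∈ s ∨ i = pivot n d 1))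
    (hu : ∀ i, i ≤ n → (i ∈ u ↔ i ∈ s ∨ i = n - 1)) : V t ≤ V u := by
  rw [pivot_one_eq] at hp ht
  have h0 : pivot n d 0 ≤ n := by
    rw [pivot_zero]
    split_ifs <;> omega
  rw [← w.reflect_eq, ← w.reflect_eq u]
  refine w.fill_zero_le hn hd (s := reflect n s) (by rw [mem_reflect]; tauto)
    (by rw [mem_reflect]; tauto) (fun i hi => ?_) fun i hi => ?_
  · rw [mem_reflect, mem_reflect, ht _ (by omega)]
    have : n - i = n - pivot n d 0 ↔ i = pivot n d 0 := by omega
    tauto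
  · rw [mem_reflect, mem_reflect, hu _ (by omega)]
    have : n - i = n - 1 ↔ i = 1 := by omega
    tauto

end IsWeight

end AffineD

namespace AffineD

theorem firstGap_le {n : ℕ} (hn : 4 ≤ n) {s : Finset ℕ} {b : ℕ} (hb : 2 ≤ b) (hbs : b ∉ s) :
    firstGap n s ≤ b := by
  by_contra! hc
  exact hbs ((firstGap_spec hn s).2.2.2 b hb hc)

theorem le_lastGap {n : ℕ} (hn : 4 ≤ n) {s : Finset ℕ} {b : ℕ} (hb : 2 ≤ b) (hbn : b + 2 ≤ n)
    (hbs : b ∉ s) : b ≤ lastGap n s := by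
  by_contra! hc
  exact hbs ((lastGap_spec hn s).2.2 b hb hc hbn)

namespace IsWeight

variable {n d : ℕ} {V : Finset ℕ → ℕ} (w : IsWeight n d V) (hn : 4 ≤ n) (hd : 2 ≤ d)
  {s t : Finset ℕ}

include w hn hd

/-- Filling the pivot of level `2`. -/
theorem fill_two (h1 : 1 ∈ s) (h2 : n - 1 ∈ s) (hs : d % 2 = 1 ∨ firstGap n s ≤ d / 2)
    (h0 : 0 ∉ s) (ht : ∀ i, i ≤ n → (i ∈ t ↔ i ∈ s ∨ i = 0)) (hx : ∃ x, x ≤ n ∧ x ∉ t) :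
    V t ≤ V s := by
  rcases w.fill_cases hn hd h1 h2 (Nat.zero_le n) h0 ht hx with ⟨a, b, ha, _⟩ |
    ⟨b, hb, hbn, hbs, hbi, e⟩ | ⟨a, ha, _⟩
  · omega
  · rw [forkOrd_zero hd, add_zero, Nat.sub_zero] at e
    rcases hs with hs | hs
    · rw [forkOrd_odd hs] at e
      omega
    · by_cases hd' : d % 2 = 1
      · rw [forkOrd_odd hd'] at e
        omega
      · obtain ⟨p1, p2, p3, -⟩ := firstGap_spec hn s
        have hbp : b ≤ firstGap n s := by
          rcases p3 with p3 | p3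
          · by_contra! hc
            exact p3 (hbi _ hc (by omega))
          · omega
        rw [forkOrd_eq_zero (h := d / 2) (by omega) (by omega) (by omega)] at e
        exact le_of_add_le_left e.le
  · omega

section

variable {h : ℕ} (hdh : d = 2 * h) (hh : 1 ≤ h) (h1 : 1 ∈ s) (h2 : n - 1 ∈ s)
  (hp : h < firstGap n s)

include hdh hh h1 h2 hp

/-- Filling the pivot of level `3` if `n ≤ d + 1`. -/
theorem fill_three_of_le (hnd : n ≤ d + 1) (hns : n ∉ s)
    (ht : ∀ i, i ≤ n → (i ∈ t ↔ i ∈ s ∨ i = n)) (hx : ∃ x, x ≤ n ∧ x ∉ t) :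
    V t ≤ V s + 1 := by
  rcases w.fill_cases hn hd h1 h2 le_rfl hns ht hx with ⟨a, b, _, _, _, _⟩ |
    ⟨b, hb, hbn, _⟩ | ⟨a, ha, has, hai, e⟩
  · omega
  · omega
  · have a1 : a ≠ 1 := fun hc => has (hc ▸ h1)
    by_cases a0 : a = 0
    · rw [a0, Nat.sub_zero, Nat.sub_self, forkOrd_zero hd, forkOrd_even hdh] at e
      have : (n + h - 1) / d < 2 := Nat.div_lt_of_lt_mul (by omega)
      omega
    · have := firstGap_le hn (by omega) has
      rw [forkOrd_eq_zero (p := n - a) hdh hh (by omega)] at e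
      have := Nat.zero_le ((n - a) / d)
      omega

/-- Filling the pivot of level `3` if `d + 2 ≤ n`. -/
theorem fill_three (hnd : d + 2 ≤ n) (h0 : 0 ∉ s) (hds : d ∉ s)
    (ht : ∀ i, i ≤ n → (i ∈ t ↔ i ∈ s ∨ i = d)) (hx : ∃ x, x ≤ n ∧ x ∉ t) :
    V t ≤ V s + 1 := by
  rcases w.fill_cases hn hd h1 h2 (by omega) hds ht hx with ⟨a, b, ha, hb, _, _, _, e⟩ |
    ⟨b, hb, hbn, _, hbi, _⟩ | ⟨a, ha, has, hai, e⟩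
  · have := add_div_le d (d - a) (b - d)
    rw [show d - a + (b - d) = b - a by omega] at this
    omega
  · exact absurd (hbi 0 (by omega) (by omega)) h0
  · have a1 : a ≠ 1 := fun hc => has (hc ▸ h1)
    by_cases a0 : a = 0
    · have := forkOrd_add_self hdh hh (n - d)
      rw [show n - d + d = n by omega] at this
      rw [a0, Nat.sub_zero, Nat.sub_zero, Nat.div_self (by omega), this] at e
      omega
    · have := firstGap_le hn (by omega) has
      have := forkOrd_add_le hdh hh (p := n - d) (q := d - a) (by omega)
      rw [show n - d + (d - a) = n - a by omega] at this
      have := Nat.zero_le ((d - a) / d)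
      omega

section

variable (hnd : d + 2 ≤ n) (h0 : 0 ∈ s)

include hnd h0

omit h0 in
/-- Filling the pivot of a layer. -/
theorem fill_layer (hG : forkOrd d (firstGap n s) < depth n d)
    (hjs : pivot n d (4 + forkOrd d (firstGap n s)) ∉ s)
    (ht : ∀ i, i ≤ n → (i ∈ t ↔ i ∈ s ∨ i = pivot n d (4 + forkOrd d (firstGap n s))))
    (hx : ∃ x, x ≤ n ∧ x ∉ t) : V t ≤ V s + 1 := by
  obtain ⟨q1, q2, q3, q4, q5⟩ := pivot_layer hdh hh hnd (forkOrd_pos hdh hh (by omega)) hG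
  set j := pivot n d (4 + forkOrd d (firstGap n s))
  obtain ⟨p1, p2, p3, -⟩ := firstGap_spec hn s
  have hpj : firstGap n s < j := by
    by_contra! hc
    have := forkOrd_mono (d := d) hc
    omega
  have p4 := p3.resolve_right (by omega)
  rcases w.fill_cases hn hd h1 h2 (by omega) hjs ht hx with ⟨a, b, ha, hb, _, _, _, e⟩ |
    ⟨b, hb, hbn, _, hbi, _⟩ | ⟨a, ha, has, hai, e⟩
  · have := add_div_le d (j - a) (b - j)
    rw [show j - a + (b - j) = b - a by omega] at this
    omega
  · exact absurd (hbi _ (by omega) (by omega)) p4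
  · have hap : firstGap n s ≤ a := by
      by_contra! hc
      exact p4 (hai _ hc (by omega) (by omega))
    have hja : j - a ≤ d + h := by
      by_contra! hc
      have r1 := forkOrd_mono (d := d) hap
      have r2 := lt_forkOrd_add hdh hh a
      have r3 := forkOrd_mono (d := d) (by omega : a + h + 1 ≤ j - d)
      have r4 := q4 (by omega)
      omega
    have := forkOrd_add_le_of_dvd hdh hh q2 hja
    rw [show n - j + (j - a) = n - a by omega] at this
    omega

omit hp h0 in
/-- Filling the pivot of the second to last level. -/
theorem fill_top (he : n ≤ lastGap n s + h) (hns : n ∉ s)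
    (ht : ∀ i, i ≤ n → (i ∈ t ↔ i ∈ s ∨ i = n)) (hx : ∃ x, x ≤ n ∧ x ∉ t) : V t ≤ V s := by
  rcases w.fill_cases hn hd h1 h2 le_rfl hns ht hx with ⟨a, b, _, _, _, _⟩ |
    ⟨b, hb, hbn, _⟩ | ⟨a, ha, has, hai, e⟩
  · omega
  · omega
  · obtain ⟨e1, e2, -⟩ := lastGap_spec hn s
    have e3 := (e2.resolve_left (by omega)).2
    have hea : lastGap n s ≤ a := by
      by_contra! hc
      exact e3 (hai _ hc (by omega) (by omega))
    rw [forkOrd_eq_zero (p := n - a) hdh hh (by omega)] at e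
    have := Nat.zero_le ((n - a) / d)
    omega

/-- Filling the pivot of the last level. -/
theorem fill_last (hG : depth n d ≤ forkOrd d (firstGap n s)) (he : lastGap n s + h < n)
    (hjs : pivot n d (5 + depth n d) ∉ s)
    (ht : ∀ i, i ≤ n → (i ∈ t ↔ i ∈ s ∨ i = pivot n d (5 + depth n d)))
    (hx : ∃ x, x ≤ n ∧ x ∉ t) : V t ≤ V s + 1 := by
  obtain ⟨q1, q2, q3, q4, q5⟩ := pivot_last hdh hh hnd
  set j := pivot n d (5 + depth n d)
  have g1 := forkOrd_add_self hdh hh (n - d)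
  rw [show n - d + d = n by omega] at g1
  have g2 : forkOrd d (n - d) ≤ depth n d := le_max_right _ _
  have j1 : j ≠ 1 := fun hc => hjs (hc ▸ h1)
  have hpj := firstGap_le hn (by omega) hjs
  have hjp := q5 _ hG
  have hprev : ∀ a, a < j → a ∈ s := by
    intro a ha
    by_contra has
    have a0 : a ≠ 0 := fun hc => has (hc ▸ h0)
    have a1 : a ≠ 1 := fun hc => has (hc ▸ h1)
    have := firstGap_le hn (by omega) has
    omega
  rcases w.fill_cases hn hd h1 h2 (by omega) hjs ht hx with ⟨a, b, ha, hb, _, has, _, e⟩ |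
    ⟨b, hb, hbn, hbs, hbi, e⟩ | ⟨a, ha, has, hai, e⟩
  · exact absurd (hprev a ha) has
  · by_cases hb' : b = n
    · rw [hb'] at e
      by_cases hG' : depth n d ≤ forkOrd d (n - d)
      · have := q5 _ hG'
        have r := Nat.div_le_div_right (c := d) (by omega : d ≤ n - j)
        rw [Nat.div_self (by omega)] at r
        omega
      · have : depth n d = max 1 (forkOrd d (n - d)) := rfl
        have := Nat.zero_le ((n - j) / d)
        omega
    · have b1 : b + 1 ≠ n := fun hc => hbs (by rwa [show b = n - 1 by omega])
      have := le_lastGap hn (by omega) (by omega) hbs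
      have r1 := forkOrd_mono (d := d) (by omega : b ≤ n - d + (h - 1))
      have r2 := forkOrd_add_le hdh hh (p := n - d) (q := h - 1) (by omega)
      have := Nat.zero_le ((b - j) / d)
      omega
  · exact absurd (hprev a ha) has

end

end

/-- Filling the pivot increases the weight by at most one. -/
theorem fill_pivot (hps : pivot n d (level n d s) ∉ s)
    (ht : ∀ i, i ≤ n → (i ∈ t ↔ i ∈ s ∨ i = pivot n d (level n d s)))
    (hx : ∃ x, x ≤ n ∧ x ∉ t) : V t ≤ V s + 1 := by
  rcases level_cases n hd s with ⟨h1, e⟩ | ⟨_, h2, e⟩ | ⟨h1, h2, ⟨hp, e⟩ | ⟨h, hdh, hh, hp, H⟩⟩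
  · rw [e] at hps ht
    exact w.fill_zero hn hd h1 hps ht
  · rw [e] at hps ht
    exact w.fill_one hn hd h2 hps ht
  · rw [e, pivot_two] at hps ht
    exact (w.fill_two hn hd h1 h2 hp hps ht hx).trans (Nat.le_succ _)
  · rcases H with ⟨hnd, e⟩ | ⟨hnd, ⟨h0, e⟩ | ⟨h0, ⟨hG, e⟩ | ⟨hG, ⟨he, e⟩ | ⟨he, e⟩⟩⟩⟩
    · rw [e, pivot_three, if_pos hnd] at hps ht
      exact w.fill_three_of_le hn hd hdh hh h1 h2 hp hnd hps ht hx
    · rw [e, pivot_three, if_neg (by omega)] at hps ht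
      exact w.fill_three hn hd hdh hh h1 h2 hp hnd h0 hps ht hx
    · rw [e] at hps ht
      exact w.fill_layer hn hd hdh hh h1 h2 hp hnd hG hps ht hx
    · rw [e, pivot_top] at hps ht
      exact (w.fill_top hn hd hdh hh h1 h2 hnd he hps ht hx).trans (Nat.le_succ _)
    · rw [e] at hps ht
      exact w.fill_last hn hd hdh hh h1 h2 hp hnd h0 hG he hps ht hx

/-- Filling the pivot does not exceed the weight obtained by raising the level. -/
theorem fill_pivot_le {u : Finset ℕ} {x : ℕ} (hxs : x ∉ s) (hxn : x ≤ n)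
    (hu : ∀ i, i ≤ n → (i ∈ u ↔ i ∈ s ∨ i = x)) (hlt : level n d s < level n d u)
    (hux : ∃ x, x ≤ n ∧ x ∉ u) (hps : pivot n d (level n d s) ∉ s)
    (ht : ∀ i, i ≤ n → (i ∈ t ↔ i ∈ s ∨ i = pivot n d (level n d s)))
    (htx : ∃ x, x ≤ n ∧ x ∉ t) : V t ≤ V u := by
  have hV := w.fill_pivot hn hd hps ht htx
  have hmono : V s ≤ V u := w.mono _ _ (fun i hi his => (hu i hi).2 (Or.inl his)) hux
  rcases level_cases n hd s with ⟨h1, e⟩ | ⟨h1, h2, e⟩ | ⟨h1, h2, ⟨hp, e⟩ | ⟨h, hdh, hh, hp, H⟩⟩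
  · rw [e] at hps ht hlt
    have : 1 ∈ u := by
      by_contra hc
      unfold level at hlt
      rw [if_pos hc] at hlt
      omega
    have hx1 : x = 1 := (((hu 1 (by omega)).1 this).resolve_left h1).symm
    exact w.fill_zero_le hn hd h1 hps ht (hx1 ▸ hu)
  · rw [e] at hps ht hlt
    have : n - 1 ∈ u := by
      by_contra hc
      unfold level at hlt
      rw [if_neg (not_not.2 ((hu 1 (by omega)).2 (Or.inl h1))), if_pos hc] at hlt
      omega
    have hx1 : x = n - 1 := (((hu _ (by omega)).1 this).resolve_left h2).symm
    exact w.fill_one_le hn hd h2 hps ht (hx1 ▸ hu)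
  · rw [e, pivot_two] at hps ht
    exact (w.fill_two hn hd h1 h2 hp hps ht htx).trans hmono
  · have h1u := (hu 1 (by omega)).2 (Or.inl h1)
    have h2u := (hu (n - 1) (by omega)).2 (Or.inl h2)
    have hpu := firstGap_mono hn fun i hi his => (hu i hi).2 (Or.inl his)
    rcases H with ⟨hnd, e⟩ | ⟨hnd, ⟨h0, e⟩ | ⟨h0, ⟨hG, e⟩ | ⟨hG, ⟨he, e⟩ | ⟨he, e⟩⟩⟩⟩
    · exfalso
      rw [e] at hlt
      unfold level at hlt
      rw [if_neg (not_not.2 h1u), if_neg (not_not.2 h2u), if_neg (by omega),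
        if_pos (Or.inl hnd)] at hlt
      omega
    · rw [e] at hlt
      have h0u : 0 ∈ u := by
        by_contra hc
        unfold level at hlt
        rw [if_neg (not_not.2 h1u), if_neg (not_not.2 h2u), if_neg (by omega),
          if_pos (Or.inr hc)] at hlt
        omega
      have hx0 : x = 0 := (((hu 0 (by omega)).1 h0u).resolve_left h0).symm
      subst hx0
      rcases w.fill_cases hn hd h1 h2 hxn hxs hu hux with ⟨a, b, ha, _⟩ |
        ⟨b, hb, hbn, hbs, hbi, e'⟩ | ⟨a, ha, _⟩
      · omega
      · rw [forkOrd_zero hd, add_zero, Nat.sub_zero] at e'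
        have b1 : b ≠ 1 := fun hc => hbs (hc ▸ h1)
        have := firstGap_le hn (by omega) hbs
        have := div_lt_forkOrd hdh hh (p := b) (by omega)
        omega
      · omega
    · rw [e] at hlt
      have hg : forkOrd d (firstGap n s) < forkOrd d (firstGap n u) := by
        by_contra! hc
        unfold level at hlt
        rw [if_neg (not_not.2 h1u), if_neg (not_not.2 h2u), if_neg (by omega),
          if_neg (not_or.2 ⟨by omega, not_not.2 ((hu 0 (by omega)).2 (Or.inl h0))⟩), if_pos (by omega)] at hlt
        omega
      have hx : firstGap n s = x := (firstGap_fill hn hu).resolve_left fun hc => by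
        rw [hc] at hg
        exact lt_irrefl _ hg
      rw [hx] at hg
      have hprev : ∀ a, a < x → a ∈ s := by
        intro a ha
        by_contra has
        have a0 : a ≠ 0 := fun hc => has (hc ▸ h0)
        have a1 : a ≠ 1 := fun hc => has (hc ▸ h1)
        have := firstGap_le hn (by omega) has
        omega
      rcases w.fill_cases hn hd h1 h2 hxn hxs hu hux with ⟨a, b, ha, _, _, has, _⟩ |
        ⟨b, hb, hbn, hbs, hbi, e'⟩ | ⟨a, ha, has, _⟩
      · exact absurd (hprev a ha) has
      · have hbu : b ∉ u := fun hc => by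
          have := ((hu b hbn).1 hc).resolve_left hbs
          omega
        have b0 : b ≠ 0 := by omega
        have b1 : b ≠ 1 := fun hc => hbs (hc ▸ h1)
        have r1 := forkOrd_mono (d := d) (firstGap_le hn (by omega) hbu)
        have r2 := add_div_lt_forkOrd hdh hh (p := x) (q := b - x)
          (by rw [show x + (b - x) = b by omega]; omega)
        rw [show x + (b - x) = b by omega] at r2
        omega
      · exact absurd (hprev a ha) has
    · rw [e, pivot_top] at hps ht
      exact (w.fill_top hn hd hdh hh h1 h2 hnd he hps ht htx).trans hmono
    · exfalso
      rw [e] at hlt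
      unfold level at hlt
      have hgu := forkOrd_mono (d := d) hpu
      split_ifs at hlt <;> omega

end IsWeight

end AffineD

namespace SignedComplex

variable {B A : Type*} [LinearOrder B] [CommRing A]

/-- The incidence sign of the vertex `s` relative to the set `σ`. -/
def sign (A : Type*) [CommRing A] (s : B) (σ : Finset B) : A :=
  (-1) ^ (σ.filter (· < s)).card

/-- The boundary of a function on finite subsets, with the usual simplicial signs. -/
def boundary [Fintype B] (z : Finset B → A) (τ : Finset B) : A :=
  ∑ s, if s ∈ τ then 0 else sign A s τ * z (insert s τ)

/-- The cone with apex `s` over a function on finite subsets. -/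
def cone (s : B) (z : Finset B → A) (σ : Finset B) : A :=
  if s ∈ σ then sign A s σ * z (σ.erase s) else 0

lemma sign_mul_self (s : B) (σ : Finset B) : sign A s σ * sign A s σ = 1 := by
  rw [sign, ← mul_pow]; simp

lemma sign_insert_of_lt {s t : B} {σ : Finset B} (h : t < s) (ht : t ∉ σ) :
    sign A s (insert t σ) = -sign A s σ := by
  rw [sign, sign, Finset.filter_insert, if_pos h, Finset.card_insert_of_notMem (by simp [ht])]
  ring

lemma sign_insert_of_le {s t : B} {σ : Finset B} (h : s ≤ t) :
    sign A s (insert t σ) = sign A s σ := by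
  rw [sign, sign, Finset.filter_insert, if_neg h.not_gt]

lemma sign_insert_comm {s t : B} {σ : Finset B} (hst : s ≠ t) (hs : s ∉ σ) (ht : t ∉ σ) :
    sign A s σ * sign A t (insert s σ) = -(sign A t σ * sign A s (insert t σ)) := by
  rcases lt_or_gt_of_ne hst with h | h
  · rw [sign_insert_of_lt h hs, sign_insert_of_le h.le]; ring
  · rw [sign_insert_of_lt h ht, sign_insert_of_le h.le]; ring

lemma boundary_sub [Fintype B] (y z : Finset B → A) (τ : Finset B) :
    boundary (y - z) τ = boundary y τ - boundary z τ := by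
  simp only [boundary, ← Finset.sum_sub_distrib]
  refine Finset.sum_congr rfl fun s _ => ?_
  split_ifs <;> simp [mul_sub]

lemma boundary_add [Fintype B] (y z : Finset B → A) (τ : Finset B) :
    boundary (y + z) τ = boundary y τ + boundary z τ := by
  simp only [boundary, ← Finset.sum_add_distrib]
  refine Finset.sum_congr rfl fun s _ => ?_
  split_ifs <;> simp [mul_add]

lemma boundary_boundary [Fintype B] (z : Finset B → A) (τ : Finset B) :
    boundary (boundary z) τ = 0 := by
  have key : ∀ s t, (if s ∈ τ then (0 : A) else sign A s τ *
      if t ∈ insert s τ then 0 else sign A t (insert s τ) * z (insert t (insert s τ))) =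
      if s ∈ τ ∨ t ∈ τ ∨ t = s then 0 else
        sign A s τ * sign A t (insert s τ) * z (insert t (insert s τ)) := by
    intro s t
    by_cases hs : s ∈ τ <;> by_cases ht : t ∈ τ <;> by_cases hst : t = s <;>
      simp_all [mul_assoc]
  have expand : boundary (boundary z) τ = ∑ s, ∑ t, if s ∈ τ ∨ t ∈ τ ∨ t = s then 0 else
        sign A s τ * sign A t (insert s τ) * z (insert t (insert s τ)) := by
    rw [boundary]
    refine Finset.sum_congr rfl fun s _ => ?_
    rw [← Finset.sum_congr rfl fun t _ => key s t]
    split_ifs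
    · simp
    · rw [boundary, Finset.mul_sum]
  rw [expand, ← Fintype.sum_prod_type']
  refine Finset.sum_involution (fun p _ => p.swap) ?_ ?_ (by simp) (by simp)
  · rintro ⟨s, t⟩ -
    by_cases h : s ∈ τ ∨ t ∈ τ ∨ t = s
    · have h' : t ∈ τ ∨ s ∈ τ ∨ s = t := by tauto
      simp only [Prod.swap_prod_mk, if_pos h, if_pos h', add_zero]
    · have h' : ¬(t ∈ τ ∨ s ∈ τ ∨ s = t) := by tauto
      simp only [Prod.swap_prod_mk, if_neg h, if_neg h']
      push Not at h
      rw [sign_insert_comm (Ne.symm h.2.2) h.1 h.2.1, Finset.insert_comm]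
      ring
  · rintro ⟨s, t⟩ - hne heq
    obtain ⟨rfl, -⟩ : t = s ∧ s = t := by simpa using heq
    simp at hne

lemma boundary_cone [Fintype B] (s : B) (z : Finset B → A) (τ : Finset B) :
    boundary (cone s z) τ + cone s (boundary z) τ = z τ := by
  by_cases hs : s ∈ τ
  · have h : ∀ t, (if t ∈ τ then (0 : A) else sign A t τ * cone s z (insert t τ)) =
        if t ∈ τ then 0 else
          -(sign A s τ * (sign A t (τ.erase s) * z (insert t (τ.erase s)))) := by
      intro t
      split_ifs with ht
      · rfl
      · have hts : t ≠ s := fun h => ht (h ▸ hs)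
        rw [cone, if_pos (by simp [hs]), Finset.erase_insert_of_ne hts, ← mul_assoc, ← mul_assoc]
        have ht' : t ∉ τ.erase s := by simp [ht]
        have hc := sign_insert_comm (A := A) hts ht' (Finset.notMem_erase s τ)
        rw [Finset.insert_erase hs] at hc
        obtain ⟨ρ, hρ, rfl⟩ : ∃ ρ, s ∉ ρ ∧ insert s ρ = τ :=
          ⟨τ.erase s, Finset.notMem_erase s τ, Finset.insert_erase hs⟩
        rw [Finset.erase_insert hρ] at *
        rw [sign_insert_of_le le_rfl]
        rcases lt_or_gt_of_ne hts with h | h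
        · rw [sign_insert_of_le h.le, Finset.insert_comm, sign_insert_of_le le_rfl,
            sign_insert_of_lt h ht']; ring
        · rw [sign_insert_of_lt h hρ, Finset.insert_comm, sign_insert_of_le le_rfl,
            sign_insert_of_le h.le]; ring
    rw [boundary, Finset.sum_congr rfl fun t _ => h t, cone, if_pos hs, boundary, Finset.mul_sum,
      ← Finset.sum_add_distrib, Finset.sum_eq_single s]
    · have : sign A s (τ.erase s) = sign A s τ := by
        conv_rhs => rw [← Finset.insert_erase hs, sign_insert_of_le le_rfl]
      simp only [hs, if_true, Finset.notMem_erase, if_false, Finset.insert_erase hs, this, zero_add]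
      rw [← mul_assoc, sign_mul_self, one_mul]
    · intro t _ hts
      by_cases ht : t ∈ τ <;> simp [ht, hts]
    · simp
  · rw [cone, if_neg hs, add_zero, boundary, Finset.sum_eq_single s]
    · rw [if_neg hs, cone, if_pos (Finset.mem_insert_self _ _), Finset.erase_insert hs,
        sign_insert_of_le le_rfl, ← mul_assoc, sign_mul_self, one_mul]
    · intro t _ hts
      simp [cone, hs, Ne.symm hts]
    · simp

/-- Data for a discrete homotopy on the faces of a simplex: a monotone `level` on faces together
with a vertex `pivot m` for each level whose toggling preserves level `m`, compatible with a
weight on proper faces. -/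
structure PivotData [Fintype B] (level weight : Finset B → ℕ) (pivot : ℕ → B) : Prop where
  level_mono : ∀ {σ τ}, σ ⊆ τ → level σ ≤ level τ
  level_insert : ∀ τ, level (insert (pivot (level τ)) τ) = level τ
  level_erase : ∀ σ, level (σ.erase (pivot (level σ))) = level σ
  weight_insert : ∀ τ, pivot (level τ) ∉ τ → insert (pivot (level τ)) τ ≠ Finset.univ →
    weight (insert (pivot (level τ)) τ) ≤ weight τ + 1
  weight_insert_le : ∀ τ x, x ∉ τ → insert x τ ≠ Finset.univ → level τ < level (insert x τ) →
    pivot (level τ) ∉ τ → weight (insert (pivot (level τ)) τ) ≤ weight (insert x τ)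

lemma PivotData.exists_filling_of_level_lt [Fintype B] {level weight : Finset B → ℕ}
    {pivot : ℕ → B} (hp : PivotData level weight pivot) (φ : A) {k : ℕ}
    (hk : k + 1 < Fintype.card B) (m : ℕ) (z : Finset B → A) (hz : ∀ σ, σ.card ≠ k → z σ = 0)
    (hcycle : ∀ τ, boundary z τ = 0) (hm : ∀ σ, m ≤ level σ → z σ = 0)
    (hdvd : ∀ τ, pivot (level τ) ∉ τ → φ ^ weight (insert (pivot (level τ)) τ) ∣ φ * z τ) :
    ∃ y : Finset B → A, (∀ σ, σ.card ≠ k + 1 → y σ = 0) ∧ (∀ σ, φ ^ weight σ ∣ φ * y σ) ∧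
      ∀ τ, boundary y τ = z τ := by
  induction m generalizing z with
  | zero => exact ⟨0, by simp, by simp, fun τ => by simp [boundary, hm τ]⟩
  | succ m ih =>
    set y : Finset B → A := fun σ => if level σ = m then cone (pivot m) z σ else 0 with hy
    have hycard : ∀ σ, σ.card ≠ k + 1 → y σ = 0 := by
      intro σ hσ
      simp only [hy, cone]
      split_ifs with h1 h2
      · rw [hz, mul_zero]
        rw [Finset.card_erase_of_mem h2]
        have := Finset.card_pos.2 ⟨_, h2⟩
        omega
      all_goals rfl
    have hydvd : ∀ σ, φ ^ weight σ ∣ φ * y σ := by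
      intro σ
      simp only [hy, cone]
      split_ifs with h1 h2
      · have he := hp.level_erase σ
        rw [h1] at he
        have := hdvd (σ.erase (pivot m)) (by rw [he]; simp)
        rw [he, Finset.insert_erase h2] at this
        rw [mul_left_comm]
        exact this.mul_left _
      all_goals simp
    have hyb : ∀ τ, m ≤ level τ → boundary y τ = z τ := by
      intro τ hτ
      rcases hτ.lt_or_eq with hτ | hτ
      · rw [hm τ hτ, boundary]
        refine Finset.sum_eq_zero fun s _ => ?_
        have := hp.level_mono (Finset.subset_insert s τ)
        split_ifs
        · rfl
        · simp only [hy]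
          rw [if_neg (by omega), mul_zero]
      · have hcone : cone (pivot m) (boundary z) τ = 0 := by simp [cone, hcycle]
        rw [← boundary_cone (pivot m) z τ, hcone, add_zero, boundary, boundary]
        refine Finset.sum_congr rfl fun s _ => ?_
        split_ifs with hs
        · rfl
        · simp only [hy]
          split_ifs with h1
          · rfl
          · have h2 := hp.level_mono (Finset.subset_insert s τ)
            have hsm : s ≠ pivot m := by
              rintro rfl
              have := hp.level_insert τ
              rw [← hτ] at this
              exact h1 this
            rw [cone]
            split_ifs with h3
            · have h4 := hp.level_erase τ
              rw [← hτ] at h4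
              have h5 : level (τ.erase (pivot m)) ≤ level ((insert s τ).erase (pivot m)) :=
                hp.level_mono (Finset.erase_subset_erase _ (Finset.subset_insert s τ))
              have h6 : level ((insert s τ).erase (pivot m)) ≠ m := by
                intro h7
                have h8 := hp.level_insert ((insert s τ).erase (pivot m))
                rw [h7, Finset.insert_erase h3] at h8
                exact h1 h8
              rw [hm _ (by omega), mul_zero, mul_zero, mul_zero]
            · simp
    suffices h : ∃ y' : Finset B → A, (∀ σ, σ.card ≠ k + 1 → y' σ = 0) ∧
        (∀ σ, φ ^ weight σ ∣ φ * y' σ) ∧ ∀ τ, boundary y' τ = (z - boundary y) τ by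
      obtain ⟨y', hy'card, hy'dvd, hy'⟩ := h
      refine ⟨y + y', fun σ hσ => by simp [hycard σ hσ, hy'card σ hσ], fun σ => ?_, fun τ => ?_⟩
      · rw [Pi.add_apply, mul_add]
        exact dvd_add (hydvd σ) (hy'dvd σ)
      · rw [boundary_add, hy' τ]; simp
    refine ih (z - boundary y) ?_ ?_ ?_ ?_
    · intro τ hτ
      have : boundary y τ = 0 := by
        refine Finset.sum_eq_zero fun s _ => ?_
        split_ifs with hs
        · rfl
        · rw [hycard _ (by rw [Finset.card_insert_of_notMem hs]; omega), mul_zero]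
      simp [hz τ hτ, this]
    · intro τ
      rw [boundary_sub, hcycle, boundary_boundary, sub_zero]
    · intro τ hτ
      simp [hyb τ hτ]
    · intro τ hτ
      by_cases hlt : m ≤ level τ
      · simp [hyb τ hlt]
      rw [Pi.sub_apply, mul_sub]
      refine dvd_sub (hdvd τ hτ) ?_
      rw [boundary, Finset.mul_sum]
      refine Finset.dvd_sum fun s _ => ?_
      split_ifs with hs
      · simp
      by_cases h0 : y (insert s τ) = 0
      · simp [h0]
      have hcard : (insert s τ).card = k + 1 := by
        by_contra h; exact h0 (hycard _ h)
      have hlev : level (insert s τ) = m := by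
        by_contra h; exact h0 (by simp [hy, h])
      rw [mul_left_comm]
      refine ((pow_dvd_pow φ ?_).trans (hydvd _)).mul_left _
      refine hp.weight_insert_le τ s hs (fun h => ?_) (by omega) hτ
      rw [h, Finset.card_univ] at hcard
      omega

/-- A cycle below the top dimension whose values are divisible by the weight bounds a chain whose
values are divisible by the weight up to one factor. -/
lemma PivotData.exists_filling [Fintype B] {level weight : Finset B → ℕ}
    {pivot : ℕ → B} (hp : PivotData level weight pivot) (φ : A) {k : ℕ}
    (hk : k + 1 < Fintype.card B) (z : Finset B → A) (hz : ∀ σ, σ.card ≠ k → z σ = 0)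
    (hcycle : ∀ τ, boundary z τ = 0) (hdvd : ∀ τ, φ ^ weight τ ∣ z τ) :
    ∃ y : Finset B → A, (∀ σ, σ.card ≠ k + 1 → y σ = 0) ∧ (∀ σ, φ ^ weight σ ∣ φ * y σ) ∧
      ∀ τ, boundary y τ = z τ := by
  refine hp.exists_filling_of_level_lt φ hk (level Finset.univ + 1) z hz hcycle ?_ ?_
  · intro σ hσ
    have := hp.level_mono (Finset.subset_univ σ)
    omega
  · intro τ hτ
    by_cases h0 : z τ = 0
    · simp [h0]
    have hcard : τ.card = k := by
      by_contra h; exact h0 (hz _ h)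
    refine (pow_dvd_pow φ (hp.weight_insert τ hτ fun h => ?_)).trans ?_
    · have := congrArg Finset.card h
      rw [Finset.card_insert_of_notMem hτ, Finset.card_univ] at this
      omega
    · rw [pow_succ']
      exact mul_dvd_mul_left φ (hdvd τ)

end SignedComplex

namespace CoxeterSystem

open SignedComplex

variable {B : Type*} {W : Type*} [Group W]
  {M : CoxeterMatrix B} (cs : CoxeterSystem M W)

open Classical in
/-- The chain of the weighted complex rescaled by Poincaré polynomials, as a function on all
subsets: rescaling turns the weighted boundary into the simplicial one. -/
noncomputable def rescale (k : ℕ) (x : KW cs k → R) (σ : Finset B) : R :=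
  if h : σ.card = k ∧ (parabolic cs σ : Set W).Finite then
    toLaurent (poin cs σ) * x ⟨σ, h⟩ else 0

theorem rescale_coe {k : ℕ} (x : KW cs k → R) (σ : KW cs k) :
    rescale cs k x σ.1 = toLaurent (poin cs σ.1) * x σ := by
  rw [rescale, dif_pos σ.2]

theorem rescale_of_card_ne {k : ℕ} (x : KW cs k → R) {σ : Finset B} (h : σ.card ≠ k) :
    rescale cs k x σ = 0 := by
  rw [rescale, dif_neg (by tauto)]

theorem rescale_smul {k : ℕ} (r : R) (x : KW cs k → R) (σ : Finset B) :
    rescale cs k (r • x) σ = r * rescale cs k x σ := by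
  simp only [rescale]
  split_ifs
  · simp only [Pi.smul_apply, smul_eq_mul]; ring
  · simp

theorem rescale_injective (k : ℕ) : Function.Injective (rescale cs k) := by
  intro x y h
  funext σ
  have := congrFun h σ.1
  rw [rescale_coe, rescale_coe] at this
  refine mul_left_cancel₀ (fun h0 => poin_ne_zero cs σ.2.2 ?_) this
  exact toLaurent_injective (by rw [h0, map_zero])

variable [Fintype B] [LinearOrder B]

theorem toLaurent_poin_mul_bcoeff {σ τ : Finset B} (hσ : (parabolic cs σ : Set W).Finite) :
    toLaurent (poin cs τ) * bcoeff cs σ τ =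
      ∑ s, if s ∈ σ ∧ τ = σ.erase s then sign R s σ * toLaurent (poin cs σ) else 0 := by
  simp only [ite_and]
  rw [bcoeff, Finset.mul_sum, ← Finset.sum_filter]
  simp only [Finset.filter_mem_eq_inter, Finset.univ_inter]
  refine Finset.sum_congr rfl fun s hs => ?_
  split_ifs with h
  · have hdvd := poin_dvd_of_subset cs (h ▸ Finset.erase_subset s σ : τ ⊆ σ) hσ
    have hτ : poin cs τ ≠ 0 := poin_ne_zero cs (hσ.subset (parabolic_mono cs
      (h ▸ Finset.erase_subset s σ : τ ⊆ σ)))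
    rw [mul_left_comm, ← map_mul, EuclideanDomain.mul_div_cancel' hτ hdvd, sign]
  · simp

theorem rescale_bdry {k : ℕ} (x : KW cs (k + 1) → R) (τ : Finset B) :
    rescale cs k (bdry cs k x) τ = boundary (rescale cs (k + 1) x) τ := by
  by_cases h : τ.card = k ∧ (parabolic cs τ : Set W).Finite
  · rw [rescale, dif_pos h]
    have expand : toLaurent (poin cs τ) * bdry cs k x ⟨τ, h⟩ =
        ∑ σ : Finset B, ∑ s, if s ∈ σ ∧ τ = σ.erase s then
          sign R s σ * rescale cs (k + 1) x σ else 0 := by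
      rw [bdry, Matrix.mulVecLin_apply, Matrix.mulVec, dotProduct, Finset.mul_sum]
      refine Fintype.sum_of_injective Subtype.val Subtype.val_injective _ _ ?_ ?_
      · intro σ hσ
        refine Finset.sum_eq_zero fun s _ => ?_
        split_ifs
        · rw [rescale, dif_neg, mul_zero]
          exact fun h' => hσ ⟨⟨σ, h'⟩, rfl⟩
        · rfl
      · intro σ
        rw [Matrix.of_apply, ← mul_assoc, toLaurent_poin_mul_bcoeff cs σ.2.2, Finset.sum_mul]
        refine Finset.sum_congr rfl fun s _ => ?_
        rw [rescale_coe, ite_mul, zero_mul, mul_assoc]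
    rw [expand, Finset.sum_comm, boundary]
    refine Finset.sum_congr rfl fun s _ => ?_
    split_ifs with hs
    · refine Finset.sum_eq_zero fun σ _ => if_neg ?_
      rintro ⟨-, rfl⟩
      simp at hs
    · rw [Finset.sum_eq_single (insert s τ)]
      · rw [if_pos ⟨Finset.mem_insert_self s τ, (Finset.erase_insert hs).symm⟩,
          sign_insert_of_le le_rfl]
      · rintro σ - hσ
        refine if_neg ?_
        rintro ⟨h1, rfl⟩
        exact hσ (Finset.insert_erase h1).symm
      · simp
  · rw [rescale, dif_neg h, boundary, Finset.sum_eq_zero]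
    intro s _
    split_ifs with hs
    · rfl
    · rw [rescale, dif_neg, mul_zero]
      rintro ⟨h1, h2⟩
      rw [Finset.card_insert_of_notMem hs] at h1
      exact h ⟨by omega, h2.subset (parabolic_mono cs (Finset.subset_insert s τ))⟩

theorem boundary_rescale_of_mem_cycles {k : ℕ} {x : KW cs k → R} (hx : x ∈ cycles cs k)
    (τ : Finset B) : boundary (rescale cs k x) τ = 0 := by
  cases k with
  | zero =>
    refine Finset.sum_eq_zero fun s _ => ?_
    split_ifs
    · rfl
    · rw [rescale_of_card_ne cs x (by simp [Finset.card_eq_zero]), mul_zero]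
  | succ k =>
    have hx' : bdry cs k x = 0 := hx
    rw [← rescale_bdry, hx']
    simp [rescale]

end CoxeterSystem

namespace AffineD

open SignedComplex

theorem exists_poin_eq_pow_mul {d : ℕ} (hd : 0 < d) {p : ℚ[X]} (hp : p ≠ 0) :
    ∃ r : R, toLaurent p = cyc d ^ ord d p * r ∧ IsCoprime (cyc d) r := by
  obtain ⟨r, hr, hdvd⟩ := (finiteMultiplicity_cyclotomic hd hp).exists_eq_pow_mul_and_not_dvd
  refine ⟨toLaurent r, ?_, ?_⟩
  · conv_lhs => rw [hr]
    rw [map_mul, map_pow]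
    rfl
  · exact (((cyclotomic.irreducible_rat hd).coprime_iff_not_dvd).2 hdvd).map
      (toLaurent : ℚ[X] →+* LaurentPolynomial ℚ)

variable {n : ℕ}

/-- The set of indices of a set of nodes. -/
def indices (σ : Finset (Fin (n + 1))) : Finset ℕ := σ.map Fin.valEmbedding

theorem val_mem_indices {σ : Finset (Fin (n + 1))} {i : Fin (n + 1)} :
    i.val ∈ indices σ ↔ i ∈ σ := by
  simp [indices, Fin.val_inj]

theorem nodes_indices (σ : Finset (Fin (n + 1))) : nodes n (indices σ) = σ := by
  ext i
  rw [mem_nodes, val_mem_indices]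

theorem mem_indices_insert (σ : Finset (Fin (n + 1))) (x : Fin (n + 1)) (i : ℕ) (_ : i ≤ n) :
    i ∈ indices (insert x σ) ↔ i ∈ indices σ ∨ i = x.val := by
  simp only [indices, Finset.map_insert, Finset.mem_insert, Fin.valEmbedding_apply]
  tauto

theorem exists_notMem_indices {σ : Finset (Fin (n + 1))} (h : σ ≠ Finset.univ) :
    ∃ x, x ≤ n ∧ x ∉ indices σ := by
  obtain ⟨x, hx⟩ : ∃ x, x ∉ σ := by
    by_contra! hc
    exact h (Finset.eq_univ_iff_forall.2 hc)
  exact ⟨x.val, by omega, fun hm => hx (val_mem_indices.1 hm)⟩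

/-- The pivot as a node of the diagram. -/
noncomputable def pivotNode (n d k : ℕ) : Fin (n + 1) := ⟨min (pivot n d k) n, by omega⟩

theorem pivotNode_val (hn : 4 ≤ n) {d : ℕ} (hd : 2 ≤ d) (s : Finset ℕ) :
    (pivotNode n d (level n d s)).val = pivot n d (level n d s) :=
  min_eq_left (pivot_level_le hn hd s)

theorem pivotData (hn : 4 ≤ n) {M : CoxeterMatrix (Fin (n + 1))} (hM : IsAffineD n M)
    {W : Type*} [Group W] (cs : CoxeterSystem M W) {d : ℕ} (hd : 2 ≤ d) :
    PivotData (fun σ => level n d (indices σ)) (fun σ => ord d (poin cs σ)) (pivotNode n d) := by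
  have w := isWeight_ord_poin hn hM cs hd
  have hv := fun s => pivotNode_val hn hd s
  have hmono : ∀ {σ τ : Finset (Fin (n + 1))}, σ ⊆ τ →
      level n d (indices σ) ≤ level n d (indices τ) := fun h =>
    level_mono hn fun i _ hi => Finset.map_subset_map.2 h hi
  refine ⟨hmono, fun τ => ?_, fun σ => ?_, fun τ hτ hne => ?_, fun τ x hx hne hlt hτ => ?_⟩
  · exact le_antisymm (level_le_of_eq_pivot_left hn hd (mem_indices_insert _ _) (hv _))
      (hmono (Finset.subset_insert _ _))
  · by_cases h : pivotNode n d (level n d (indices σ)) ∈ σ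
    · refine le_antisymm (hmono (Finset.erase_subset _ _))
        (level_le_of_eq_pivot_right hn hd (fun i hi => ?_) (hv _))
      rw [← mem_indices_insert _ _ i hi, Finset.insert_erase h]
    · rw [Finset.erase_eq_of_notMem h]
  · have := w.fill_pivot hn hd (s := indices τ) (t := indices (insert _ τ))
      (by rwa [← hv, val_mem_indices]) (by rw [← hv]; exact mem_indices_insert _ _)
      (exists_notMem_indices hne)
    simpa only [nodes_indices] using this
  · have hcard : insert (pivotNode n d (level n d (indices τ))) τ ≠ Finset.univ := by
      intro h
      refine hne (Finset.eq_univ_of_card _ ?_)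
      rw [Finset.card_insert_of_notMem hx, ← Finset.card_insert_of_notMem hτ, h, Finset.card_univ]
    have := w.fill_pivot_le hn hd (s := indices τ) (x := x.val) (u := indices (insert x τ))
      (t := indices (insert (pivotNode n d (level n d (indices τ))) τ))
      (by rwa [val_mem_indices]) (by omega) (mem_indices_insert _ _) hlt
      (exists_notMem_indices hne)
      (by rwa [← hv, val_mem_indices]) (by rw [← hv]; exact mem_indices_insert _ _)
      (exists_notMem_indices hcard)
    simpa only [nodes_indices] using this

/-- Up to a multiplier coprime to `Φ_d`, the multiple `Φ_d • c` of a cycle is a boundary. -/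
theorem exists_isCoprime_smul_mem_range (hn : 4 ≤ n) {M : CoxeterMatrix (Fin (n + 1))}
    (hM : IsAffineD n M) {W : Type*} [Group W] (cs : CoxeterSystem M W) {d : ℕ} (hd : 2 ≤ d)
    {k : ℕ} (hk : k < n) {c : KW cs k → R} (hc : c ∈ cycles cs k) :
    ∃ u : R, IsCoprime (cyc d) u ∧ (u * cyc d) • c ∈ LinearMap.range (bdry cs k) := by
  have hfin : ∀ {σ : Finset (Fin (n + 1))}, (parabolic cs σ : Set W).Finite ↔ σ ≠ Finset.univ :=
    finite_iff hn hM cs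
  have hfac : ∀ σ : Finset (Fin (n + 1)), ∃ r : R, IsCoprime (cyc d) r ∧
      (σ ≠ Finset.univ → toLaurent (poin cs σ) = cyc d ^ ord d (poin cs σ) * r) := by
    intro σ
    by_cases h : σ = Finset.univ
    · exact ⟨1, isCoprime_one_right, fun h' => absurd h h'⟩
    · obtain ⟨r, hr, hcop⟩ := exists_poin_eq_pow_mul (d := d) (by omega)
        (poin_ne_zero cs (hfin.2 h))
      exact ⟨r, hcop, fun _ => hr⟩
  choose p hcop hp using hfac
  obtain ⟨y, hycard, hydvd, hy⟩ := (pivotData hn hM cs hd).exists_filling (cyc d) (k := k)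
    (by simp only [Fintype.card_fin]; omega) (rescale cs k c)
    (fun σ => rescale_of_card_ne cs c) (boundary_rescale_of_mem_cycles cs hc) (by
      intro σ
      rw [rescale]
      split_ifs with h
      · rw [hp σ (hfin.1 h.2), mul_assoc]
        exact dvd_mul_right _ _
      · exact dvd_zero _)
  choose a ha using hydvd
  refine ⟨∏ σ, p σ, IsCoprime.prod_right fun σ _ => hcop σ,
    fun σ => a σ.1 * ∏ ρ ∈ Finset.univ.erase σ.1, p ρ, rescale_injective cs k ?_⟩
  funext τ
  have hb : rescale cs (k + 1) (fun σ => a σ.1 * ∏ ρ ∈ Finset.univ.erase σ.1, p ρ) =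
      fun σ => ((∏ σ, p σ) * cyc d) * y σ := by
    funext σ
    rw [rescale]
    split_ifs with h
    · rw [hp σ (hfin.1 h.2), mul_assoc (∏ σ, p σ), ha σ,
        ← Finset.mul_prod_erase Finset.univ p (Finset.mem_univ σ)]
      ring
    · rw [hycard, mul_zero]
      intro hσ
      refine h ⟨hσ, hfin.2 ?_⟩
      rintro rfl
      simp only [Finset.card_univ, Fintype.card_fin] at hσ
      omega
  rw [rescale_bdry, hb, rescale_smul, ← hy τ, boundary, boundary, Finset.mul_sum]
  refine Finset.sum_congr rfl fun s _ => ?_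
  split_ifs
  · simp
  · ring

theorem smul_mem_range_of_sq_smul_mem_range (hn : 4 ≤ n) {M : CoxeterMatrix (Fin (n + 1))}
    (hM : IsAffineD n M) {W : Type*} [Group W] (cs : CoxeterSystem M W) {d : ℕ} (hd : 2 ≤ d)
    {k : ℕ} {c : KW cs k → R} (hc : c ∈ cycles cs k)
    (h : cyc d ^ 2 • c ∈ LinearMap.range (bdry cs k)) :
    cyc d • c ∈ LinearMap.range (bdry cs k) := by
  rcases lt_or_ge k n with hk | hk
  · obtain ⟨u, ⟨α, β, hαβ⟩, hu⟩ := exists_isCoprime_smul_mem_range hn hM cs hd hk hc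
    have : cyc d • c = α • cyc d ^ 2 • c + β • (u * cyc d) • c := by
      rw [smul_smul, smul_smul, ← add_smul]
      congr 1
      linear_combination (-cyc d) * hαβ
    rw [this]
    exact add_mem (Submodule.smul_mem _ _ h) (Submodule.smul_mem _ _ hu)
  · obtain ⟨y, hy⟩ := h
    have hempty : IsEmpty (KW cs (k + 1)) := by
      refine ⟨fun σ => (finite_iff hn hM cs).1 σ.2.2 (Finset.eq_univ_of_card _ ?_)⟩
      have h1 := σ.2.1
      have h2 := Finset.card_le_univ σ.1
      rw [Fintype.card_fin] at *
      omega
    rw [Subsingleton.elim y 0, map_zero] at hy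
    have hne : cyc d ^ 2 ≠ 0 := pow_ne_zero 2 fun h0 =>
      cyclotomic_ne_zero d ℚ (toLaurent_injective (by rw [map_zero]; exact h0))
    rw [(smul_eq_zero.1 hy.symm).resolve_left hne, smul_zero]
    exact zero_mem _

end AffineD

/-- The local homology of the Artin group of affine type `D̃ₙ` (`n ≥ 4`) has square-free
torsion: for every `k` and every `d ≥ 2`, the homology `H_k` of the weighted complex has
no `Φ_d²`-torsion. -/
theorem squarefree_torsion_affine_Dn (n : ℕ) (hn : 4 ≤ n) {W : Type*} [Group W]
    {Mat : CoxeterMatrix (Fin (n + 1))} (cs : CoxeterSystem Mat W)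
    (hM : ∀ i j : Fin (n + 1), i.val < j.val →
      Mat.M i j =
        (if (i.val = 0 ∧ j.val = 2) ∨ (i.val = 1 ∧ j.val = 2) ∨
            (2 ≤ i.val ∧ i.val ≤ n - 2 ∧ j.val = i.val + 1) ∨
            (i.val = n - 2 ∧ j.val = n) then 3
         else 2)) :
    ∀ k : ℕ, ∀ d : ℕ, 2 ≤ d → ∀ x : Hgy cs k, cyc d ^ 2 • x = 0 → cyc d • x = 0 := by
  intro k d hd x
  obtain ⟨c, rfl⟩ := Submodule.Quotient.mk_surjective _ x
  rw [← Submodule.Quotient.mk_smul, ← Submodule.Quotient.mk_smul, Submodule.Quotient.mk_eq_zero,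
    Submodule.Quotient.mk_eq_zero]
  exact AffineD.smul_mem_range_of_sq_smul_mem_range hn hM cs hd c.2
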